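/- Let p > 2 and k be distinct primes, and let q = p^r for some r ≥ 1 be such that q^k ≠ 9. Let M_1, M_2, M_3 ∈ Mat_{k×k}(F_q) be such that M_1 M_2 is an invertible matrix of order q^k − 1 and M_1 M_2 M_3 ≠ M_3 M_2 M_1. Then the subgroup of SL_{2k}(F_q) generated by the three block matrices ((I_k, M_1), (0, I_k)), ((I_k, 0), (M_2, I_k)) and ((I_k, M_3), (0, I_k)) is either isomorphic as a group to Sp_{2k}(F_q, Ω_k), or it equals the whole of SL_{2k}(F_q). -/

import Mathlib

open Matrix

/-- Assemble a `2 × 2` array of `k × k` blocks into a `2k × 2k` matrix. -/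
def blocks2 {k : ℕ} {F : Type*} (B : Matrix (Fin 2) (Fin 2) (Matrix (Fin k) (Fin k) F)) :
    Matrix (Fin 2 × Fin k) (Fin 2 × Fin k) F :=
  Matrix.of fun p q => B p.1 q.1 p.2 q.2

/-- The symplectic group `Sp(F, Ω) = {X ∈ GL : Xᵀ Ω X = Ω}`, as a subgroup of `GL`. -/
def SpGL {n : Type*} [Fintype n] [DecidableEq n] {F : Type*} [Field F]
    (Ω : Matrix n n F) : Subgroup (GL n F) where
  carrier := {g | (g : Matrix n n F)ᵀ * Ω * (g : Matrix n n F) = Ω}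
  one_mem' := by
    simp
  mul_mem' := by
    intro a b ha hb
    simp only [Set.mem_setOf_eq] at ha hb ⊢
    rw [Units.val_mul, Matrix.transpose_mul]
    calc (b : Matrix n n F)ᵀ * (a : Matrix n n F)ᵀ * Ω * ((a : Matrix n n F) * (b : Matrix n n F))
        = (b : Matrix n n F)ᵀ * ((a : Matrix n n F)ᵀ * Ω * (a : Matrix n n F)) *
            (b : Matrix n n F) := by noncomm_ring
      _ = (b : Matrix n n F)ᵀ * Ω * (b : Matrix n n F) := by rw [ha]
      _ = Ω := hb
  inv_mem' := by
    intro a ha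
    simp only [Set.mem_setOf_eq] at ha ⊢
    have h1 : (a : Matrix n n F) * ((a⁻¹ : GL n F) : Matrix n n F) = 1 := by
      rw [← Units.val_mul, mul_inv_cancel, Units.val_one]
    calc ((a⁻¹ : GL n F) : Matrix n n F)ᵀ * Ω * ((a⁻¹ : GL n F) : Matrix n n F)
        = ((a⁻¹ : GL n F) : Matrix n n F)ᵀ *
            ((a : Matrix n n F)ᵀ * Ω * (a : Matrix n n F)) *
            ((a⁻¹ : GL n F) : Matrix n n F) := by rw [ha]
      _ = ((a : Matrix n n F) * ((a⁻¹ : GL n F) : Matrix n n F))ᵀ * Ω *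
            ((a : Matrix n n F) * ((a⁻¹ : GL n F) : Matrix n n F)) := by
          rw [Matrix.transpose_mul]; noncomm_ring
      _ = Ω := by rw [h1]; simp

set_option linter.unusedSectionVars false

section Counting

variable {A X : Type*} [Group A] [Fintype A] [DecidableEq A] [MulAction A X] [DecidableEq X]

/-- The number of elements outside `{1, ε}` fixing a point, counted with weight `1 + [par g]`. -/
def fixWeight (ε : A) (par : A → Prop) [DecidablePred par] (x : X) : ℕ :=
  ∑ g ∈ Finset.univ.filter (fun g : A => g • x = x ∧ g ≠ 1 ∧ g ≠ ε), (if par g then 2 else 1)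

variable {ε : A} {par : A → Prop} [DecidablePred par]

theorem fixWeight_smul (hc : ∀ g, ε * g = g * ε) (hpar : ∀ g h, par (h * g * h⁻¹) ↔ par g)
    (x : X) (h : A) : fixWeight ε par (h • x) = fixWeight ε par x := by
  unfold fixWeight
  symm
  apply Finset.sum_bij (fun g _ => h * g * h⁻¹)
  · intro g hg
    simp only [Finset.mem_filter, Finset.mem_univ, true_and] at hg ⊢
    refine ⟨?_, ?_, ?_⟩
    · simp [mul_smul, hg.1]
    · intro h1
      apply hg.2.1
      have : g = h⁻¹ * (h * g * h⁻¹) * h := by group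
      rw [this, h1]; group
    · intro h1
      apply hg.2.2
      have : g = h⁻¹ * (h * g * h⁻¹) * h := by group
      rw [this, h1, mul_assoc, hc]; group
  · intro a _ b _ hab
    simpa using hab
  · intro b hb
    simp only [Finset.mem_filter, Finset.mem_univ, true_and] at hb
    refine ⟨h⁻¹ * b * h, ?_, by group⟩
    simp only [Finset.mem_filter, Finset.mem_univ, true_and]
    refine ⟨?_, ?_, ?_⟩
    · rw [mul_smul, mul_smul, hb.1, inv_smul_smul]
    · intro h1
      apply hb.2.1
      have : b = h * (h⁻¹ * b * h) * h⁻¹ := by group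
      rw [this, h1]; group
    · intro h1
      apply hb.2.2
      have : b = h * (h⁻¹ * b * h) * h⁻¹ := by group
      rw [this, h1, ← hc]; group
  · intro a _
    simp [hpar]

theorem sum_fixWeight (fix : A → Finset X)
    (hfix : ∀ g, g ≠ 1 → g ≠ ε → ∀ x, x ∈ fix g ↔ g • x = x)
    (hcard : ∀ g, g ≠ 1 → g ≠ ε → (fix g).card * (if par g then 2 else 1) = 2)
    (hε : ε ≠ 1) (Z : Finset X) :
    ∑ x ∈ Z, fixWeight ε par x ≤ 2 * (Fintype.card A - 2) ∧
    ((∀ g, g ≠ 1 → g ≠ ε → fix g ⊆ Z) →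
      ∑ x ∈ Z, fixWeight ε par x = 2 * (Fintype.card A - 2)) := by
  have h1 : ∑ x ∈ Z, fixWeight ε par x =
      ∑ g ∈ Finset.univ.filter (fun g : A => g ≠ 1 ∧ g ≠ ε),
        (Z ∩ fix g).card * (if par g then 2 else 1) := by
    unfold fixWeight
    rw [Finset.sum_comm' (t' := Finset.univ.filter (fun g : A => g ≠ 1 ∧ g ≠ ε))
      (s' := fun g => Z ∩ fix g)]
    · simp
    · intro x g
      simp only [Finset.mem_filter, Finset.mem_univ, true_and, Finset.mem_inter]
      constructor
      · rintro ⟨h1, h2, h3, h4⟩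
        exact ⟨⟨h1, (hfix g h3 h4 x).2 h2⟩, h3, h4⟩
      · rintro ⟨⟨h1, h2⟩, h3, h4⟩
        exact ⟨h1, (hfix g h3 h4 x).1 h2, h3, h4⟩
  have h2 : (Finset.univ.filter (fun g : A => g ≠ 1 ∧ g ≠ ε)).card = Fintype.card A - 2 := by
    have : Finset.univ.filter (fun g : A => g ≠ 1 ∧ g ≠ ε) = Finset.univ \ {1, ε} := by
      ext g; simp
    rw [this, Finset.card_sdiff, Finset.inter_univ, Finset.card_pair hε.symm, Finset.card_univ]
  rw [h1]
  constructor
  · calc _ ≤ ∑ g ∈ Finset.univ.filter (fun g : A => g ≠ 1 ∧ g ≠ ε), 2 := by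
          apply Finset.sum_le_sum
          intro g hg
          simp only [Finset.mem_filter, Finset.mem_univ, true_and] at hg
          refine le_of_le_of_eq ?_ (hcard g hg.1 hg.2)
          apply Nat.mul_le_mul_right
          apply Finset.card_le_card
          exact Finset.inter_subset_right
      _ = _ := by rw [Finset.sum_const, h2, smul_eq_mul, mul_comm]
  · intro h
    rw [mul_comm 2, ← h2, ← smul_eq_mul, ← Finset.sum_const]
    apply Finset.sum_congr rfl
    intro g hg
    simp only [Finset.mem_filter, Finset.mem_univ, true_and] at hg
    rw [Finset.inter_eq_right.2 (h g hg.1 hg.2), hcard g hg.1 hg.2]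

/-- The orbit of a point as a finset. -/
def orbFinset (A : Type*) {X : Type*} [Group A] [Fintype A] [MulAction A X] [DecidableEq X]
    (x : X) : Finset X := Finset.univ.image (fun g : A => g • x)

theorem mem_orbFinset {x y : X} : y ∈ orbFinset A x ↔ ∃ g : A, g • x = y := by
  simp [orbFinset]

theorem card_orbFinset_mul (x : X) :
    (orbFinset A x).card * (Finset.univ.filter (fun g : A => g • x = x)).card
      = Fintype.card A := by
  classical
  have hfin : (MulAction.orbit A x).Finite := Set.finite_range _
  let _ : Fintype (MulAction.orbit A x) := hfin.fintype
  have := MulAction.card_orbit_mul_card_stabilizer_eq_card_group A x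
  rw [← this]
  congr 1
  · rw [← Set.toFinset_card]
    congr 1
    ext y
    simp [mem_orbFinset, MulAction.mem_orbit_iff]
  · rw [Fintype.card_subtype]
    congr 1

theorem sum_orbFinset (hc : ∀ g, ε * g = g * ε) (hpar : ∀ g h, par (h * g * h⁻¹) ↔ par g)
    (x : X) : ∑ y ∈ orbFinset A x, fixWeight ε par y
      = (orbFinset A x).card * fixWeight ε par x := by
  rw [← smul_eq_mul, ← Finset.sum_const]
  apply Finset.sum_congr rfl
  intro y hy
  obtain ⟨g, rfl⟩ := mem_orbFinset.1 hy
  exact fixWeight_smul hc hpar x g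

theorem orbFinset_disjoint {x y : X} (h : y ∉ orbFinset A x) :
    Disjoint (orbFinset A x) (orbFinset A y) := by
  rw [Finset.disjoint_left]
  intro z hz hz'
  obtain ⟨g, rfl⟩ := mem_orbFinset.1 hz
  obtain ⟨g', hg'⟩ := mem_orbFinset.1 hz'
  apply h
  rw [mem_orbFinset]
  exact ⟨g'⁻¹ * g, by rw [mul_smul, ← hg', inv_smul_smul]⟩

theorem fixWeight_eq (hε : ε ≠ 1) (hεx : ∀ x : X, ε • x = x) (x : X) :
    fixWeight ε par x + 2 = (Finset.univ.filter (fun g : A => g • x = x)).card +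
      (Finset.univ.filter (fun g : A => g • x = x ∧ g ≠ 1 ∧ g ≠ ε ∧ par g)).card := by
  have h1 : fixWeight ε par x =
      (Finset.univ.filter (fun g : A => g • x = x ∧ g ≠ 1 ∧ g ≠ ε)).card +
      (Finset.univ.filter (fun g : A => g • x = x ∧ g ≠ 1 ∧ g ≠ ε ∧ par g)).card := by
    unfold fixWeight
    have : ∀ g : A, (if par g then 2 else 1) = 1 + if par g then 1 else 0 := by
      intro g; split_ifs <;> rfl
    simp only [this]
    rw [Finset.sum_add_distrib, Finset.sum_const, smul_eq_mul, mul_one, ← Finset.sum_filter,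
      Finset.sum_const, smul_eq_mul, mul_one, Finset.filter_filter]
    simp only [and_assoc]
  have h2 : (Finset.univ.filter (fun g : A => g • x = x ∧ g ≠ 1 ∧ g ≠ ε)).card + 2 =
      (Finset.univ.filter (fun g : A => g • x = x)).card := by
    have : Finset.univ.filter (fun g : A => g • x = x ∧ g ≠ 1 ∧ g ≠ ε) =
        Finset.univ.filter (fun g : A => g • x = x) \ {1, ε} := by
      ext g; simp
    rw [this, Finset.card_sdiff_of_subset, Finset.card_pair hε.symm, Nat.sub_add_cancel]
    · rw [← Finset.card_pair hε.symm]
      apply Finset.card_le_card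
      intro g; simp only [Finset.mem_insert, Finset.mem_singleton, Finset.mem_filter,
        Finset.mem_univ, true_and]
      rintro (rfl | rfl) <;> simp [hεx]
    · intro g; simp only [Finset.mem_insert, Finset.mem_singleton, Finset.mem_filter,
        Finset.mem_univ, true_and]
      rintro (rfl | rfl) <;> simp [hεx]
  omega


theorem even_card_of_involution {α : Type*} (s : Finset α) (f : α → α) (hf : ∀ a ∈ s, f a ∈ s)
    (hne : ∀ a ∈ s, f a ≠ a) (hff : ∀ a ∈ s, f (f a) = a) : Even s.card := by
  have : ∑ a ∈ s, (1 : ZMod 2) = 0 :=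
    Finset.sum_involution (fun a _ => f a) (fun _ _ => by decide)
      (fun a ha _ => hne a ha) hf hff
  rw [Finset.sum_const, nsmul_eq_mul, mul_one] at this
  exact (ZMod.natCast_eq_zero_iff_even).1 this

theorem even_card_filter_smul (hε : ε ≠ 1) (hε2 : ε * ε = 1) (hεx : ∀ x : X, ε • x = x)
    (x : X) : Even (Finset.univ.filter (fun g : A => g • x = x)).card := by
  apply even_card_of_involution _ (fun g => ε * g)
  · intro g; simp [mul_smul, hεx]
  · intro g _; simpa using hε
  · intro g _; simp [← mul_assoc, hε2]

/-- If `g` fixes `x` and `g ≠ ±1`, the total weight of the orbit of `x` is at least `|A| / 2`, and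
at least `|A|` when `g` is parabolic. -/
theorem card_le_weight_orbFinset (hε : ε ≠ 1) (hε2 : ε * ε = 1) (hεx : ∀ x : X, ε • x = x)
    (hpar : ∀ g, par g → par (ε * g)) {x : X} {g : A} (hg : g • x = x) (h1 : g ≠ 1)
    (h2 : g ≠ ε) :
    Fintype.card A ≤ 2 * ((orbFinset A x).card * fixWeight ε par x) ∧
    (par g → Fintype.card A ≤ (orbFinset A x).card * fixWeight ε par x) := by
  have hw := fixWeight_eq (par := par) hε hεx x
  have hsub : ({1, ε, g, ε * g} : Finset A) ⊆ Finset.univ.filter (fun g : A => g • x = x) := by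
    intro h
    simp only [Finset.mem_insert, Finset.mem_singleton, Finset.mem_filter, Finset.mem_univ,
      true_and]
    rintro (rfl | rfl | rfl | rfl) <;> simp [hεx, hg, mul_smul]
  have hne : g ≠ ε * g := by simpa [eq_comm] using hε
  have hn1 : 1 ≠ ε * g := by
    intro h
    apply h2
    calc g = ε * (ε * g) := by rw [← mul_assoc, hε2, one_mul]
      _ = ε := by rw [← h, mul_one]
  have hn2 : ε ≠ ε * g := by simpa using h1
  have h4 := Finset.card_le_card hsub
  rw [Finset.card_insert_of_notMem (by simp [hε.symm, h1.symm, hn1]),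
    Finset.card_insert_of_notMem (by simp [h2.symm, hn2]), Finset.card_pair hne] at h4
  have hm := card_orbFinset_mul (A := A) x
  rw [← hm]
  constructor
  · rw [mul_left_comm]
    apply Nat.mul_le_mul_left
    omega
  · intro hp
    apply Nat.mul_le_mul_left
    have h5 : ({g, ε * g} : Finset A) ⊆
        Finset.univ.filter (fun g : A => g • x = x ∧ g ≠ 1 ∧ g ≠ ε ∧ par g) := by
      intro h
      simp only [Finset.mem_insert, Finset.mem_singleton, Finset.mem_filter, Finset.mem_univ,
        true_and]
      rintro (rfl | rfl)
      · exact ⟨hg, h1, h2, hp⟩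
      · exact ⟨by rw [mul_smul, hg, hεx], hn1.symm, hn2.symm, hpar _ hp⟩
    have h6 := Finset.card_le_card h5
    rw [Finset.card_pair hne] at h6
    omega

/-- The orbit count behind Dickson's theorem. -/
theorem orbit_analysis (hc : ∀ g, ε * g = g * ε) (hε : ε ≠ 1) (hε2 : ε * ε = 1)
    (hεx : ∀ x : X, ε • x = x)
    (hpar : ∀ g h, par (h * g * h⁻¹) ↔ par g) (hparε : ∀ g, par g → par (ε * g))
    (fix : A → Finset X)
    (hfix : ∀ g, g ≠ 1 → g ≠ ε → ∀ x, x ∈ fix g ↔ g • x = x)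
    (hcard : ∀ g, g ≠ 1 → g ≠ ε → (fix g).card * (if par g then 2 else 1) = 2)
    (o : X) (P n : ℕ) (hP : 3 ≤ P) (hn : Even n)
    (hst : (Finset.univ.filter (fun g : A => g • o = o)).card = P * n)
    (hpo : (Finset.univ.filter (fun g : A => g • o = o ∧ g ≠ 1 ∧ g ≠ ε ∧ par g)).card
      = 2 * (P - 1))
    (hm : 3 ≤ (orbFinset A o).card) :
    (∀ x g, g • x = x → g ≠ 1 → g ≠ ε → par g → x ∈ orbFinset A o) ∧
    ∃ d, Even d ∧ ((orbFinset A o).card * (P - 2) + 2) * d = (orbFinset A o).card * (P * n) := by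
  set m := (orbFinset A o).card with hmdef
  have hw := fixWeight_eq (par := par) hε hεx o
  have hA := card_orbFinset_mul (A := A) o
  rw [← hmdef, hst] at hA
  rw [hst, hpo] at hw
  have hsum := sum_orbFinset (ε := ε) (par := par) hc hpar o
  rw [← hmdef] at hsum
  obtain ⟨Q, rfl⟩ : ∃ Q, P = Q + 2 := ⟨P - 2, by omega⟩
  have hw' : fixWeight ε par o = (Q + 2) * n + 2 * Q := by omega
  have htot : m * fixWeight ε par o = Fintype.card A + 2 * (m * Q) := by
    rw [hw', ← hA]; ring
  have hmQ : 3 ≤ m * Q := by nlinarith [show 1 ≤ Q by omega]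
  rw [show Q + 2 - 2 = Q by omega]
  have hfirst : ∀ x g, g • x = x → g ≠ 1 → g ≠ ε → par g → x ∈ orbFinset A o := by
    intro x g hg h1 h2 hp
    by_contra hx
    have hl := (card_le_weight_orbFinset hε hε2 hεx hparε hg h1 h2).2 hp
    have := (sum_fixWeight (par := par) fix hfix hcard hε (orbFinset A o ∪ orbFinset A x)).1
    rw [Finset.sum_union (orbFinset_disjoint hx), hsum, sum_orbFinset hc hpar, htot] at this
    omega
  refine ⟨hfirst, ?_⟩
  by_cases hz : ∃ z g, g • z = z ∧ g ≠ 1 ∧ g ≠ ε ∧ z ∉ orbFinset A o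
  · obtain ⟨z, g, hg, h1, h2, hzo⟩ := hz
    have hl := (card_le_weight_orbFinset hε hε2 hεx hparε hg h1 h2).1
    have hall := (sum_fixWeight (par := par) fix hfix hcard hε (orbFinset A o ∪ orbFinset A z)).2
    rw [Finset.sum_union (orbFinset_disjoint hzo), hsum, sum_orbFinset hc hpar, htot] at hall
    have hall := hall (by
      intro h hh1 hh2 x hx
      by_contra hxz
      rw [Finset.mem_union, not_or] at hxz
      have hfx := (hfix h hh1 hh2 x).1 hx
      have hl' := (card_le_weight_orbFinset hε hε2 hεx hparε hfx hh1 hh2).1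
      have := (sum_fixWeight (par := par) fix hfix hcard hε
        (orbFinset A o ∪ orbFinset A z ∪ orbFinset A x)).1
      rw [Finset.sum_union, Finset.sum_union (orbFinset_disjoint hzo), hsum,
        sum_orbFinset hc hpar, sum_orbFinset hc hpar, htot] at this
      · omega
      · rw [Finset.disjoint_union_left]
        exact ⟨orbFinset_disjoint hxz.1, orbFinset_disjoint hxz.2⟩)
    have hwz := fixWeight_eq (par := par) hε hεx z
    have hno : (Finset.univ.filter (fun g : A => g • z = z ∧ g ≠ 1 ∧ g ≠ ε ∧ par g)) = ∅ := by
      rw [Finset.filter_eq_empty_iff]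
      rintro g _ ⟨hg, h1, h2, hp⟩
      exact hzo (hfirst z g hg h1 h2 hp)
    rw [hno, Finset.card_empty, add_zero] at hwz
    have hAz := card_orbFinset_mul (A := A) z
    rw [← hwz] at hAz
    refine ⟨_, even_card_filter_smul hε hε2 hεx z, ?_⟩
    rw [← hwz, hA, ← hAz]
    congr 1
    rw [mul_add] at hAz
    omega
  · push Not at hz
    exfalso
    have hall := (sum_fixWeight (par := par) fix hfix hcard hε (orbFinset A o)).2 (by
      intro h hh1 hh2 x hx
      exact hz x h ((hfix h hh1 hh2 x).1 hx) hh1 hh2)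
    rw [hsum, htot, ← hA] at hall
    obtain ⟨n', rfl⟩ := hn
    have hn' : 1 ≤ n' := by
      rcases Nat.eq_zero_or_pos n' with h | h
      · subst h
        rw [add_zero, mul_zero, mul_zero] at hA
        exact absurd hA.symm Fintype.card_ne_zero
      · exact h
    obtain ⟨c, rfl⟩ : ∃ c, n' = c + 1 := ⟨n' - 1, by omega⟩
    have h7 : m * (Q + 2) * (c + 1) = 2 + m * Q := by
      have : m * ((Q + 2) * (c + 1 + (c + 1))) = 2 * (m * (Q + 2) * (c + 1)) := by ring
      rw [this] at hall
      have : 3 * 1 ≤ m * (Q + 2) * (c + 1) := Nat.mul_le_mul (by nlinarith) (by omega)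
      omega
    nlinarith [Nat.zero_le (m * Q * c), Nat.zero_le (m * c)]

end Counting

/-- The unipotent element `!![1, x; 0, 1]`. -/
def upU {E : Type*} [Ring E] (x : E) : (Matrix (Fin 2) (Fin 2) E)ˣ where
  val := !![1, x; 0, 1]
  inv := !![1, -x; 0, 1]
  val_inv := by simp [Matrix.one_fin_two]
  inv_val := by simp [Matrix.one_fin_two]

/-- The unipotent element `!![1, 0; x, 1]`. -/
def loU {E : Type*} [Ring E] (x : E) : (Matrix (Fin 2) (Fin 2) E)ˣ where
  val := !![1, 0; x, 1]
  inv := !![1, 0; -x, 1]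
  val_inv := by simp [Matrix.one_fin_two]
  inv_val := by simp [Matrix.one_fin_two]

section Ring
variable {E : Type*} [Ring E]

theorem upU_val (x : E) : (upU x : Matrix (Fin 2) (Fin 2) E) = !![1, x; 0, 1] := rfl
theorem loU_val (x : E) : (loU x : Matrix (Fin 2) (Fin 2) E) = !![1, 0; x, 1] := rfl
theorem upU_inv_val (x : E) : ((upU x)⁻¹ : (Matrix (Fin 2) (Fin 2) E)ˣ) = upU (-x) :=
  Units.ext rfl
theorem loU_inv_val (x : E) : ((loU x)⁻¹ : (Matrix (Fin 2) (Fin 2) E)ˣ) = loU (-x) :=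
  Units.ext rfl

theorem upU_add (x y : E) : upU (x + y) = upU x * upU y := by
  ext1; simp [upU_val, add_comm]
theorem loU_add (x y : E) : loU (x + y) = loU x * loU y := by
  ext1; simp [loU_val]
theorem upU_zero : upU (0 : E) = 1 := by
  ext1; simp [upU_val, Matrix.one_fin_two]
theorem upU_injective : Function.Injective (upU : E → _) := by
  intro x y h
  simpa [upU_val] using congrArg (fun g : (Matrix (Fin 2) (Fin 2) E)ˣ => g.val 0 1) h

end Ring

section Proj
variable {L : Type*} [Field L] [DecidableEq L]

open OnePoint

theorem gl_fix [IsAlgClosed L] (h2 : (2 : L) ≠ 0) (g : GL (Fin 2) L)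
    (hdet : g.val 0 0 * g.val 1 1 - g.val 0 1 * g.val 1 0 = 1) (h1 : g ≠ 1) (hm1 : g ≠ -1) :
    ∃ F : Finset (OnePoint L), (∀ x, x ∈ F ↔ g • x = x) ∧
      F.card * (if (g.val 0 0 + g.val 1 1) ^ 2 = 4 then 2 else 1) = 2 := by
  classical
  obtain ⟨a, ha⟩ : ∃ a, g.val 0 0 = a := ⟨_, rfl⟩
  obtain ⟨b, hb⟩ : ∃ a, g.val 0 1 = a := ⟨_, rfl⟩
  obtain ⟨c, hc⟩ : ∃ a, g.val 1 0 = a := ⟨_, rfl⟩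
  obtain ⟨d, hd⟩ : ∃ a, g.val 1 1 = a := ⟨_, rfl⟩
  rw [ha, hb, hc, hd] at hdet
  rw [ha, hd]
  have hinf : g • (∞ : OnePoint L) = ∞ ↔ c = 0 := by
    rw [smul_infty_eq_self_iff, hc]
  have hsome : ∀ x : L, g • (x : OnePoint L) = x ↔ c * x ^ 2 + (d - a) * x - b = 0 := by
    intro x
    rw [smul_some_eq_ite, ha, hb, hc, hd]
    split_ifs with h
    · constructor
      · intro h'; exact absurd h' (infty_ne_coe x)
      · intro h'
        exfalso
        have h3 : a * x + b = 0 := by linear_combination x * h - h'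
        have : (1 : L) = 0 := by linear_combination (- hdet + a * h - c * h3)
        exact one_ne_zero this
    · rw [OnePoint.coe_eq_coe, div_eq_iff h]
      constructor <;> intro h' <;> linear_combination -h'
  by_cases hc0 : c = 0
  · subst hc0
    have had : a * d = 1 := by linear_combination hdet
    by_cases hadeq : a = d
    · subst hadeq
      have hb0 : b ≠ 0 := by
        rintro rfl
        have : (a - 1) * (a + 1) = 0 := by linear_combination had
        rcases mul_eq_zero.1 this with h | h
        · apply h1
          have : a = 1 := by linear_combination h
          ext i j; fin_cases i <;> fin_cases j <;> simp [ha, hb, hc, hd, this]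
        · apply hm1
          have : a = -1 := by linear_combination h
          ext i j; fin_cases i <;> fin_cases j <;> simp [ha, hb, hc, hd, this]
      refine ⟨{∞}, ?_, ?_⟩
      · intro x
        induction x using OnePoint.rec with
        | infty => simp [hinf]
        | coe x => simp [hsome, hb0]
      · rw [if_pos (by linear_combination 4 * had)]; simp
    · have hda : d - a ≠ 0 := sub_ne_zero.2 (Ne.symm hadeq)
      refine ⟨{∞, ((b / (d - a) : L) : OnePoint L)}, ?_, ?_⟩
      · intro x
        induction x using OnePoint.rec with
        | infty => simp [hinf]
        | coe x =>
          simp only [Finset.mem_insert, coe_ne_infty, Finset.mem_singleton, OnePoint.coe_eq_coe,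
            false_or, hsome]
          rw [eq_div_iff hda]
          constructor <;> intro h <;> linear_combination h
      · rw [if_neg, Finset.card_pair (infty_ne_coe _)]
        intro h
        have : (d - a) ^ 2 = 0 := by linear_combination h - 4 * had
        exact hda (pow_eq_zero_iff (two_ne_zero) |>.1 this)
  · obtain ⟨r, hr⟩ := IsAlgClosed.exists_pow_nat_eq ((a + d) ^ 2 - 4) (n := 2) (by norm_num)
    have h2c : 2 * c ≠ 0 := mul_ne_zero h2 hc0
    refine ⟨{(((a - d + r) / (2 * c) : L) : OnePoint L),
      (((a - d - r) / (2 * c) : L) : OnePoint L)},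
      ?_, ?_⟩
    · intro x
      induction x using OnePoint.rec with
      | infty => simp [hinf, hc0]
      | coe x =>
        simp only [Finset.mem_insert, Finset.mem_singleton, OnePoint.coe_eq_coe, hsome]
        rw [eq_div_iff h2c, eq_div_iff h2c, ← sub_eq_zero, ← sub_eq_zero (b := a - d - r),
          ← mul_eq_zero]
        have : (x * (2 * c) - (a - d + r)) * (x * (2 * c) - (a - d - r)) =
          (4 * c) * (c * x ^ 2 + (d - a) * x - b) := by linear_combination -hr - 4 * hdet
        rw [this, mul_eq_zero]
        have h4c : 4 * c ≠ 0 := by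
          have : (4 : L) * c = 2 * (2 * c) := by ring
          rw [this]; exact mul_ne_zero h2 h2c
        simp [h4c]
    · split_ifs with h
      · have : r = 0 := by
          rw [h, sub_self] at hr
          exact pow_eq_zero_iff (two_ne_zero) |>.1 hr
        subst this
        simp
      · rw [Finset.card_pair]
        intro h'
        rw [OnePoint.coe_eq_coe, div_left_inj' h2c] at h'
        have : 2 * r = 0 := by linear_combination h'
        rcases mul_eq_zero.1 this with h' | h'
        · exact h2 h'
        · apply h; rw [h'] at hr; linear_combination -hr

end Proj

theorem dickson_numerics {m f P n d : ℕ} (hm : m = 1 + f * P) (hP : 3 ≤ P) (hf : f ≠ 0)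
    (hn : Even n) (hd : Even d) (hn0 : n ≠ 0) (hnP : n ≤ 2 * (P - 1))
    (h : (m * (P - 2) + 2) * d = m * (P * n)) : (f = 1 ∧ P - 1 ≤ n) ∨ (f = 3 ∧ P = 3) := by
  obtain ⟨Q, rfl⟩ : ∃ Q, P = Q + 2 := ⟨P - 2, by omega⟩
  obtain ⟨n', rfl⟩ := hn
  obtain ⟨d', rfl⟩ := hd
  rw [show Q + 2 - 2 = Q by omega] at h
  have h1 : (1 + f * Q) * d' = (1 + f * Q + 2 * f) * n' := by
    subst hm
    have : 2 * (Q + 2) * ((1 + f * Q) * d') = 2 * (Q + 2) * ((1 + f * Q + 2 * f) * n') := by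
      linarith [h]
    exact Nat.eq_of_mul_eq_mul_left (by positivity) this
  have h2 : (1 + f * Q) ∣ n' + n' := by
    have h3 : (1 + f * Q) ∣ f * (n' + n') := by
      have h4 : (1 + f * Q) ∣ (1 + f * Q) * n' + f * (n' + n') := ⟨d', by rw [h1]; ring⟩
      exact (Nat.dvd_add_right (Dvd.intro _ rfl)).1 h4
    refine Nat.Coprime.dvd_of_dvd_mul_left ?_ h3
    simp
  obtain ⟨j, hj⟩ := h2
  have hj0 : j ≠ 0 := by rintro rfl; omega
  have hle : 1 + f * Q ≤ n' + n' := by rw [hj]; exact Nat.le_mul_of_pos_right _ (by omega)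
  rcases Nat.lt_or_ge f 3 with hf3 | hf3
  · interval_cases f
    · exact absurd rfl hf
    · left; omega
    · exfalso
      rcases Nat.lt_or_ge j 2 with hj2 | hj2
      · have : j = 1 := by omega
        subst this
        omega
      · have : (1 + 2 * Q) * 2 ≤ (1 + 2 * Q) * j := Nat.mul_le_mul_left _ hj2
        omega
  · right
    have h5 : 3 * Q ≤ f * Q := Nat.mul_le_mul_right _ hf3
    have : Q = 1 := by omega
    subst this
    omega

theorem card_dvd_card_of_add_mem {L : Type*} [AddCommGroup L] [DecidableEq L] (V : AddSubgroup L)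
    (Vf S : Finset L) (hV : ∀ x, x ∈ Vf ↔ x ∈ V) (hS : ∀ x ∈ S, ∀ v ∈ V, x + v ∈ S) :
    Vf.card ∣ S.card := by
  classical
  rw [Finset.card_eq_sum_card_image (QuotientAddGroup.mk : L → L ⧸ V) S]
  apply Finset.dvd_sum
  intro b hb
  obtain ⟨x, hx, rfl⟩ := Finset.mem_image.1 hb
  apply dvd_of_eq
  apply Finset.card_bij (fun v _ => x + v)
  · intro v hv
    rw [hV] at hv
    simp only [Finset.mem_filter]
    exact ⟨hS x hx v hv, by simpa using hv⟩
  · intro a _ b _ h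
    exact add_left_cancel h
  · intro y hy
    rw [Finset.mem_filter] at hy
    refine ⟨-x + y, ?_, by abel⟩
    rw [hV]
    exact QuotientAddGroup.eq.1 hy.2.symm

section Dickson

variable {L : Type*} [Field L] [DecidableEq L]

open OnePoint

/-- The additive group of upper unipotent entries. -/
def unipSub {E : Type*} [Ring E] (G : Subgroup (Matrix (Fin 2) (Fin 2) E)ˣ) : AddSubgroup E where
  carrier := {x | upU x ∈ G}
  zero_mem' := by
    change upU 0 ∈ G
    rw [upU_zero]; exact one_mem _
  add_mem' := by
    intro a b ha hb
    change upU (a + b) ∈ G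
    rw [upU_add]; exact mul_mem ha hb
  neg_mem' := by
    intro a ha
    change upU (-a) ∈ G
    rw [← upU_inv_val]; exact inv_mem ha

theorem mem_unipSub {E : Type*} [Ring E] {G : Subgroup (Matrix (Fin 2) (Fin 2) E)ˣ} {x : E} :
    x ∈ unipSub G ↔ upU x ∈ G := Iff.rfl

variable (G : Subgroup (GL (Fin 2) L))

theorem borel_mul_upU
    (hdet : ∀ g ∈ G, g.val 0 0 * g.val 1 1 - g.val 0 1 * g.val 1 0 = 1)
    {g : GL (Fin 2) L} (hg : g ∈ G) (hg0 : g.val 1 0 = 0) {x : L} (hx : x ∈ unipSub G) :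
    g.val 0 0 ^ 2 * x ∈ unipSub G := by
  have h := hdet g hg
  rw [hg0] at h
  rw [mem_unipSub] at hx ⊢
  have : upU (g.val 0 0 ^ 2 * x) = g * upU x * g⁻¹ := by
    rw [eq_mul_inv_iff_mul_eq]
    ext i j
    fin_cases i <;> fin_cases j <;>
      simp [upU_val, Matrix.mul_apply, Fin.sum_univ_two, hg0]
    linear_combination (g.val 0 0 * x) * h
  rw [this]
  exact mul_mem (mul_mem hg hx) (inv_mem hg)

theorem card_borel_filter
    (hdet : ∀ g ∈ G, g.val 0 0 * g.val 1 1 - g.val 0 1 * g.val 1 0 = 1)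
    [Fintype G] [DecidableEq (OnePoint L)] (Vf : Finset L)
    (hV : ∀ x, x ∈ Vf ↔ x ∈ unipSub G) :
    (Finset.univ.filter (fun g : G => g • (∞ : OnePoint L) = ∞)).card = Vf.card *
      ((Finset.univ.filter (fun g : G => g • (∞ : OnePoint L) = ∞)).image
        (fun g => g.1.val 0 0)).card := by
  have hinf : ∀ g : G, g • (∞ : OnePoint L) = ∞ ↔ g.1.val 1 0 = 0 := fun g => by
    rw [Subgroup.smul_def, smul_infty_eq_self_iff]
  simp only [hinf]
  rw [Finset.card_eq_sum_card_image (fun g : G => g.1.val 0 0), mul_comm Vf.card, ← smul_eq_mul,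
    ← Finset.sum_const]
  apply Finset.sum_congr rfl
  intro t ht
  obtain ⟨g₀, hg₀, rfl⟩ := Finset.mem_image.1 ht
  simp only [Finset.mem_filter, Finset.mem_univ, true_and] at hg₀
  have hd0 := hdet g₀ g₀.2
  rw [hg₀] at hd0
  have ht0 : g₀.1.val 0 0 ≠ 0 := by
    intro h; rw [h] at hd0; simp at hd0
  symm
  apply Finset.card_bij (fun v hv => g₀ * ⟨upU v, (hV v).1 hv⟩)
  · intro v hv
    simp [upU_val, Matrix.mul_apply, Fin.sum_univ_two, hg₀]
  · intro v hv w hw h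
    have := mul_left_cancel h
    exact upU_injective (Subtype.ext_iff.1 this)
  · intro g hg
    simp only [Finset.mem_filter, Finset.mem_univ, true_and] at hg
    have hd := hdet g g.2
    rw [hg.1, hg.2] at hd
    have key : g₀.1 * upU ((g.1.val 0 1 - g₀.1.val 0 1) / g₀.1.val 0 0) = g.1 := by
      ext i j
      fin_cases i <;> fin_cases j <;>
        simp [upU_val, Matrix.mul_apply, Fin.sum_univ_two, hg₀, hg.1, hg.2]
      · field_simp; ring
      · exact mul_left_cancel₀ ht0 (by linear_combination hd0 - hd)
    have hmem : (g.1.val 0 1 - g₀.1.val 0 1) / g₀.1.val 0 0 ∈ unipSub G := by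
      rw [mem_unipSub, ← inv_mul_eq_iff_eq_mul.2 key.symm]
      exact mul_mem (inv_mem g₀.2) g.2
    exact ⟨_, (hV _).2 hmem, Subtype.ext key⟩

theorem card_parabolic_filter
    (hdet : ∀ g ∈ G, g.val 0 0 * g.val 1 1 - g.val 0 1 * g.val 1 0 = 1)
    [Fintype G] [DecidableEq G] [DecidableEq (OnePoint L)]
    (h2 : (2 : L) ≠ 0) (hneg : -1 ∈ G)
    (Vf : Finset L) (hV : ∀ x, x ∈ Vf ↔ x ∈ unipSub G) :
    (Finset.univ.filter (fun g : G => g • (∞ : OnePoint L) = ∞ ∧ g ≠ 1 ∧ g ≠ ⟨-1, hneg⟩ ∧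
      (g.1.val 0 0 + g.1.val 1 1) ^ 2 = 4)).card = 2 * (Vf.card - 1) := by
  have hinf : ∀ g : G, g • (∞ : OnePoint L) = ∞ ↔ g.1.val 1 0 = 0 := fun g => by
    rw [Subgroup.smul_def, smul_infty_eq_self_iff]
  simp only [hinf]
  have h0 : (0 : L) ∈ Vf := (hV 0).2 (zero_mem _)
  have h11 : (1 : L) ≠ -1 := by
    intro h; apply h2; linear_combination h
  have hne : (1 : G) ≠ ⟨-1, hneg⟩ := by
    intro h
    apply h11
    have := congrArg (fun g : G => g.1.val 0 0) h
    simpa using this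
  have e : 2 * (Vf.card - 1) = (({1, ⟨-1, hneg⟩} : Finset G) ×ˢ Vf.erase 0).card := by
    rw [Finset.card_product, Finset.card_pair hne, Finset.card_erase_of_mem h0]
  rw [e]
  symm
  apply Finset.card_bij (fun x hx => x.1 * ⟨upU x.2, (hV _).1
    (Finset.mem_of_mem_erase (Finset.mem_product.1 hx).2)⟩)
  · rintro ⟨η, v⟩ hx
    simp only [Finset.mem_product, Finset.mem_insert, Finset.mem_singleton, Finset.mem_erase] at hx
    simp only [Finset.mem_filter, Finset.mem_univ, true_and]
    rcases hx with ⟨rfl | rfl, hv0, hv⟩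
    · refine ⟨by simp [upU_val], ?_, ?_, by simp [upU_val]; norm_num⟩
      · intro h
        have := congrArg (fun g : G => g.1.val 0 1) h
        exact hv0 (by simpa [upU_val] using this)
      · intro h
        have := congrArg (fun g : G => g.1.val 0 0) h
        exact h11 (by simpa [upU_val] using this)
    · refine ⟨by simp [upU_val], ?_, ?_, by simp [upU_val]; norm_num⟩
      · intro h
        have := congrArg (fun g : G => g.1.val 0 0) h
        exact h11 (by simpa [upU_val] using this.symm)
      · intro h
        have := congrArg (fun g : G => g.1.val 0 1) h
        exact hv0 (by simpa [upU_val] using this)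
  · rintro ⟨η, v⟩ hx ⟨η', v'⟩ hx' h
    simp only [Finset.mem_product, Finset.mem_insert, Finset.mem_singleton, Finset.mem_erase]
      at hx hx'
    have e1 := congrArg (fun g : G => g.1.val 0 0) h
    have e2 := congrArg (fun g : G => g.1.val 0 1) h
    rcases hx with ⟨rfl | rfl, hv0, hv⟩ <;> rcases hx' with ⟨rfl | rfl, hv0', hv'⟩
    · simpa [upU_val] using e2
    · simp [upU_val] at e1; exact absurd e1 h11
    · simp [upU_val] at e1; exact absurd e1.symm h11
    · simpa [upU_val] using e2
  · intro g hg
    simp only [Finset.mem_filter, Finset.mem_univ, true_and] at hg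
    obtain ⟨hc, hg1, hgm, htr⟩ := hg
    have hd := hdet g g.2
    rw [hc] at hd
    have had : g.1.val 0 0 = g.1.val 1 1 := by
      have : (g.1.val 0 0 - g.1.val 1 1) ^ 2 = 0 := by linear_combination htr - 4 * hd
      exact sub_eq_zero.1 ((pow_eq_zero_iff two_ne_zero).1 this)
    have hpm : (g.1.val 0 0 - 1) * (g.1.val 0 0 + 1) = 0 := by
      rw [← had] at hd; linear_combination hd
    rcases mul_eq_zero.1 hpm with h | h
    · have h := sub_eq_zero.1 h
      have key : g.1 = upU (g.1.val 0 1) := by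
        ext i j
        fin_cases i <;> fin_cases j <;> simp [upU_val, ← had, h, hc]
      refine ⟨(1, g.1.val 0 1), ?_, ?_⟩
      · simp only [Finset.mem_product, Finset.mem_insert, true_or, Finset.mem_erase, true_and]
        refine ⟨?_, ?_⟩
        · intro h'
          rw [h', upU_zero] at key
          exact hg1 (Subtype.ext key)
        · rw [hV, mem_unipSub, ← key]; exact g.2
      · apply Subtype.ext
        simp [← key]
    · have h := eq_neg_of_add_eq_zero_left h
      have key : -g.1 = upU (-g.1.val 0 1) := by
        ext i j
        fin_cases i <;> fin_cases j <;> simp [upU_val, ← had, h, hc]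
      refine ⟨(⟨-1, hneg⟩, -g.1.val 0 1), ?_, ?_⟩
      · simp only [Finset.mem_product, Finset.mem_insert, Finset.mem_singleton, or_true,
          Finset.mem_erase, true_and]
        refine ⟨?_, ?_⟩
        · intro h'
          rw [h', upU_zero] at key
          exact hgm (Subtype.ext (neg_eq_iff_eq_neg.1 key))
        · rw [hV, mem_unipSub, ← key, ← neg_one_mul]; exact mul_mem hneg g.2
      · apply Subtype.ext
        simp [← key]

end Dickson

section DicksonMain

variable {L : Type*} [Field L] [DecidableEq L]

open OnePoint

theorem dickson_alg [IsAlgClosed L] (h2 : (2 : L) ≠ 0) (G : Subgroup (GL (Fin 2) L)) [Finite G]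
    (hdet : ∀ g ∈ G, g.val 0 0 * g.val 1 1 - g.val 0 1 * g.val 1 0 = 1)
    (hneg : -1 ∈ G) (s : L) (hs : s ≠ 0) (hU : upU 1 ∈ G) (hL : loU s ∈ G) :
    (∀ n : ℕ, s⁻¹ ^ n ∈ unipSub G) ∨ ((3 : L) = 0 ∧ ∃ a b : L, (a = 0 ∨ a = 1 ∨ a = -1) ∧
      (b = 0 ∨ b = 1 ∨ b = -1) ∧ s ^ 2 = a + b * s) := by
  classical
  let _ : Fintype G := Fintype.ofFinite G
  have h11 : (1 : L) ≠ -1 := by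
    intro h; apply h2; linear_combination h
  have hVfin : {x : L | upU x ∈ G}.Finite := by
    apply Set.Finite.of_injOn (f := upU) (t := (G : Set (GL (Fin 2) L)))
    · intro x hx; exact hx
    · exact upU_injective.injOn
    · exact Set.toFinite _
  obtain ⟨Vf, hV'⟩ : ∃ Vf : Finset L, ∀ x, x ∈ Vf ↔ upU x ∈ G :=
    ⟨hVfin.toFinset, fun x => by simp⟩
  have hV : ∀ x, x ∈ Vf ↔ x ∈ unipSub G := hV'
  have h1V : (1 : L) ∈ unipSub G := hU
  have h0V : (0 : L) ∈ unipSub G := zero_mem _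
  have h012 : ({0, 1, 2} : Finset L).card = 3 := by
    rw [Finset.card_insert_of_notMem, Finset.card_pair]
    · intro h; exact one_ne_zero (α := L) (by linear_combination -h)
    · simp [h2.symm]
  have hP : 3 ≤ Vf.card := by
    rw [← h012]
    apply Finset.card_le_card
    intro x hx
    simp only [Finset.mem_insert, Finset.mem_singleton] at hx
    rw [hV]
    rcases hx with rfl | rfl | rfl
    · exact h0V
    · exact h1V
    · rw [← one_add_one_eq_two]; exact add_mem h1V h1V
  set ε : G := ⟨-1, hneg⟩ with hεdef
  have hε : ε ≠ 1 := by
    intro h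
    have := congrArg (fun g : G => g.1.val 0 0) h
    exact h11 (by simpa [hεdef] using this.symm)
  have hε2 : ε * ε = 1 := Subtype.ext (by simp [hεdef])
  have hεc : ∀ g, ε * g = g * ε := fun g => Subtype.ext (by simp [hεdef])
  have hεx : ∀ x : OnePoint L, ε • x = x := by
    intro x
    rw [Subgroup.smul_def]
    induction x using OnePoint.rec with
    | infty => rw [smul_infty_eq_self_iff]; simp [hεdef]
    | coe x => rw [smul_some_eq_ite]; simp [hεdef]
  have hinf : ∀ g : G, g • (∞ : OnePoint L) = ∞ ↔ g.1.val 1 0 = 0 := fun g => by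
    rw [Subgroup.smul_def, smul_infty_eq_self_iff]
  let par : G → Prop := fun g => (g.1.val 0 0 + g.1.val 1 1) ^ 2 = 4
  have htr : ∀ g : G, g.1.val 0 0 + g.1.val 1 1 = g.1.val.trace := fun g => by
    rw [Matrix.trace_fin_two]
  have hparc : ∀ g h : G, par (h * g * h⁻¹) ↔ par g := by
    intro g h
    change _ ^ 2 = (4 : L) ↔ _ ^ 2 = (4 : L)
    rw [htr, htr]
    have : (h * g * h⁻¹).1.val = h.1.val * g.1.val * (h.1⁻¹).val := rfl
    rw [this, Matrix.trace_mul_comm, ← mul_assoc, ← Units.val_mul, inv_mul_cancel, Units.val_one,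
      one_mul]
  have hparε : ∀ g : G, par g → par (ε * g) := by
    intro g hg
    change _ ^ 2 = (4 : L)
    change _ ^ 2 = (4 : L) at hg
    rw [← hg]
    simp [hεdef]
    ring
  have hfixex : ∀ g : G, ∃ F : Finset (OnePoint L), g ≠ 1 → g ≠ ε → ((∀ x, x ∈ F ↔ g • x = x) ∧
      F.card * (if par g then 2 else 1) = 2) := by
    intro g
    by_cases h1 : g ≠ 1 ∧ g ≠ ε
    · obtain ⟨F, hF⟩ := gl_fix h2 g.1 (hdet g g.2) (fun h => h1.1 (Subtype.ext h))
        (fun h => h1.2 (Subtype.ext h))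
      exact ⟨F, fun _ _ => hF⟩
    · exact ⟨∅, fun h h' => absurd ⟨h, h'⟩ h1⟩
  choose fix hfix using hfixex
  -- the stabilizer of infinity
  set St := Finset.univ.filter (fun g : G => g • (∞ : OnePoint L) = ∞) with hSt
  set τ := St.image (fun g => g.1.val 0 0) with hτ
  have hτ0 : ∀ t ∈ τ, t ≠ 0 ∧ t ^ 2 ∈ unipSub G ∧ (∀ v ∈ unipSub G, t ^ 2 * v ∈ unipSub G) ∧
      -t ∈ τ := by
    intro t ht
    obtain ⟨g, hg, rfl⟩ := Finset.mem_image.1 ht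
    rw [hSt, Finset.mem_filter, hinf] at hg
    have hd := hdet g g.2
    rw [hg.2] at hd
    refine ⟨?_, ?_, ?_, ?_⟩
    · intro h; rw [h] at hd; simp at hd
    · have := borel_mul_upU G hdet g.2 hg.2 h1V
      rwa [mul_one] at this
    · intro v hv
      exact borel_mul_upU G hdet g.2 hg.2 hv
    · rw [hτ, Finset.mem_image]
      refine ⟨ε * g, ?_, by simp [hεdef]⟩
      rw [hSt, Finset.mem_filter, hinf]
      simp [hεdef, hg.2]
  have hne : Even τ.card := by
    apply even_card_of_involution τ (fun t => -t) (fun t ht => (hτ0 t ht).2.2.2)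
    · intro t ht h
      apply (hτ0 t ht).1
      have : 2 * t = 0 := by linear_combination -h
      exact (mul_eq_zero.1 this).resolve_left h2
    · intro t _; simp
  have hn0 : τ.card ≠ 0 := by
    rw [Finset.card_ne_zero]
    exact ⟨1, Finset.mem_image.2 ⟨1, by simp [hSt], by simp⟩⟩
  set Ef := τ.image (fun t => t ^ 2) with hEf
  have hE2 : τ.card ≤ 2 * Ef.card := by
    apply Finset.card_le_mul_card_image
    intro a ha
    obtain ⟨t, ht, rfl⟩ := Finset.mem_image.1 ha
    calc _ ≤ ({t, -t} : Finset L).card := by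
          apply Finset.card_le_card
          intro u hu
          rw [Finset.mem_filter] at hu
          rw [Finset.mem_insert, Finset.mem_singleton]
          exact sq_eq_sq_iff_eq_or_eq_neg.1 hu.2
      _ ≤ 2 := Finset.card_le_two
  have hEV : Ef ⊆ Vf.erase 0 := by
    intro a ha
    obtain ⟨t, ht, rfl⟩ := Finset.mem_image.1 ha
    rw [Finset.mem_erase, hV]
    exact ⟨pow_ne_zero 2 (hτ0 t ht).1, (hτ0 t ht).2.1⟩
  have hEP : Ef.card ≤ Vf.card - 1 := by
    rw [← Finset.card_erase_of_mem ((hV 0).2 h0V)]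
    exact Finset.card_le_card hEV
  -- the orbit of infinity
  set O := orbFinset G (∞ : OnePoint L) with hO
  have hinfO : (∞ : OnePoint L) ∈ O := mem_orbFinset.2 ⟨1, one_smul _ _⟩
  have hOsm : ∀ (g : G) (x : OnePoint L), x ∈ O → g • x ∈ O := by
    intro g x hx
    obtain ⟨h, rfl⟩ := mem_orbFinset.1 hx
    exact mem_orbFinset.2 ⟨g * h, mul_smul _ _ _⟩
  have hloO : ∀ c : L, c ≠ 0 → loU c ∈ G → ((c⁻¹ : L) : OnePoint L) ∈ O := by
    intro c hc hcG
    refine mem_orbFinset.2 ⟨⟨loU c, hcG⟩, ?_⟩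
    rw [Subgroup.smul_def, smul_infty_eq_ite]
    simp [loU_val, hc]
  have hsO : ((s⁻¹ : L) : OnePoint L) ∈ O := hloO s hs hL
  have hs2 : s + s ≠ 0 := by
    rw [← two_mul]; exact mul_ne_zero h2 hs
  have hss : s ≠ s + s := by simpa using hs
  have hm3 : 3 ≤ O.card := by
    have hsO2 : (((s + s)⁻¹ : L) : OnePoint L) ∈ O :=
      hloO (s + s) hs2 (by rw [loU_add]; exact mul_mem hL hL)
    have : ({∞, ((s⁻¹ : L) : OnePoint L), (((s + s)⁻¹ : L) : OnePoint L)} :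
        Finset (OnePoint L)).card = 3 := by
      rw [Finset.card_insert_of_notMem (by simp), Finset.card_pair]
      rw [Ne, OnePoint.coe_eq_coe, _root_.inv_inj]
      exact hss
    rw [← this]
    apply Finset.card_le_card
    intro x
    simp only [Finset.mem_insert, Finset.mem_singleton]
    rintro (rfl | rfl | rfl) <;> assumption
  obtain ⟨hparO, d, hd, hdeq⟩ := orbit_analysis (ε := ε) (par := par) hεc hε hε2 hεx hparc hparε fix
    (fun g h h' => (hfix g h h').1) (fun g h h' => (hfix g h h').2) ∞ Vf.card τ.card hP hne
    (card_borel_filter G hdet Vf hV) (card_parabolic_filter G hdet h2 hneg Vf hV) hm3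
  -- the finite part of the orbit
  set Of := O.preimage (fun x : L => (x : OnePoint L)) OnePoint.coe_injective.injOn with hOf
  have hmemOf : ∀ x : L, x ∈ Of ↔ (x : OnePoint L) ∈ O := fun x => Finset.mem_preimage
  have hOcard : O.card = 1 + Of.card := by
    have : O = insert ∞ (Of.image (fun x : L => (x : OnePoint L))) := by
      ext x
      induction x using OnePoint.rec with
      | infty => simp [hinfO]
      | coe x => simp [hmemOf]
    rw [this, Finset.card_insert_of_notMem (by simp),
      Finset.card_image_of_injective _ OnePoint.coe_injective, add_comm]
  have hOV : ∀ x ∈ Of, ∀ v ∈ unipSub G, x + v ∈ Of := by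
    intro x hx v hv
    rw [hmemOf] at hx ⊢
    have := hOsm ⟨upU v, hv⟩ _ hx
    rw [Subgroup.smul_def, smul_some_eq_ite] at this
    simpa [upU_val] using this
  have h0O : (0 : L) ∈ Of := by
    rw [hmemOf]
    apply hparO _ ⟨loU s, hL⟩
    · rw [Subgroup.smul_def, smul_some_eq_ite]
      simp [loU_val]
    · intro h
      have := congrArg (fun g : G => g.1.val 1 0) h
      exact hs (by simpa [loU_val] using this)
    · intro h
      have := congrArg (fun g : G => g.1.val 1 0) h
      exact hs (by simpa [loU_val, hεdef] using this)
    · change _ ^ 2 = (4 : L)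
      simp [loU_val]; norm_num
  obtain ⟨f, hf⟩ := card_dvd_card_of_add_mem (unipSub G) Vf Of hV hOV
  have hf0 : f ≠ 0 := by
    rintro rfl
    rw [mul_zero, Finset.card_eq_zero] at hf
    rw [hf] at h0O
    simp at h0O
  have hsOf : s⁻¹ ∈ Of := (hmemOf _).2 hsO
  have hVO : ∀ v ∈ unipSub G, v ∈ Of := by
    intro v hv
    have := hOV 0 h0O v hv
    rwa [zero_add] at this
  rcases dickson_numerics (by rw [hOcard, hf, mul_comm]) hP hf0 hne hd hn0 (by omega) hdeq with
    ⟨rfl, hn⟩ | ⟨rfl, hP3⟩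
  · left
    have hVO' : Vf = Of := by
      apply Finset.eq_of_subset_of_card_le
      · intro v hv; exact hVO v ((hV v).1 hv)
      · omega
    let L₀ : AddSubgroup L :=
      { carrier := {a | ∀ v ∈ unipSub G, a * v ∈ unipSub G}
        zero_mem' := fun v _ => by rw [zero_mul]; exact h0V
        add_mem' := fun {a b} ha hb v hv => by rw [add_mul]; exact add_mem (ha v hv) (hb v hv)
        neg_mem' := fun {a} ha v hv => by rw [neg_mul]; exact neg_mem (ha v hv) }
    have hL₀V : ∀ a ∈ L₀, a ∈ Vf := by
      intro a ha
      have := ha 1 h1V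
      rw [mul_one] at this
      exact (hV a).2 this
    let L₀f := Vf.filter (fun a => a ∈ L₀)
    have hL₀f : ∀ x, x ∈ L₀f ↔ x ∈ L₀ := by
      intro x
      rw [Finset.mem_filter]
      exact ⟨fun h => h.2, fun h => ⟨hL₀V x h, h⟩⟩
    obtain ⟨j, hj⟩ := card_dvd_card_of_add_mem L₀ L₀f Vf hL₀f (by
      intro x hx v hv
      rw [hV] at hx ⊢
      exact add_mem hx ((hV v).1 (hL₀V v hv)))
    have hL₀card : Ef.card + 1 ≤ L₀f.card := by
      have h0E : (0 : L) ∉ Ef := fun h => by simpa using hEV h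
      rw [← Finset.card_insert_of_notMem h0E]
      apply Finset.card_le_card
      intro a ha
      rw [hL₀f]
      rcases Finset.mem_insert.1 ha with rfl | ha
      · exact zero_mem _
      · obtain ⟨t, ht, rfl⟩ := Finset.mem_image.1 ha
        exact (hτ0 t ht).2.2.1
    have hj1 : j = 1 := by
      have : j < 2 := by
        by_contra hj2
        have : L₀f.card * 2 ≤ L₀f.card * j := Nat.mul_le_mul_left _ (by omega)
        omega
      interval_cases j
      · omega
      · rfl
    subst hj1
    have hsub : L₀f = Vf := Finset.eq_of_subset_of_card_le (Finset.filter_subset _ _) (by omega)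
    have hsL : s⁻¹ ∈ L₀ := by
      rw [← hL₀f, hsub, hVO']; exact hsOf
    intro n
    induction n with
    | zero => rw [pow_zero]; exact h1V
    | succ n ih => rw [pow_succ']; exact hsL _ ih
  · right
    have hV3 : Vf = {0, 1, -1} := by
      symm
      apply Finset.eq_of_subset_of_card_le
      · intro x
        simp only [Finset.mem_insert, Finset.mem_singleton, hV]
        rintro (rfl | rfl | rfl)
        · exact h0V
        · exact h1V
        · exact neg_mem h1V
      · rw [hP3, Finset.card_insert_of_notMem (by simp), Finset.card_pair h11]
    have hV3' : ∀ x, x ∈ unipSub G ↔ (x = 0 ∨ x = 1 ∨ x = -1) := by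
      intro x
      rw [← hV, hV3]; simp
    have h3 : (3 : L) = 0 := by
      have : (1 + 1 : L) ∈ unipSub G := add_mem h1V h1V
      rw [hV3', one_add_one_eq_two] at this
      rcases this with h | h | h
      · exact absurd h h2
      · exact absurd (by linear_combination h) (one_ne_zero (α := L))
      · linear_combination h
    refine ⟨h3, ?_⟩
    by_cases hsV : s⁻¹ ∈ unipSub G
    · refine ⟨1, 0, by simp, by simp, ?_⟩
      rw [hV3'] at hsV
      rcases hsV with h | h | h
      · exact absurd h (inv_ne_zero hs)
      · rw [inv_eq_one] at h; rw [h]; ring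
      · rw [inv_eq_iff_eq_inv] at h; rw [h]; norm_num
    · have hnegs : -s⁻¹ ∈ Of := by
        rw [hmemOf, ← inv_neg]
        apply hloO _ (neg_ne_zero.2 hs)
        rw [← loU_inv_val]; exact inv_mem hL
      have hOf9 : Of = (Vf ∪ Vf.image (fun v => s⁻¹ + v)) ∪ Vf.image (fun v => -s⁻¹ + v) := by
        symm
        have hs2V : s⁻¹ + s⁻¹ ∉ unipSub G := by
          intro h
          apply hsV
          have := neg_mem h
          have e : -(s⁻¹ + s⁻¹) = s⁻¹ := by linear_combination -s⁻¹ * h3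
          rwa [e] at this
        apply Finset.eq_of_subset_of_card_le
        · intro x
          simp only [Finset.mem_union, Finset.mem_image, hV]
          rintro ((h | ⟨v, hv, rfl⟩) | ⟨v, hv, rfl⟩)
          · exact hVO x h
          · exact hOV _ hsOf v hv
          · exact hOV _ hnegs v hv
        · rw [Finset.card_union_of_disjoint, Finset.card_union_of_disjoint,
            Finset.card_image_of_injective _ (add_right_injective _),
            Finset.card_image_of_injective _ (add_right_injective _)]
          · omega
          · rw [Finset.disjoint_left]
            intro x hx hx'
            obtain ⟨v, hv, rfl⟩ := Finset.mem_image.1 hx'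
            rw [hV] at hx hv
            exact hsV (by simpa using sub_mem hx hv)
          · rw [Finset.disjoint_left]
            intro x hx hx'
            obtain ⟨v, hv, rfl⟩ := Finset.mem_image.1 hx'
            rw [hV] at hv
            rw [Finset.mem_union, Finset.mem_image, hV] at hx
            rcases hx with hx | ⟨w, hw, hx⟩
            · exact hsV (by simpa using neg_mem (sub_mem hx hv))
            · rw [hV] at hw
              apply hs2V
              have := sub_mem hv hw
              have e : v - w = s⁻¹ + s⁻¹ := by linear_combination -hx
              rwa [e] at this
      have hsne1 : s - 1 ≠ 0 := by
        intro h
        apply hsV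
        rw [sub_eq_zero.1 h, inv_one]; exact h1V
      have hkey : (s + 1) / (s * (s - 1)) ∈ Of := by
        rw [hmemOf]
        have := hOsm ⟨loU s, hL⟩ _ ((hmemOf _).1 (hOV _ hsOf 1 h1V))
        rw [Subgroup.smul_def, smul_some_eq_ite] at this
        have e : s * (s⁻¹ + 1) + 1 = s - 1 := by
          rw [mul_add, mul_inv_cancel₀ hs]; linear_combination h3
        simp only [loU_val, Matrix.cons_val, Matrix.of_apply, Matrix.cons_val',
          Matrix.cons_val_fin_one] at this
        rw [if_neg (by rw [e]; exact hsne1), e] at this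
        convert this using 2
        field_simp
        ring
      have hij : ∃ i j : L, (i = 0 ∨ i = 1 ∨ i = -1) ∧ (j = 0 ∨ j = 1 ∨ j = -1) ∧
          (s + 1) / (s * (s - 1)) = i * s⁻¹ + j := by
        rw [hOf9] at hkey
        simp only [Finset.mem_union, Finset.mem_image, hV, hV3'] at hkey
        rcases hkey with (h | ⟨v, hv, h⟩) | ⟨v, hv, h⟩
        · exact ⟨0, _, by simp, h, by simp⟩
        · exact ⟨1, v, by simp, hv, by rw [← h, one_mul]⟩
        · exact ⟨-1, v, by simp, hv, by rw [← h]; ring⟩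
      obtain ⟨i, j, hi, hj, he⟩ := hij
      rw [div_eq_iff (mul_ne_zero hs hsne1)] at he
      have he' : s + 1 = (i + j * s) * (s - 1) := by
        rw [he]; field_simp
      rcases hj with rfl | rfl | rfl
      · exfalso
        apply hsV
        rw [hV3']
        rcases hi with rfl | rfl | rfl
        · right; right
          rw [inv_eq_iff_eq_inv, inv_neg, inv_one]; linear_combination he'
        · exact absurd (by linear_combination he') h2
        · have : 2 * s = 0 := by linear_combination he'
          exact absurd (mul_eq_zero.1 this) (by simp [h2, hs])
      · rcases hi with rfl | rfl | rfl
        · exact ⟨1, -1, by simp, by simp, by linear_combination -he' + s * h3⟩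
        · exact ⟨-1, 1, by simp, by simp, by linear_combination -he' + h3⟩
        · exact ⟨0, 0, by simp, by simp, by linear_combination -he' + s * h3⟩
      · rcases hi with rfl | rfl | rfl
        · exact ⟨-1, 0, by simp, by simp, by linear_combination he'⟩
        · exact ⟨1, 1, by simp, by simp, by linear_combination he' - h3⟩
        · exact ⟨0, -1, by simp, by simp, by linear_combination he'⟩

end DicksonMain

section DicksonFinite

variable {K : Type*} [Field K]

theorem loU_mem_of_upU_mem {H : Subgroup (GL (Fin 2) K)} {s : K} (hs : s ≠ 0)
    (hL : loU s ∈ H) (hU : ∀ x, upU x ∈ H) (x : K) : loU x ∈ H := by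
  have hw : upU s⁻¹ * loU (-s) * upU s⁻¹ ∈ H := by
    refine mul_mem (mul_mem (hU _) ?_) (hU _)
    rw [← loU_inv_val]; exact inv_mem hL
  have key : loU x = (upU s⁻¹ * loU (-s) * upU s⁻¹) * upU (-x / s ^ 2) *
      (upU s⁻¹ * loU (-s) * upU s⁻¹)⁻¹ := by
    rw [eq_mul_inv_iff_mul_eq]
    ext i j
    fin_cases i <;> fin_cases j <;>
      simp [upU_val, loU_val, Matrix.mul_apply, Fin.sum_univ_two, hs]
    field_simp
  rw [key]
  exact mul_mem (mul_mem hw (hU _)) (inv_mem hw)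

theorem dickson [Finite K] (h2 : (2 : K) ≠ 0) (s : K) (hs : ∀ x : K, x ≠ 0 → ∃ n : ℕ, s ^ n = x)
    (hc3 : Nat.card K ≠ 3) (hc9 : Nat.card K ≠ 9) (H : Subgroup (GL (Fin 2) K))
    (hU : upU 1 ∈ H) (hL : loU s ∈ H) (x : K) : upU x ∈ H ∧ loU x ∈ H := by
  classical
  have hs0 : s ≠ 0 := by
    rintro rfl
    obtain ⟨n, hn⟩ := hs (-1) (neg_ne_zero.2 one_ne_zero)
    rcases Nat.eq_zero_or_pos n with rfl | h
    · rw [pow_zero] at hn; exact h2 (by linear_combination hn)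
    · rw [zero_pow (by omega)] at hn
      exact h2 (by linear_combination 2 * hn)
  suffices hall : ∀ x, upU x ∈ H from ⟨hall x, loU_mem_of_upU_mem hs0 hL hall x⟩
  let H₁ : Subgroup (GL (Fin 2) K) :=
    { carrier := {h | h.val.det = 1 ∧ (h ∈ H ∨ -h ∈ H)}
      one_mem' := ⟨by simp, Or.inl (one_mem _)⟩
      mul_mem' := by
        rintro a b ⟨ha, ha'⟩ ⟨hb, hb'⟩
        refine ⟨by rw [Units.val_mul, Matrix.det_mul, ha, hb, one_mul], ?_⟩
        rcases ha' with ha' | ha' <;> rcases hb' with hb' | hb'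
        · left; exact mul_mem ha' hb'
        · right; rw [← mul_neg]; exact mul_mem ha' hb'
        · right; rw [← neg_mul]; exact mul_mem ha' hb'
        · left; rw [← neg_mul_neg]; exact mul_mem ha' hb'
      inv_mem' := by
        rintro a ⟨ha, ha'⟩
        refine ⟨?_, ?_⟩
        · have : (a * a⁻¹).val.det = 1 := by simp
          rwa [Units.val_mul, Matrix.det_mul, ha, one_mul] at this
        · rcases ha' with ha' | ha'
          · left; exact inv_mem ha'
          · right; rw [← inv_neg]; exact inv_mem ha' }
  have hH₁ : ∀ h, h ∈ H₁ ↔ h.val.det = 1 ∧ (h ∈ H ∨ -h ∈ H) := fun h => Iff.rfl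
  let L := AlgebraicClosure K
  let φ : K →+* L := algebraMap K L
  let Φ : GL (Fin 2) K →* GL (Fin 2) L := Matrix.GeneralLinearGroup.map φ
  have hΦu : ∀ x, Φ (upU x) = upU (φ x) := by
    intro x
    ext i j
    rw [Matrix.GeneralLinearGroup.map_apply]
    fin_cases i <;> fin_cases j <;> simp [upU_val]
  have hΦl : ∀ x, Φ (loU x) = loU (φ x) := by
    intro x
    ext i j
    rw [Matrix.GeneralLinearGroup.map_apply]
    fin_cases i <;> fin_cases j <;> simp [loU_val]
  have hΦinj : Function.Injective Φ := by
    intro a b hab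
    ext i j
    apply φ.injective
    have := congrArg (fun g : GL (Fin 2) L => g.val i j) hab
    simpa only [Φ, Matrix.GeneralLinearGroup.map_apply] using this
  have hmem : ∀ x, upU (φ x) ∈ H₁.map Φ → upU x ∈ H₁ := by
    rintro x ⟨h, hh, he⟩
    rw [← hΦu] at he
    rwa [← hΦinj he]
  have hUdet : ∀ x : K, (upU x).val.det = 1 := fun x => by simp [upU_val]
  have hdbl : ∀ x, upU x ∈ H₁ → upU (x + x) ∈ H := by
    rintro x ⟨-, h | h⟩
    · rw [upU_add]; exact mul_mem h h
    · rw [upU_add, ← neg_mul_neg]; exact mul_mem h h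
  have hfin : Finite (H₁.map Φ) := by
    have : Finite H₁ := inferInstance
    exact Set.Finite.image Φ (Set.toFinite (H₁ : Set (GL (Fin 2) K)))
  have hφ2 : (2 : L) ≠ 0 := by
    rw [← map_ofNat φ 2]; exact (map_ne_zero φ).2 h2
  rcases dickson_alg hφ2 (H₁.map Φ) (by
      rintro _ ⟨h, hh, rfl⟩
      have h1 := ((hH₁ h).1 hh).1
      rw [Matrix.det_fin_two] at h1
      have h3 := congrArg φ h1
      simpa [Φ, Matrix.GeneralLinearGroup.map_apply] using h3)
    (⟨-1, ⟨by simp [Matrix.det_fin_two], Or.inr (by rw [neg_neg]; exact one_mem _)⟩, by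
      ext i j
      rw [Matrix.GeneralLinearGroup.map_apply]
      fin_cases i <;> fin_cases j <;> simp⟩)
    (φ s) ((map_ne_zero φ).2 hs0)
    (⟨upU 1, ⟨hUdet 1, Or.inl hU⟩, by rw [hΦu, map_one]⟩)
    (⟨loU s, ⟨by simp [loU_val], Or.inl hL⟩, hΦl s⟩) with h | ⟨h3, a, b, ha, hb, hab⟩
  · have hall : ∀ y : K, upU y ∈ H₁ := by
      intro y
      by_cases hy : y = 0
      · rw [hy, upU_zero]; exact one_mem _
      · obtain ⟨n, hn⟩ := hs y⁻¹ (inv_ne_zero hy)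
        apply hmem
        have := h n
        rw [mem_unipSub, ← map_inv₀, ← map_pow, inv_pow, hn, inv_inv] at this
        exact this
    intro y
    have := hdbl (y / 2) (hall _)
    have e : y / 2 + y / 2 = y := by field_simp; ring
    rwa [e] at this
  · exfalso
    have h3K : (3 : K) = 0 := by
      apply φ.injective; rw [map_ofNat, map_zero, h3]
    have hlift : ∀ a : L, (a = 0 ∨ a = 1 ∨ a = -1) → ∃ a' : K, φ a' = a ∧
        a' ∈ ({0, 1, -1} : Finset K) := by
      rintro a (rfl | rfl | rfl)
      · exact ⟨0, by simp, by simp⟩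
      · exact ⟨1, by simp, by simp⟩
      · exact ⟨-1, by simp, by simp⟩
    obtain ⟨a, rfl, haT⟩ := hlift a ha
    obtain ⟨b, rfl, hbT⟩ := hlift b hb
    have hab' : s ^ 2 = a + b * s := by
      apply φ.injective; simpa using hab
    let _ : Fintype K := Fintype.ofFinite K
    let T : Finset K := {0, 1, -1}
    have hTa : ∀ x ∈ T, ∀ y ∈ T, x + y ∈ T := by
      intro x hx y hy
      simp only [T, Finset.mem_insert, Finset.mem_singleton] at hx hy ⊢
      rcases hx with rfl | rfl | rfl <;> rcases hy with rfl | rfl | rfl <;> simp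
      · right; linear_combination h3K
      · right; linear_combination -h3K
    have hTm : ∀ x ∈ T, ∀ y ∈ T, x * y ∈ T := by
      intro x hx y hy
      simp only [T, Finset.mem_insert, Finset.mem_singleton] at hx hy ⊢
      rcases hx with rfl | rfl | rfl <;> rcases hy with rfl | rfl | rfl <;> simp
    have hpow : ∀ n : ℕ, ∃ u ∈ T, ∃ v ∈ T, s ^ n = u + v * s := by
      intro n
      induction n with
      | zero => exact ⟨1, by simp [T], 0, by simp [T], by simp⟩
      | succ n ih =>
        obtain ⟨u, hu, v, hv, h⟩ := ih
        refine ⟨v * a, hTm _ hv _ haT, u + v * b, hTa _ hu _ (hTm _ hv _ hbT), ?_⟩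
        rw [pow_succ, h]
        linear_combination v * hab'
    have hle : Fintype.card K ≤ 9 := by
      calc Fintype.card K = (Finset.univ : Finset K).card := rfl
        _ ≤ ((T ×ˢ T).image (fun x => x.1 + x.2 * s)).card := by
            apply Finset.card_le_card
            intro x _
            rw [Finset.mem_image]
            by_cases hx : x = 0
            · exact ⟨(0, 0), by simp [T], by simp [hx]⟩
            · obtain ⟨n, rfl⟩ := hs x hx
              obtain ⟨u, hu, v, hv, h⟩ := hpow n
              exact ⟨(u, v), Finset.mem_product.2 ⟨hu, hv⟩, h.symm⟩
        _ ≤ (T ×ˢ T).card := Finset.card_image_le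
        _ = T.card * T.card := Finset.card_product _ _
        _ ≤ 3 * 3 := Nat.mul_le_mul Finset.card_le_three Finset.card_le_three
    have : CharP K 3 := (CharP.charP_iff_prime_eq_zero Nat.prime_three).2 (by exact_mod_cast h3K)
    obtain ⟨n, -, hn⟩ := FiniteField.card K 3
    rw [Nat.card_eq_fintype_card, hn] at hc3 hc9
    rw [hn] at hle
    have hn1 := n.pos
    have : (n : ℕ) < 3 := by
      by_contra h
      have := Nat.pow_le_pow_right (show 0 < 3 by norm_num) (show 3 ≤ (n : ℕ) by omega)
      omega
    obtain h | h : (n : ℕ) = 1 ∨ (n : ℕ) = 2 := by omega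
    · rw [h] at hc3; omega
    · rw [h] at hc9; omega

end DicksonFinite

section UnipRing

variable {E : Type*} [Ring E]

/-- The diagonal element `!![a, 0; 0, b]`. -/
def diU (a b : Eˣ) : (Matrix (Fin 2) (Fin 2) E)ˣ where
  val := !![(a : E), 0; 0, (b : E)]
  inv := !![((a⁻¹ : Eˣ) : E), 0; 0, ((b⁻¹ : Eˣ) : E)]
  val_inv := by simp [Matrix.one_fin_two]
  inv_val := by simp [Matrix.one_fin_two]

theorem diU_val (a b : Eˣ) : (diU a b : Matrix (Fin 2) (Fin 2) E) = !![(a : E), 0; 0, (b : E)] :=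
  rfl

theorem diU_conj_upU (a b : Eˣ) (x : E) :
    diU a b * upU x * (diU a b)⁻¹ = upU (a * x * ((b⁻¹ : Eˣ) : E)) := by
  rw [mul_inv_eq_iff_eq_mul]
  ext1
  simp [upU_val, diU_val]

theorem diU_conj_loU (a b : Eˣ) (x : E) :
    diU a b * loU x * (diU a b)⁻¹ = loU (b * x * ((a⁻¹ : Eˣ) : E)) := by
  rw [mul_inv_eq_iff_eq_mul]
  ext1
  simp [loU_val, diU_val]

theorem upU_loU_upU_conj (a : Eˣ) (x : E) :
    (upU (a : E) * loU (-((a⁻¹ : Eˣ) : E)) * upU (a : E)) * upU x *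
      (upU (a : E) * loU (-((a⁻¹ : Eˣ) : E)) * upU (a : E))⁻¹ =
    loU (-(((a⁻¹ : Eˣ) : E) * x * ((a⁻¹ : Eˣ) : E))) := by
  rw [mul_inv_eq_iff_eq_mul]
  ext1
  simp [upU_val, loU_val, mul_assoc, mul_add]

theorem upU_loU_upU_conj_loU (a : Eˣ) (x : E) :
    (upU (a : E) * loU (-((a⁻¹ : Eˣ) : E)) * upU (a : E)) * loU x *
      (upU (a : E) * loU (-((a⁻¹ : Eˣ) : E)) * upU (a : E))⁻¹ =
    upU (-((a : E) * x * (a : E))) := by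
  rw [mul_inv_eq_iff_eq_mul]
  ext1
  simp [upU_val, loU_val, mul_assoc, mul_add]

theorem two_ne_torsion (p : ℕ) (hp : Odd p) [CharP E p] {x y : E} (h : 2 * x = 2 * y) : x = y := by
  obtain ⟨m, hm⟩ := hp
  have hc : ((m + 1 : ℕ) : E) * 2 = 1 := by
    have : ((p : ℕ) : E) = 0 := CharP.cast_eq_zero E p
    rw [hm] at this
    push_cast at this ⊢
    calc ((m : E) + 1) * 2 = (2 * m + 1) + 1 := by noncomm_ring
      _ = 1 := by rw [this, zero_add]
  calc x = ((m + 1 : ℕ) : E) * 2 * x := by rw [hc, one_mul]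
    _ = ((m + 1 : ℕ) : E) * (2 * x) := by rw [mul_assoc]
    _ = ((m + 1 : ℕ) : E) * (2 * y) := by rw [h]
    _ = y := by rw [← mul_assoc, hc, one_mul]

theorem upU_loU_pow (p n : ℕ) [Fact p.Prime] (hp : Odd p) [CharP E p] (hn : 1 ≤ n) (W : E)
    (hW : W ^ p ^ n = W) (hu : IsUnit (W + 4)) :
    (upU 1 * loU W) ^ (p ^ n * p ^ n) = upU (-(1 - W ^ (p ^ n - 1))) * (upU 1 * loU W) := by
  have hP3 : 3 ≤ p ^ n := by
    have h2 := (Fact.out : p.Prime).two_le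
    have h3 : 3 ≤ p := by
      obtain ⟨m, hm⟩ := hp; omega
    exact h3.trans (Nat.le_self_pow (by omega) p)
  have hPodd : Odd (p ^ n) := hp.pow
  have hPP : p ^ n * p ^ n = p ^ (n + n) := (pow_add p n n).symm
  have htwo : ∀ (A : Type _) [Ring A] [CharP A p] (m : ℕ), (2 : A) ^ p ^ m = 2 := by
    intro A _ _ m
    rw [← one_add_one_eq_two, add_pow_char_pow_of_commute p _ (Commute.one_left _)]
    simp
  have hfrob : ∀ (m : ℕ) (A : E), (2 + A) ^ p ^ m = 2 + A ^ p ^ m := by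
    intro m A
    rw [add_pow_char_pow_of_commute p _ (Commute.ofNat_left 2 A), htwo E]
  obtain ⟨Q, hQ⟩ : ∃ Q, p ^ n = Q := ⟨_, rfl⟩
  obtain ⟨η, hη⟩ : ∃ η, W ^ (Q - 1) = η := ⟨_, rfl⟩
  have hWQ : W ^ Q = W := by rw [← hQ]; exact hW
  have hηW : η * W = W := by
    rw [← hη, ← pow_succ, Nat.sub_add_cancel (by omega), hWQ]
  have hWη : W * η = W := by
    rw [← hη, ← pow_succ', Nat.sub_add_cancel (by omega), hWQ]
  have hηη : η * η = η := by
    nth_rewrite 2 3 [← hη]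
    obtain ⟨m, hm⟩ : ∃ m, Q - 1 = m + 1 := ⟨Q - 2, by omega⟩
    rw [hm, pow_succ', ← mul_assoc, hηW]
  have hηpow : ∀ m, 1 ≤ m → η ^ m = η := by
    intro m hm
    induction m, hm using Nat.le_induction with
    | base => rw [pow_one]
    | succ m _ ih => rw [pow_succ, ih, hηη]
  have hcomm : Commute W (W + 4) := (Commute.refl W).add_right (Commute.ofNat_right W 4)
  have hu1 : (W + 4) ^ (Q - 1) = 1 := by
    have h1 : (W + 4) ^ Q = W + 4 := by
      have e : W + 4 = 2 + (2 + W) := by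
        rw [← add_assoc, add_comm W]; norm_num
      rw [e, ← hQ, hfrob, hfrob, hW]
    apply hu.mul_right_cancel
    rw [← pow_succ, Nat.sub_add_cancel (by omega), h1, one_mul]
  have hΔ : (W * (W + 4)) ^ ((Q * Q - 1) / 2) = η := by
    obtain ⟨m, hm⟩ : Odd Q := hQ ▸ hPodd
    have : (Q * Q - 1) / 2 = (Q - 1) * (m + 1) := by
      have : Q * Q - 1 = (Q - 1) * (m + 1) * 2 := by
        rw [hm]
        have : (2 * m + 1) * (2 * m + 1) = (2 * m + 1 - 1) * (m + 1) * 2 + 1 := by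
          rw [Nat.add_sub_cancel]; ring
        omega
      rw [this, Nat.mul_div_cancel _ (by norm_num)]
    rw [this, pow_mul, hcomm.mul_pow, hη, hu1, mul_one, hηpow _ (by omega)]
  have hWQQ : W ^ (Q * Q) = W := by rw [pow_mul, hWQ, hWQ]
  let g : Matrix (Fin 2) (Fin 2) E := !![1 + W, 1; W, 1]
  have hg : (upU 1 * loU W).val = g := by
    rw [Units.val_mul, upU_val, loU_val]
    simp [g]
  let T : Matrix (Fin 2) (Fin 2) E := Matrix.scalar (Fin 2) (2 + W)
  have hT : ∀ x : E, Matrix.scalar (Fin 2) x = !![x, 0; 0, x] := by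
    intro x
    ext i j
    fin_cases i <;> fin_cases j <;> simp
  let δ : Matrix (Fin 2) (Fin 2) E := !![W, 2; 2 * W, -W]
  have hsq : δ * δ = Matrix.scalar (Fin 2) (W * (W + 4)) := by
    rw [hT]
    ext i j
    fin_cases i <;> fin_cases j <;>
      simp [δ, Matrix.mul_apply, Fin.sum_univ_two] <;> noncomm_ring
  have hTδ : Commute T δ := by
    change T * δ = δ * T
    simp only [T, hT]
    ext i j
    fin_cases i <;> fin_cases j <;>
      simp [δ, Matrix.mul_apply, Fin.sum_univ_two] <;> noncomm_ring
  have hgT : 2 * g = T + δ := by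
    simp only [T, hT, two_mul]
    ext i j
    fin_cases i <;> fin_cases j <;>
      simp [δ, g, ← one_add_one_eq_two, add_mul] <;> abel
  have hpow : (2 * g) ^ (Q * Q) = T + δ * Matrix.scalar (Fin 2) η := by
    rw [hgT, ← hQ, hPP, add_pow_char_pow_of_commute p _ hTδ, ← hPP, hQ]
    congr 1
    · simp only [T]
      rw [← map_pow, ← hQ, hPP, hfrob, ← hPP, hQ, hWQQ]
    · have hQQ : Q * Q = 2 * ((Q * Q - 1) / 2) + 1 := by
        obtain ⟨m, hm⟩ : Odd (Q * Q) := hQ ▸ hPodd.mul hPodd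
        omega
      rw [hQQ, pow_succ', pow_mul, pow_two, hsq, ← map_pow, hΔ]
  have h2Q : (2 * g) ^ (Q * Q) = 2 * g ^ (Q * Q) := by
    rw [(Commute.ofNat_left 2 g).mul_pow]
    congr 1
    rw [← hQ, hPP, htwo]
  rw [hQ, hη]
  ext1
  rw [Units.val_pow_eq_pow_val, hg, Units.val_mul, hg, upU_val]
  apply two_ne_torsion p hp
  rw [← h2Q, hpow]
  simp only [T, hT, two_mul]
  ext i j
  fin_cases i <;> fin_cases j <;>
    simp [δ, g, hWη, hηW, sub_mul, ← one_add_one_eq_two, add_mul] <;> abel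

end UnipRing

/-- The closure properties shared by the additive groups of upper unipotents in a subgroup
containing the unipotents with entries in the field `K`. -/
structure Adm {K E : Type*} [Field K] [Ring E] (p : ℕ) (ι : K →+* E) (V : AddSubgroup E) :
    Prop where
  base : ∀ x, ι x ∈ V
  sandwich : ∀ a, ∀ X ∈ V, ι a * X * ι a ∈ V
  proj : ∀ x : K, x ≠ 0 → ∀ (W : E) (n : ℕ), 1 ≤ n → ι x⁻¹ * W ∈ V → W ^ p ^ n = W →
    IsUnit (W + 4) → (1 - W ^ (p ^ n - 1)) * ι x ∈ V

section UnipField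

variable {K E : Type*} [Field K] [Ring E] (ι : K →+* E)

/-- The image of a nonzero field element as a unit. -/
def unitOf (x : K) (hx : x ≠ 0) : Eˣ := Units.map (ι : K →* E) (Units.mk0 x hx)

theorem unitOf_val (x : K) (hx : x ≠ 0) : (unitOf ι x hx : E) = ι x := rfl

theorem unitOf_inv_val (x : K) (hx : x ≠ 0) : (((unitOf ι x hx)⁻¹ : Eˣ) : E) = ι x⁻¹ := rfl

theorem loU_mem_of_mem_unipSub {G : Subgroup (Matrix (Fin 2) (Fin 2) E)ˣ}
    (hU : upU 1 ∈ G) (hL : loU 1 ∈ G) {X : E} :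
    loU X ∈ G ↔ X ∈ unipSub G := by
  have hw : upU (((1 : Eˣ) : E)) * loU (-(((1 : Eˣ)⁻¹ : Eˣ) : E)) * upU (((1 : Eˣ) : E)) ∈ G := by
    have : loU (-(((1 : Eˣ)⁻¹ : Eˣ) : E)) ∈ G := by
      rw [inv_one, Units.val_one, ← loU_inv_val]; exact inv_mem hL
    exact mul_mem (mul_mem hU this) hU
  constructor
  · intro h
    have h1 := mul_mem (mul_mem hw h) (inv_mem hw)
    rw [upU_loU_upU_conj_loU, Units.val_one, one_mul, mul_one, ← upU_inv_val, inv_mem_iff] at h1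
    exact h1
  · intro h
    have h1 := mul_mem (mul_mem hw h) (inv_mem hw)
    rw [upU_loU_upU_conj, inv_one, Units.val_one, one_mul, mul_one, ← loU_inv_val,
      inv_mem_iff] at h1
    exact h1

theorem adm_unipSub (p : ℕ) [Fact p.Prime] (hp : Odd p) [CharP E p]
    (G : Subgroup (Matrix (Fin 2) (Fin 2) E)ˣ)
    (hG : ∀ x : K, upU (ι x) ∈ G ∧ loU (ι x) ∈ G) : Adm p ι (unipSub G) where
  base x := (hG x).1
  sandwich a X hX := by
    by_cases ha : a = 0
    · rw [ha, map_zero, zero_mul, zero_mul]; exact zero_mem _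
    have h1 := (hG 1)
    rw [map_one] at h1
    rw [mem_unipSub]
    have hX' := (loU_mem_of_mem_unipSub h1.1 h1.2).2 hX
    have hw : upU (unitOf ι a ha : E) * loU (-(((unitOf ι a ha)⁻¹ : Eˣ) : E)) *
        upU (unitOf ι a ha : E) ∈ G := by
      rw [unitOf_val, unitOf_inv_val, ← map_neg]
      exact mul_mem (mul_mem (hG _).1 (hG _).2) (hG _).1
    have h2 := mul_mem (mul_mem hw hX') (inv_mem hw)
    rw [upU_loU_upU_conj_loU, ← upU_inv_val, inv_mem_iff] at h2
    exact h2
  proj x hx W n hn hY hW hu := by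
    have h1 := (hG 1)
    rw [map_one] at h1
    have hY' := (loU_mem_of_mem_unipSub h1.1 h1.2).2 hY
    let D : (Matrix (Fin 2) (Fin 2) E)ˣ := diU 1 (unitOf ι x hx)⁻¹
    let G' := G.comap (MulAut.conj D).toMonoidHom
    have hG' : ∀ g, g ∈ G' ↔ D * g * D⁻¹ ∈ G := fun g => Iff.rfl
    have hg : upU 1 * loU W ∈ G' := by
      apply mul_mem
      · rw [hG', diU_conj_upU]; simpa [unitOf_val] using (hG x).1
      · rw [hG', diU_conj_loU]; simpa [unitOf_inv_val] using hY'
    have h3 := mul_mem (pow_mem hg (p ^ n * p ^ n)) (inv_mem hg)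
    rw [upU_loU_pow p n hp hn W hW hu, mul_inv_cancel_right, hG', diU_conj_upU, inv_inv,
      Units.val_one, one_mul, unitOf_val, neg_mul, ← upU_inv_val, inv_mem_iff] at h3
    exact h3

end UnipField

section Galois

variable {F K : Type} [Field F] [Field K] [Algebra F K] [Finite F] [Finite K]

/-- Multiplication operators on `K` as endomorphisms over `F`. -/
def mu (F : Type) {K : Type} [Field F] [Field K] [Algebra F K] : K →+* Module.End F K :=
  (Algebra.lmul F K).toRingHom

/-- A Galois automorphism as an endomorphism over `F`. -/
def tau (g : K ≃ₐ[F] K) : Module.End F K := g.toLinearMap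

@[simp] theorem mu_apply (x y : K) : mu F x y = x * y := rfl
@[simp] theorem tau_apply (g : K ≃ₐ[F] K) (y : K) : tau g y = g y := rfl

theorem mu_mul (x : K) (X : Module.End F K) : mu F x * X = x • X := by
  ext y; simp

theorem tau_mul_mu (g : K ≃ₐ[F] K) (x : K) : tau g * mu F x = g x • tau g := by
  ext y; simp

theorem tau_mul (g h : K ≃ₐ[F] K) : tau g * tau h = tau (g * h) := by
  ext y; simp

theorem tau_one : tau (1 : K ≃ₐ[F] K) = 1 := by
  ext y; simp

theorem smul_one_eq_mu (x : K) : x • (1 : Module.End F K) = mu F x := by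
  ext y; simp

theorem sub_smul_end (a b : K) (X : Module.End F K) : a • X - b • X = (a - b) • X := by
  ext y; simp [sub_mul]

theorem smul_mul_end (x : K) (X Y : Module.End F K) : (x • X) * Y = x • (X * Y) := by
  ext y; simp

variable [FiniteDimensional F K]

theorem tau_linearIndependent : LinearIndependent K (tau : (K ≃ₐ[F] K) → Module.End F K) :=
  (linearIndependent_toLinearMap F K K).comp (fun g : K ≃ₐ[F] K => g.toAlgHom)
    (fun g h e => by
      ext x
      exact congrArg (fun f : K →ₐ[F] K => f x) e)

/-- The basis of the endomorphism ring given by the Galois group. -/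
noncomputable def galEndBasis (F K : Type) [Field F] [Field K] [Algebra F K] [Finite F] [Finite K]
    [FiniteDimensional F K] :
    Module.Basis (K ≃ₐ[F] K) K (Module.End F K) :=
  basisOfLinearIndependentOfCardEqFinrank tau_linearIndependent (by
    rw [Module.finrank_linearMap_self, ← IsGalois.card_aut_eq_finrank, Nat.card_eq_fintype_card])

/-- The coefficients of an endomorphism with respect to the Galois group. -/
noncomputable def gcoef (X : Module.End F K) (g : K ≃ₐ[F] K) : K := (galEndBasis F K).repr X g

theorem galEndBasis_apply (g : K ≃ₐ[F] K) : galEndBasis F K g = tau g := by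
  simp [galEndBasis]

theorem sum_gcoef (X : Module.End F K) : ∑ g, gcoef X g • tau g = X := by
  conv_rhs => rw [← (galEndBasis F K).sum_repr X]
  simp [gcoef, galEndBasis_apply]

theorem gcoef_sum (n : (K ≃ₐ[F] K) → K) : gcoef (∑ g, n g • tau g) = n := by
  funext g
  have := (galEndBasis F K).repr_sum_self n
  simp only [galEndBasis_apply] at this
  exact congrFun this g

theorem gcoef_unique {X : Module.End F K} {n : (K ≃ₐ[F] K) → K} (h : X = ∑ g, n g • tau g) :
    gcoef X = n := by rw [h, gcoef_sum]

theorem gcoef_smul (x : K) (X : Module.End F K) (g : K ≃ₐ[F] K) :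
    gcoef (x • X) g = x * gcoef X g := by simp [gcoef]

/-- Functions of the form `h ↦ a * h b` span all functions on the Galois group. -/
theorem gal_functions_span (W : AddSubgroup ((K ≃ₐ[F] K) → K))
    (hW : ∀ a b : K, (fun h : K ≃ₐ[F] K => a * h b) ∈ W) (f : (K ≃ₐ[F] K) → K) : f ∈ W := by
  classical
  obtain ⟨s, hs⟩ := IsCyclic.exists_generator (α := Kˣ)
  have hinj : Set.InjOn (fun h : K ≃ₐ[F] K => h (s : K)) (Finset.univ : Finset (K ≃ₐ[F] K)) := by
    intro g _ h _ e
    ext x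
    by_cases hx : x = 0
    · simp [hx]
    · obtain ⟨n, hn⟩ := (hs (Units.mk0 x hx))
      have hn' : (s : K) ^ n = x := by
        have := congrArg Units.val hn
        simpa using this
      rw [← hn', map_zpow₀, map_zpow₀]
      exact congrArg (· ^ n) e
  let P := Lagrange.interpolate Finset.univ (fun h : K ≃ₐ[F] K => h (s : K)) f
  have hP : f = ∑ i ∈ Finset.range (P.natDegree + 1),
      fun h : K ≃ₐ[F] K => P.coeff i * h (s ^ i : K) := by
    funext h
    rw [← Lagrange.eval_interpolate_at_node f hinj (Finset.mem_univ h)]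
    change P.eval _ = _
    rw [Polynomial.eval_eq_sum_range, Finset.sum_apply]
    simp
  rw [hP]
  exact sum_mem fun i _ => hW _ _

end Galois

section AdmLemmas

variable {F K : Type} [Field F] [Field K] [Algebra F K] [Finite F] [Finite K]
  [FiniteDimensional F K] {p : ℕ} {V : AddSubgroup (Module.End F K)}

theorem Adm.symm_mem (hV : Adm p (mu F) V) (a b : K) {X : Module.End F K} (hX : X ∈ V) :
    a • (X * mu F b) + b • (X * mu F a) ∈ V := by
  have h1 := hV.sandwich (a + b) X hX
  have h2 := hV.sandwich a X hX
  have h3 := hV.sandwich b X hX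
  have : a • (X * mu F b) + b • (X * mu F a) =
      mu F (a + b) * X * mu F (a + b) - mu F a * X * mu F a - mu F b * X * mu F b := by
    simp only [← mu_mul, map_add]
    noncomm_ring
  rw [this]
  exact sub_mem (sub_mem h1 h2) h3

theorem Adm.twist (hV : Adm p (mu F) V) {X : Module.End F K} (hX : X ∈ V)
    (f : (K ≃ₐ[F] K) → K) :
    ∑ h, ((f h + h (f h⁻¹)) * gcoef X h) • tau h ∈ V := by
  let Φ : ((K ≃ₐ[F] K) → K) →+ Module.End F K :=
    { toFun := fun f => ∑ h, ((f h + h (f h⁻¹)) * gcoef X h) • tau h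
      map_zero' := by simp
      map_add' := by
        intro a b
        rw [← Finset.sum_add_distrib]
        refine Finset.sum_congr rfl fun h _ => ?_
        rw [← add_smul]
        congr 1
        simp only [Pi.add_apply, map_add]; ring }
  refine gal_functions_span (V.comap Φ) (fun a b => ?_) f
  have := hV.symm_mem a b hX
  rw [← sum_gcoef X] at this
  rw [AddSubgroup.mem_comap]
  convert this using 1
  simp only [Φ, AddMonoidHom.coe_mk, ZeroHom.coe_mk, Finset.sum_mul, smul_mul_end, tau_mul_mu,
    Finset.smul_sum, smul_smul]
  rw [← Finset.sum_add_distrib]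
  refine Finset.sum_congr rfl fun h _ => ?_
  rw [← add_smul]
  congr 1
  have : h (h⁻¹ b) = b := by rw [← AlgEquiv.mul_apply, mul_inv_cancel, AlgEquiv.one_apply]
  rw [map_mul, this]; ring

theorem Adm.twist_single (hV : Adm p (mu F) V) {X : Module.End F K} (hX : X ∈ V)
    (g : K ≃ₐ[F] K) (x : K) :
    (x * gcoef X g) • tau g + (g⁻¹ x * gcoef X g⁻¹) • tau g⁻¹ ∈ V := by
  classical
  convert hV.twist hX (Pi.single g x) using 1
  simp only [add_mul, add_smul, Finset.sum_add_distrib]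
  congr 1
  · rw [Finset.sum_eq_single g]
    · simp
    · intro h _ hh; simp [Pi.single_eq_of_ne hh]
    · simp
  · rw [Finset.sum_eq_single g⁻¹]
    · simp
    · intro h _ hh
      rw [Pi.single_eq_of_ne (fun e => hh (by rw [← e, inv_inv]))]; simp
    · simp

theorem Adm.half_mem (hp : Odd p) [CharP K p] {X : Module.End F K} (h : (2 : K) • X ∈ V) :
    X ∈ V := by
  obtain ⟨m, hm⟩ := hp
  have h0 : ((p : ℕ) : K) = 0 := CharP.cast_eq_zero K p
  have : X = (m + 1) • ((2 : K) • X) := by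
    rw [← Nat.cast_smul_eq_nsmul K, smul_smul]
    have : ((m + 1 : ℕ) : K) * 2 = 1 := by
      rw [hm] at h0; push_cast at h0 ⊢; linear_combination h0
    rw [this, one_smul]
  rw [this]
  exact nsmul_mem h _

theorem Adm.scalar_mem (hp : Odd p) [CharP K p] (hV : Adm p (mu F) V) {X : Module.End F K}
    (hX : X ∈ V) (c : F) : algebraMap F K c • X ∈ V := by
  apply Adm.half_mem hp
  have h1 := hV.symm_mem (algebraMap F K c) 1 hX
  have : X * mu F (algebraMap F K c) = algebraMap F K c • X := by
    ext y
    simp only [Module.End.mul_apply, mu_apply, LinearMap.smul_apply, ← Algebra.smul_def, map_smul,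
      smul_eq_mul]
  rw [map_one, mul_one, one_smul, this] at h1
  rwa [two_smul]

/-- Multiplying an admissible set by a field element. -/
theorem Adm.scale (hV : Adm p (mu F) V) (b : K) (hb : b ≠ 0) :
    Adm p (mu F) (V.comap (LinearMap.toAddMonoidHom (LinearMap.lsmul K (Module.End F K) b))) := by
  have hmem : ∀ X, X ∈ V.comap (LinearMap.toAddMonoidHom (LinearMap.lsmul K (Module.End F K) b)) ↔
    b • X ∈ V := fun X => Iff.rfl
  constructor
  · intro x
    rw [hmem, ← mu_mul, ← map_mul]; exact hV.base _
  · intro a X hX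
    rw [hmem] at hX ⊢
    have := hV.sandwich a _ hX
    rw [← mu_mul] at this ⊢
    rw [← mul_assoc, ← mul_assoc, ← map_mul, mul_comm b]
    rwa [← mul_assoc, ← map_mul] at this
  · intro x hx W n hn hW hWn hu
    rw [hmem] at hW ⊢
    have h1 := hV.proj (b⁻¹ * x) (by positivity) W n hn (by
      rw [mul_inv, inv_inv, map_mul, mul_assoc, mu_mul]; exact hW) hWn hu
    have := hV.sandwich b _ h1
    rw [mul_assoc, mul_assoc, ← map_mul, mul_comm _ b, mul_inv_cancel_left₀ hb] at this
    rwa [mu_mul] at this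

/-- Self-adjointness expressed through Galois coefficients. -/
def GalSymm (X : Module.End F K) : Prop := ∀ g, gcoef X g⁻¹ = g⁻¹ (gcoef X g)

theorem Adm.galSymm_mem (hp : Odd p) [CharP K p] (hV : Adm p (mu F) V)
    (hc : ∀ g : K ≃ₐ[F] K, g ≠ 1 → ∀ x : K, x • tau g + g⁻¹ x • tau g⁻¹ ∈ V) {X : Module.End F K}
    (hX : GalSymm X) : X ∈ V := by
  apply Adm.half_mem hp
  have : (2 : K) • X = ∑ g, (gcoef X g • tau g + g⁻¹ (gcoef X g) • tau g⁻¹) := by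
    simp only [← hX _]
    have e : ∑ g : K ≃ₐ[F] K, gcoef X g⁻¹ • tau g⁻¹ = ∑ g, gcoef X g • tau g :=
      Equiv.sum_comp (Equiv.inv (K ≃ₐ[F] K)) (fun g => gcoef X g • tau g)
    rw [Finset.sum_add_distrib, e, sum_gcoef, two_smul]
  rw [this]
  refine sum_mem fun g _ => ?_
  by_cases hg : g = 1
  · subst hg
    have h1 := hV.base (gcoef X 1)
    rw [← smul_one_eq_mu, ← tau_one] at h1
    rw [inv_one, AlgEquiv.one_apply]
    exact add_mem h1 h1
  · exact hc g hg _

theorem Adm.exists_full_of_not_galSymm (hV : Adm p (mu F) V)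
    (hc : ∀ g : K ≃ₐ[F] K, g ≠ 1 → ∀ x : K, x • tau g + g⁻¹ x • tau g⁻¹ ∈ V) {X : Module.End F K}
    (hX : X ∈ V) (hXs : ¬ GalSymm X) : ∃ g : K ≃ₐ[F] K, g ≠ 1 ∧ ∀ x : K, x • tau g ∈ V := by
  rw [GalSymm] at hXs
  push Not at hXs
  obtain ⟨g, hg⟩ := hXs
  have hg1 : g ≠ 1 := by rintro rfl; simp at hg
  refine ⟨g⁻¹, by simpa using hg1, fun x => ?_⟩
  have hd : gcoef X g⁻¹ - g⁻¹ (gcoef X g) ≠ 0 := sub_ne_zero.2 hg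
  obtain ⟨y, hy⟩ : ∃ y, g⁻¹ y * (gcoef X g⁻¹ - g⁻¹ (gcoef X g)) = x :=
    ⟨g (x / (gcoef X g⁻¹ - g⁻¹ (gcoef X g))), by
      rw [← AlgEquiv.mul_apply, inv_mul_cancel, AlgEquiv.one_apply, div_mul_cancel₀ _ hd]⟩
  have h1 := hV.twist_single hX g y
  have h2 := hc g hg1 (y * gcoef X g)
  have := sub_mem h1 h2
  rw [add_sub_add_left_eq_sub, sub_smul_end, map_mul, ← mul_sub, hy] at this
  exact this

end AdmLemmas

section ProjAlg

variable {F K : Type} [Field F] [Field K] [Algebra F K] [Finite F] [Finite K]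
  [FiniteDimensional F K]

theorem tau_pow (g : K ≃ₐ[F] K) (n : ℕ) : tau g ^ n = tau (g ^ n) := by
  induction n with
  | zero => rw [pow_zero, pow_zero, tau_one]
  | succ n ih => rw [pow_succ, pow_succ, ih, tau_mul]

theorem gal_pow_finrank (g : K ≃ₐ[F] K) : g ^ Module.finrank F K = 1 := by
  rw [← IsGalois.card_aut_eq_finrank]; exact pow_card_eq_one'

theorem gal_zpowers (hk : (Module.finrank F K).Prime) {σ : K ≃ₐ[F] K} (hσ : σ ≠ 1)
    (g : K ≃ₐ[F] K) : g ∈ Subgroup.zpowers σ := by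
  have := Fact.mk hk
  rw [zpowers_eq_top_of_prime_card (IsGalois.card_aut_eq_finrank F K) hσ]
  exact Subgroup.mem_top _

theorem gcoef_trace : gcoef (∑ g : K ≃ₐ[F] K, tau g) = 1 := by
  have := gcoef_sum (fun _ : K ≃ₐ[F] K => (1 : K))
  simp only [one_smul] at this
  exact this

theorem eq_smul_trace (hk : (Module.finrank F K).Prime) {σ : K ≃ₐ[F] K} (hσ : σ ≠ 1)
    {e : Module.End F K} (he : e * tau σ = e) : ∃ v : K, e = v • ∑ g : K ≃ₐ[F] K, tau g := by
  have hpow : ∀ n : ℕ, e * tau (σ ^ n) = e := by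
    intro n
    induction n with
    | zero => rw [pow_zero, tau_one, mul_one]
    | succ n ih => rw [pow_succ, ← tau_mul, ← mul_assoc, ih, he]
  have hall : ∀ g : K ≃ₐ[F] K, e * tau g = e := by
    intro g
    obtain ⟨n, rfl⟩ := mem_powers_iff_mem_zpowers.2 (gal_zpowers hk hσ g)
    exact hpow n
  have hc : ∀ g, gcoef e g = gcoef e 1 := by
    intro g
    have h1 : e = ∑ h, gcoef e (h * g⁻¹) • tau h := by
      conv_lhs => rw [← hall g, ← sum_gcoef e, Finset.sum_mul]
      simp only [smul_mul_end, tau_mul]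
      rw [← Equiv.sum_comp (Equiv.mulRight g) (fun h => gcoef e (h * g⁻¹) • tau h)]
      simp
    have h2 := congrFun (gcoef_unique h1) g
    rw [h2, mul_inv_cancel]
  refine ⟨gcoef e 1, ?_⟩
  conv_lhs => rw [← sum_gcoef e]
  rw [Finset.smul_sum]
  exact Finset.sum_congr rfl fun g _ => by rw [hc g]

theorem trace_mul_tau (σ : K ≃ₐ[F] K) :
    (∑ g : K ≃ₐ[F] K, tau g) * tau σ = ∑ g : K ≃ₐ[F] K, tau g := by
  rw [Finset.sum_mul]
  simp only [tau_mul]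
  exact Equiv.sum_comp (Equiv.mulRight σ) tau

/-- The auxiliary operator `(σ - 1) (1 - β σ⁻¹)`. -/
def auxOp (σ : K ≃ₐ[F] K) (β : K) : Module.End F K := (tau σ - 1) * (1 - β • tau σ⁻¹)

theorem auxOp_eq (σ : K ≃ₐ[F] K) (β : K) :
    auxOp σ β = tau σ + β • tau σ⁻¹ - mu F (1 + σ β) := by
  ext y
  simp [auxOp]
  ring

theorem norm_gal (σ : K ≃ₐ[F] K) (u : K) : Algebra.norm F (σ u) = Algebra.norm F u :=
  Algebra.norm_eq_of_algEquiv σ u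

theorem aux_injective (σ : K ≃ₐ[F] K) {β : K} (hβ : Algebra.norm F β ≠ 1) {u : K}
    (hu : u = β * σ⁻¹ u) : u = 0 := by
  by_contra h
  have h1 := congrArg (Algebra.norm F) hu
  rw [map_mul, norm_gal] at h1
  have h2 : Algebra.norm F u ≠ 0 := Algebra.norm_ne_zero_iff.2 h
  exact hβ (mul_right_cancel₀ h2 (by rw [one_mul]; exact h1.symm))

theorem proj_eq_smul_trace (hk : (Module.finrank F K).Prime)
    (hkK : ((Module.finrank F K : ℕ) : K) ≠ 0)
    {σ : K ≃ₐ[F] K} (hσ : σ ≠ 1) {β : K} (hβ : β = 1 ∨ Algebra.norm F β ≠ 1) {ρ : F} (hρ : ρ ≠ 0)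
    {P : ℕ} (hP : 2 ≤ P) (hYP : (ρ • auxOp σ β) ^ P = ρ • auxOp σ β) :
    ∃ v : K, v ≠ 0 ∧ 1 - (ρ • auxOp σ β) ^ (P - 1) = v • ∑ g : K ≃ₐ[F] K, tau g := by
  obtain ⟨e, he⟩ : ∃ e, 1 - (ρ • auxOp σ β) ^ (P - 1) = e := ⟨_, rfl⟩
  rw [he]
  have h1 : e * auxOp σ β = 0 := by
    have : e * (ρ • auxOp σ β) = 0 := by
      rw [← he, sub_mul, ← pow_succ, Nat.sub_add_cancel (by omega), hYP, one_mul, sub_self]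
    rw [mul_smul_comm] at this
    exact (smul_eq_zero.1 this).resolve_left hρ
  have h2 : e * (tau σ - 1) = 0 := by
    rcases hβ with rfl | hβ
    · obtain ⟨f, hf⟩ : ∃ f, e * (tau σ - 1) = f := ⟨_, rfl⟩
      rw [hf]
      have h3 : f * (tau σ - 1) = 0 := by
        have : f * (tau σ - 1) = e * auxOp σ 1 * tau σ := by
          rw [← hf, auxOp, one_smul, mul_assoc e, mul_assoc e, mul_assoc (tau σ - 1),
            sub_mul 1, tau_mul, inv_mul_cancel, tau_one, one_mul]
        rw [this, h1, zero_mul]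
      have h4 : f * tau σ = f := by rw [mul_sub, mul_one, sub_eq_zero] at h3; exact h3
      have h5 : e * tau σ = e + f := by rw [← hf, mul_sub, mul_one]; abel
      have h6 : ∀ j : ℕ, e * tau (σ ^ j) = e + j • f := by
        intro j
        induction j with
        | zero => rw [pow_zero, tau_one, mul_one, zero_nsmul, add_zero]
        | succ j ih =>
          rw [pow_succ, ← tau_mul, ← mul_assoc, ih, add_mul, h5, smul_mul_assoc, h4, succ_nsmul]
          abel
      have h7 := h6 (Module.finrank F K)
      rw [gal_pow_finrank, tau_one, mul_one, left_eq_add, ← Nat.cast_smul_eq_nsmul K] at h7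
      exact (smul_eq_zero.1 h7).resolve_left hkK
    · have hinj : Function.Injective (1 - β • tau σ⁻¹ : Module.End F K) := by
        rw [← LinearMap.ker_eq_bot, LinearMap.ker_eq_bot']
        intro u hu
        apply aux_injective σ hβ
        simpa [sub_eq_zero] using hu
      have hsurj := LinearMap.injective_iff_surjective.1 hinj
      ext y
      obtain ⟨u, rfl⟩ := hsurj y
      rw [auxOp, ← mul_assoc] at h1
      exact congrArg (fun f : Module.End F K => f u) h1
  obtain ⟨v, hv⟩ := eq_smul_trace hk hσ (e := e) (by
    rw [mul_sub, mul_one, sub_eq_zero] at h2; exact h2)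
  refine ⟨v, ?_, hv⟩
  rintro rfl
  rw [zero_smul] at hv
  rw [hv, sub_eq_zero] at he
  have h3 : (∑ g : K ≃ₐ[F] K, tau g) * (ρ • auxOp σ β) = 0 := by
    have ht : (∑ g : K ≃ₐ[F] K, tau g) * (tau σ - 1) = 0 := by
      rw [mul_sub, trace_mul_tau, mul_one, sub_self]
    rw [mul_smul_comm, auxOp, ← mul_assoc, ht, zero_mul, smul_zero]
  have h4 : (∑ g : K ≃ₐ[F] K, tau g) = 0 := by
    calc (∑ g : K ≃ₐ[F] K, tau g) = (∑ g : K ≃ₐ[F] K, tau g) * (ρ • auxOp σ β) ^ (P - 1) := by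
          rw [← he, mul_one]
      _ = 0 := by
        obtain ⟨m, hm⟩ : ∃ m, P - 1 = m + 1 := ⟨P - 2, by omega⟩
        rw [hm, pow_succ', ← mul_assoc, h3, zero_mul]
  have h5 := congrFun (gcoef_trace (F := F) (K := K)) 1
  rw [h4] at h5
  simp [gcoef] at h5

theorem auxOp_pow_of_base (p n : ℕ) [Fact p.Prime] [CharP K p] {σ : K ≃ₐ[F] K}
    (hP : ∀ g : K ≃ₐ[F] K, g ^ p ^ n = g) {b : F} (hb : b ^ p ^ n = b) :
    (auxOp σ (algebraMap F K b)) ^ p ^ n = auxOp σ (algebraMap F K b) := by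
  have : CharP (Module.End F K) p := charP_of_injective_ringHom (mu F).injective p
  have e : auxOp σ (algebraMap F K b) = (tau σ - 1) * (1 - b • tau σ⁻¹) := by
    rw [auxOp, algebraMap_smul]
  have hst : Commute (tau σ) (tau σ⁻¹) := by
    rw [Commute, SemiconjBy, tau_mul, tau_mul, mul_inv_cancel, inv_mul_cancel]
  have hc : Commute (tau σ - 1) (1 - b • tau σ⁻¹) :=
    (Commute.one_right _).sub_right
      (((hst.sub_left (Commute.one_left _))).smul_right b)
  rw [e, hc.mul_pow, sub_pow_char_pow_of_commute p _ (Commute.one_right _),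
    sub_pow_char_pow_of_commute p _ (Commute.one_left _), one_pow, smul_pow, tau_pow, tau_pow, hP,
    hP, hb]

theorem auxOp_pow_of_root (p n : ℕ) [Fact p.Prime] [CharP K p]
    (hk : (Module.finrank F K).Prime) {t : ℕ} (hP : p ^ n = Module.finrank F K * t + 1)
    {σ : K ≃ₐ[F] K} {β : K} (hβ : β ≠ 0) {ω : F} (hω : ω ≠ 1)
    (hσβ : σ β = algebraMap F K ω * β) :
    (auxOp σ β) ^ p ^ n = auxOp σ β := by
  have : CharP (Module.End F K) p := charP_of_injective_ringHom (mu F).injective p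
  obtain ⟨k, hkk⟩ : ∃ k, Module.finrank F K = k := ⟨_, rfl⟩
  rw [hkk] at hk hP
  have hω0 : ω ≠ 0 := by
    rintro rfl
    rw [map_zero, zero_mul] at hσβ
    exact hβ ((map_eq_zero σ).1 hσβ)
  have hσpow : ∀ j : ℕ, (σ ^ j) β = algebraMap F K (ω ^ j) * β := by
    intro j
    induction j with
    | zero => simp
    | succ j ih =>
      rw [pow_succ, AlgEquiv.mul_apply, hσβ, map_mul, ih, AlgEquiv.commutes, pow_succ, map_mul]
      ring
  have hωk : ω ^ k = 1 := by
    have h1 := hσpow k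
    rw [← hkk, gal_pow_finrank, AlgEquiv.one_apply, hkk] at h1
    apply (algebraMap F K).injective
    rw [map_one]
    exact mul_right_cancel₀ hβ (by rw [one_mul]; exact h1.symm)
  have hprim : IsPrimitiveRoot ω k := by
    have := Fact.mk hk
    exact IsPrimitiveRoot.iff_orderOf.2 (orderOf_eq_prime hωk hω)
  have hσinv : σ⁻¹ β = algebraMap F K ω⁻¹ * β := by
    have h0 : algebraMap F K ω ≠ 0 := (map_ne_zero _).2 hω0
    have h1 := congrArg (σ⁻¹ : K ≃ₐ[F] K) hσβ
    rw [← AlgEquiv.mul_apply, inv_mul_cancel, AlgEquiv.one_apply, map_mul, AlgEquiv.commutes] at h1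
    rw [map_inv₀, eq_inv_mul_iff_mul_eq₀ h0]; exact h1.symm
  let M : Module.End F K := auxOp σ β + 1
  have hM : ∀ j : ℕ, M (β ^ j) = (ω ^ j) • β ^ j + ((ω⁻¹) ^ j - ω) • β ^ (j + 1) := by
    intro j
    simp only [M, auxOp_eq, LinearMap.add_apply, LinearMap.sub_apply, tau_apply,
      LinearMap.smul_apply, mu_apply, Module.End.one_apply, map_pow, hσβ, hσinv, Algebra.smul_def,
      Algebra.algebraMap_self, RingHom.id_apply, map_sub, mul_pow]
    ring
  have hkill : ∀ d j : ℕ, j + d = k → ∀ i, j ≤ i → i < k →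
      Polynomial.aeval M
        (∏ l ∈ Finset.Ico j k, (Polynomial.X - Polynomial.C (ω ^ l))) (β ^ i) = 0 := by
    intro d
    induction d with
    | zero => intro j hj i h1 h2; omega
    | succ d ih =>
      intro j hj i hji hik
      rw [Finset.prod_eq_prod_Ico_succ_bot (by omega)]
      rcases Nat.eq_or_lt_of_le hji with rfl | h
      · rw [mul_comm, map_mul, Module.End.mul_apply]
        have : Polynomial.aeval M (Polynomial.X - Polynomial.C (ω ^ j)) (β ^ j) =
            ((ω⁻¹) ^ j - ω) • β ^ (j + 1) := by
          simp only [map_sub, Polynomial.aeval_X, Polynomial.aeval_C, LinearMap.sub_apply, hM,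
            Module.algebraMap_end_apply]
          abel
        rw [this, map_smul]
        rcases Nat.lt_or_ge (j + 1) k with h | h
        · rw [ih (j + 1) (by omega) _ le_rfl h, smul_zero]
        · have hj1 : j + 1 = k := by omega
          have : (ω⁻¹) ^ j - ω = 0 := by
            rw [inv_pow, sub_eq_zero]
            exact inv_eq_of_mul_eq_one_right (by rw [← pow_succ, hj1, hωk])
          rw [this, zero_smul]
      · rw [map_mul, Module.End.mul_apply, ih (j + 1) (by omega) i h hik, map_zero]
  have hind : LinearIndependent F (fun i : Fin k => β ^ (i : ℕ)) := by
    refine Module.End.eigenvectors_linearIndependent' (tau σ) (fun i : Fin k => ω ^ (i : ℕ)) ?_ _ ?_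
    · intro i j hij
      exact Fin.ext (hprim.pow_inj i.2 j.2 hij)
    · intro i
      refine ⟨?_, pow_ne_zero _ hβ⟩
      rw [Module.End.mem_eigenspace_iff, tau_apply, map_pow, hσβ, mul_pow, Algebra.smul_def,
        map_pow]
  have hne : Nonempty (Fin k) := ⟨⟨0, hk.pos⟩⟩
  have hspan := hind.span_eq_top_of_card_eq_finrank (by rw [Fintype.card_fin, hkk])
  have hMk : M ^ k = 1 := by
    have h1 := X_pow_sub_C_eq_prod hprim hk.pos (one_pow k : (1 : F) ^ k = 1)
    have h2 : M ^ k - 1 = Polynomial.aeval M (Polynomial.X ^ k - Polynomial.C (1 : F)) := by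
      simp
    rw [← sub_eq_zero, h2, h1]
    refine LinearMap.ext_on_range hspan fun i => ?_
    have := hkill k 0 (zero_add k) i (Nat.zero_le _) i.2
    rw [Nat.Ico_zero_eq_range] at this
    simpa using this
  have hZ : auxOp σ β = M - 1 := by simp [M]
  rw [hZ, sub_pow_char_pow_of_commute p _ (Commute.one_right _), one_pow]
  congr 1
  rw [hP, pow_succ, pow_mul, hMk, one_pow, one_mul]

end ProjAlg

section UnitLemmas

variable {F K : Type} [Field F] [Field K] [Algebra F K] [Finite F] [Finite K]
  [FiniteDimensional F K]

theorem auxOp_not_injective (σ : K ≃ₐ[F] K) (β : K) :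
    ¬ Function.Injective (auxOp σ β : Module.End F K) := by
  intro h
  have h1 := LinearMap.injective_iff_surjective.1 h
  have h2 : Function.Surjective (tau σ - 1 : Module.End F K) := by
    intro y
    obtain ⟨x, hx⟩ := h1 y
    exact ⟨(1 - β • tau σ⁻¹ : Module.End F K) x, hx⟩
  have h3 := LinearMap.injective_iff_surjective.2 h2
  have : (1 : K) = 0 := h3 (by simp)
  exact one_ne_zero this

theorem exists_not_eigenvalue {Z : Module.End F K} (hZ : ¬ Function.Injective Z)
    (hk : Module.finrank F K < Nat.card F) : ∃ l : F, l ≠ 0 ∧ IsUnit (Z - algebraMap F _ l) := by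
  classical
  have := Fintype.ofFinite F
  by_contra! hcon
  have hall : ∀ l : F, Z.charpoly.IsRoot l := by
    intro l
    rw [← Module.End.hasEigenvalue_iff_isRoot_charpoly, Module.End.hasEigenvalue_iff_mem_spectrum]
    by_cases hl : l = 0
    · subst hl
      rw [spectrum.zero_mem_iff]
      intro h
      exact hZ ((Module.End.isUnit_iff _).1 h).1
    · rw [spectrum.mem_iff, ← IsUnit.neg_iff, neg_sub]
      exact hcon l hl
  have h1 : (Finset.univ : Finset F).val ⊆ Z.charpoly.roots := by
    intro l _
    exact (Polynomial.mem_roots (LinearMap.charpoly_monic Z).ne_zero).2 (hall l)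
  have h2 := Polynomial.card_le_degree_of_subset_roots h1
  rw [LinearMap.charpoly_natDegree, Finset.card_univ, ← Nat.card_eq_fintype_card] at h2
  omega

theorem gal_fixed_of_pow (hk : (Module.finrank F K).Prime) {σ : K ≃ₐ[F] K} {m : ℕ}
    (hm : m.Coprime (Module.finrank F K)) {u : K} (hu : (σ ^ m) u = u) : σ u = u := by
  by_cases hσ : σ ^ m = 1
  · have h1 : orderOf σ ∣ m := orderOf_dvd_of_pow_eq_one hσ
    have h2 : orderOf σ ∣ Module.finrank F K := orderOf_dvd_of_pow_eq_one (gal_pow_finrank σ)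
    have h3 : orderOf σ = 1 := Nat.eq_one_of_dvd_coprimes hm h1 h2
    rw [orderOf_eq_one_iff.1 h3, AlgEquiv.one_apply]
  · obtain ⟨n, hn⟩ := mem_powers_iff_mem_zpowers.2 (gal_zpowers hk hσ σ)
    have : ∀ n : ℕ, ((σ ^ m) ^ n) u = u := by
      intro n
      induction n with
      | zero => simp
      | succ n ih => rw [pow_succ, AlgEquiv.mul_apply, hu, ih]
    have h := this n
    rwa [show (σ ^ m) ^ n = σ from hn] at h

theorem auxOp_sub_one_injective (p r : ℕ) [Fact p.Prime] [CharP K p]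
    (hk : (Module.finrank F K).Prime) (hq : Nat.card F = p ^ r)
    (h1 : (Nat.card F - 1).Coprime (Module.finrank F K))
    (h2 : (Nat.card F + 1).Coprime (Module.finrank F K)) (σ : K ≃ₐ[F] K) (b : F) {u : K}
    (hu : auxOp σ (algebraMap F K b) u = u) : u = 0 := by
  have := Fintype.ofFinite F
  have : CharP (Module.End F K) p := charP_of_injective_ringHom (mu F).injective p
  have hfr : ∀ x : F, x ^ p ^ r = x := by
    intro x; rw [← hq, Nat.card_eq_fintype_card]; exact FiniteField.pow_card x
  obtain ⟨q, hqq⟩ : ∃ q, Nat.card F = q := ⟨_, rfl⟩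
  rw [hqq] at hq h1 h2
  have hq1 : 1 ≤ q := by rw [← hqq]; exact Nat.card_pos
  have e1 : σ (σ u) = (2 + b) • σ u - b • u := by
    have h := congrArg σ hu
    rw [auxOp_eq] at h
    simp only [LinearMap.sub_apply, LinearMap.add_apply, tau_apply, LinearMap.smul_apply, mu_apply,
      AlgEquiv.commutes, map_sub, map_add, map_mul, map_one, smul_eq_mul] at h
    rw [← AlgEquiv.mul_apply σ σ⁻¹, mul_inv_cancel, AlgEquiv.one_apply] at h
    simp only [Algebra.smul_def, map_add, map_ofNat]
    linear_combination h
  let T : Module.End F K := tau σ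
  have hT : ∀ n y, (T ^ n) y = (σ ^ n) y := fun n y => by rw [tau_pow, tau_apply]
  have hσσ : ∀ n y, (σ ^ n) (σ y) = σ ((σ ^ n) y) := fun n y => by
    rw [← AlgEquiv.mul_apply, ← AlgEquiv.mul_apply, ← pow_succ, ← pow_succ']
  have e2 : (σ ^ q) ((σ ^ q) u) = (2 + b) • (σ ^ q) u - b • u := by
    have hA : (T ^ 2 - (2 + b) • T) ^ q = (T ^ q) ^ 2 - (2 + b) • T ^ q := by
      have hc : Commute (T ^ 2) ((2 + b) • T) := ((Commute.refl T).pow_left 2).smul_right _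
      rw [hq, sub_pow_char_pow_of_commute p _ hc, smul_pow, hfr, ← pow_mul, ← pow_mul, mul_comm]
    have hB : ∀ n : ℕ, ((T ^ 2 - (2 + b) • T) ^ n) u = (-b) ^ n • u := by
      have h0 : (T ^ 2 - (2 + b) • T) u = (-b) • u := by
        rw [LinearMap.sub_apply, LinearMap.smul_apply, hT, pow_two, AlgEquiv.mul_apply, e1]
        simp [T]
      intro n
      induction n with
      | zero => simp
      | succ n ih => rw [pow_succ, Module.End.mul_apply, h0, map_smul, ih, smul_smul, pow_succ']
    have h := hB q
    rw [hA, hq, hfr, ← hq, LinearMap.sub_apply, LinearMap.smul_apply, ← pow_mul, mul_two, pow_add,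
      Module.End.mul_apply, hT, hT, sub_eq_iff_eq_add, neg_smul] at h
    rw [h]; abel
  obtain ⟨v, hv⟩ : ∃ v, v = (σ ^ q) u + σ u - (2 + b) • u := ⟨_, rfl⟩
  have hv1 : (σ ^ q) v = σ v := by
    rw [hv]
    simp only [map_sub, map_add, map_smul, e2, e1, hσσ]
    abel
  have hv2 : (σ ^ (q - 1)) v = v := by
    apply σ.injective
    rw [← hσσ, ← AlgEquiv.mul_apply, ← pow_succ, Nat.sub_add_cancel hq1, hv1]
  have hv3 : σ v = v := gal_fixed_of_pow hk h1 hv2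
  have hv4 : σ (σ v) = (2 + b) • σ v - b • v := by
    have hz : σ (σ ((σ ^ q) u)) = (2 + b) • σ ((σ ^ q) u) - b • (σ ^ q) u := by
      rw [← hσσ, ← hσσ, e1, map_sub, map_smul, map_smul, hσσ]
    rw [hv]
    simp only [map_sub, map_add, map_smul, hz]
    rw [e1]
    simp only [map_sub, map_smul, e1, smul_sub, smul_add]
    module
  have hv5 : v = 0 := by
    rw [hv3, hv3, Algebra.smul_def, Algebra.smul_def, map_add, map_ofNat] at hv4
    linear_combination -hv4
  rw [hv5] at hv
  have e3 : (σ ^ (q + 1)) u = b • u := by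
    have h := congrArg σ hv
    rw [map_zero, map_sub, map_add, map_smul, e1, ← hσσ, ← AlgEquiv.mul_apply, ← pow_succ] at h
    rw [← sub_eq_zero, h]; abel
  by_contra hu0
  have e4 : ∀ n : ℕ, ((σ ^ (q + 1)) ^ n) u = b ^ n • u := by
    intro n
    induction n with
    | zero => simp
    | succ n ih => rw [pow_succ, AlgEquiv.mul_apply, e3, map_smul, ih, smul_smul, pow_succ']
  have e5 := e4 (Module.finrank F K)
  rw [gal_pow_finrank, AlgEquiv.one_apply] at e5
  have hbk : b ^ Module.finrank F K = 1 := by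
    have : (b ^ Module.finrank F K - 1) • u = 0 := by rw [sub_smul, one_smul, ← e5, sub_self]
    exact sub_eq_zero.1 ((smul_eq_zero.1 this).resolve_right hu0)
  have hb0 : b ≠ 0 := by
    rintro rfl
    rw [zero_pow hk.ne_zero] at hbk
    exact zero_ne_one hbk
  have hbq : b ^ (q - 1) = 1 := by
    rw [← hqq, Nat.card_eq_fintype_card]; exact FiniteField.pow_card_sub_one_eq_one b hb0
  have hb1 : b = 1 := by
    have := Nat.eq_one_of_dvd_coprimes h1 (orderOf_dvd_of_pow_eq_one hbq)
      (orderOf_dvd_of_pow_eq_one hbk)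
    exact orderOf_eq_one_iff.1 this
  rw [hb1, one_smul] at e3
  have hfix := gal_fixed_of_pow hk h2 e3
  rw [hfix, hfix, hb1, one_smul, Algebra.smul_def, map_add, map_ofNat, map_one] at e1
  rw [auxOp_eq, hb1] at hu
  simp only [LinearMap.sub_apply, LinearMap.add_apply, tau_apply, LinearMap.smul_apply, mu_apply,
      map_one, smul_eq_mul, hfix] at hu
  have hfix' : σ⁻¹ u = u := by
    apply σ.injective
    rw [← AlgEquiv.mul_apply, mul_inv_cancel, AlgEquiv.one_apply, hfix]
  rw [hfix'] at hu
  apply hu0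
  linear_combination -hu

/-- The multipliers `β` for which `auxOp σ β` is used. -/
def GoodMult (σ : K ≃ₐ[F] K) (β : K) : Prop :=
  (∃ b : F, β = algebraMap F K b) ∨
    (Module.finrank F K < Nat.card F ∧ β ≠ 0 ∧ ∃ ω : F, ω ≠ 1 ∧ σ β = algebraMap F K ω * β)

theorem exists_unit_add_four (p r : ℕ) [Fact p.Prime] [CharP K p] (hp : Odd p)
    (hk : (Module.finrank F K).Prime) (hk2 : Module.finrank F K ≠ 2) (hpk : p ≠ Module.finrank F K)
    (hq : Nat.card F = p ^ r) (σ : K ≃ₐ[F] K) {β : K} (hβ : GoodMult σ β) :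
    ∃ ρ : F, ρ ≠ 0 ∧ IsUnit (ρ • auxOp σ β + 4) := by
  have h2K : (2 : K) ≠ 0 := by
    intro h
    have h' : ((2 : ℕ) : K) = 0 := by exact_mod_cast h
    rw [CharP.cast_eq_zero_iff K p] at h'
    have := Nat.le_of_dvd (by norm_num) h'
    have := (Fact.out : p.Prime).two_le
    rcases hp with ⟨m, hm⟩
    omega
  have h4 : (4 : F) ≠ 0 := by
    intro h
    apply h2K
    have : (algebraMap F K 4) = 0 := by rw [h, map_zero]
    rw [map_ofNat] at this
    have h' : (2 : K) * 2 = 0 := by rw [← this]; norm_num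
    exact mul_self_eq_zero.1 h'
  suffices h : ∃ l : F, l ≠ 0 ∧ IsUnit (auxOp σ β - algebraMap F _ l) by
    obtain ⟨l, hl, hu⟩ := h
    refine ⟨-4 / l, div_ne_zero (neg_ne_zero.2 h4) hl, ?_⟩
    have hne : -4 / l ≠ 0 := div_ne_zero (neg_ne_zero.2 h4) hl
    have : (-4 / l) • auxOp σ β + 4 = algebraMap F (Module.End F K) (-4 / l) *
        (auxOp σ β - algebraMap F _ l) := by
      rw [mul_sub, ← map_mul, div_mul_cancel₀ _ hl, Algebra.smul_def, map_neg, map_ofNat,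
        sub_neg_eq_add]
    rw [this]
    exact ((isUnit_iff_ne_zero.2 hne).map _).mul hu
  by_cases hlt : Module.finrank F K < Nat.card F
  · exact exists_not_eigenvalue (auxOp_not_injective σ β) hlt
  · obtain ⟨b, rfl⟩ := hβ.resolve_right fun h => hlt h.1
    refine ⟨1, one_ne_zero, ?_⟩
    have hr : r ≠ 0 := by
      rintro rfl
      rw [pow_zero] at hq
      have := Finite.one_lt_card (α := F)
      omega
    have hodd : Odd (Nat.card F) := by rw [hq]; exact hp.pow
    have hq1 : 1 < Nat.card F := Finite.one_lt_card
    have hne : Module.finrank F K ≠ Nat.card F := by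
      intro h
      rw [hq] at h
      rw [h] at hk
      have := (Nat.Prime.eq_one_of_pow hk)
      rw [this, pow_one] at h
      exact hpk h.symm
    have hkodd : Odd (Module.finrank F K) := hk.odd_of_ne_two hk2
    rw [map_one, Module.End.isUnit_iff]
    have hinj : Function.Injective (auxOp σ (algebraMap F K b) - 1 : Module.End F K) := by
      rw [← LinearMap.ker_eq_bot, LinearMap.ker_eq_bot']
      intro u hu
      refine auxOp_sub_one_injective p r hk hq ?_ ?_ σ b (u := u) ?_
      · exact (Nat.coprime_of_lt_prime (by omega) (by omega) hk).symm
      · refine (Nat.coprime_of_lt_prime (by omega) ?_ hk).symm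
        rcases hodd with ⟨a, ha⟩
        rcases hkodd with ⟨c, hc⟩
        omega
      · rwa [LinearMap.sub_apply, Module.End.one_apply, sub_eq_zero] at hu
    exact ⟨hinj, LinearMap.injective_iff_surjective.1 hinj⟩

theorem exists_period (K : Type) [Field K] [Finite K] (p k : ℕ) [Fact p.Prime] [CharP K p]
    (hk : k.Prime) (hpk : p ≠ k) :
    ∃ n t : ℕ, 1 ≤ n ∧ p ^ n = k * t + 1 ∧ ∀ x : K, x ^ p ^ n = x := by
  have := Fintype.ofFinite K
  obtain ⟨m, hm1, hm⟩ := FiniteField.card K p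
  have hcop : (Fintype.card K).Coprime k := by
    rw [hm]
    exact Nat.Coprime.pow_left _ ((Nat.coprime_primes Fact.out hk).2 hpk)
  have h1 := Nat.ModEq.pow_totient hcop
  rw [Nat.totient_prime hk] at h1
  refine ⟨m * (k - 1), (Fintype.card K ^ (k - 1)) / k, ?_, ?_, ?_⟩
  · have := hk.two_le
    exact Nat.mul_pos m.pos (by omega)
  · rw [pow_mul, ← hm]
    have h3 := Nat.div_add_mod (Fintype.card K ^ (k - 1)) k
    have h4 : Fintype.card K ^ (k - 1) % k = 1 := by
      rw [h1, Nat.mod_eq_of_lt hk.one_lt]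
    rw [h4] at h3
    exact h3.symm
  · intro x
    rw [pow_mul, ← hm]
    exact FiniteField.pow_card_pow _ x

end UnitLemmas

section Classify

variable {F K : Type} [Field F] [Field K] [Algebra F K] [Finite F] [Finite K]
  [FiniteDimensional F K] {p : ℕ} {V : AddSubgroup (Module.End F K)}

theorem Adm.exists_smul_trace (hp : Odd p) [Fact p.Prime] [CharP K p]
    (hk : (Module.finrank F K).Prime) (hk2 : Module.finrank F K ≠ 2) (hpk : p ≠ Module.finrank F K)
    (hV : Adm p (mu F) V) {σ : K ≃ₐ[F] K} (hσ : σ ≠ 1) {β : K} (hβ : GoodMult σ β)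
    (hβ1 : β = 1 ∨ Algebra.norm F β ≠ 1) :
    ∃ v : K, v ≠ 0 ∧ ∀ x : K, x ≠ 0 → x⁻¹ • auxOp σ β ∈ V →
      (v • ∑ g : K ≃ₐ[F] K, tau g) * mu F x ∈ V := by
  have := Fintype.ofFinite F
  have : CharP F p := RingHom.charP (algebraMap F K) (algebraMap F K).injective p
  obtain ⟨r, -, hr⟩ := FiniteField.card F p
  rw [← Nat.card_eq_fintype_card] at hr
  obtain ⟨ρ, hρ, hunit⟩ := exists_unit_add_four p r hp hk hk2 hpk hr σ hβ
  obtain ⟨n, t, hn, hnt, hpow⟩ := exists_period K p _ hk hpk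
  have hpowF : ∀ x : F, x ^ p ^ n = x := fun x =>
    (algebraMap F K).injective (by rw [map_pow, hpow])
  have hg : ∀ g : K ≃ₐ[F] K, g ^ p ^ n = g := by
    intro g
    rw [hnt, pow_succ, pow_mul, gal_pow_finrank, one_pow, one_mul]
  have hZ : auxOp σ β ^ p ^ n = auxOp σ β := by
    rcases hβ with ⟨b, rfl⟩ | ⟨-, hβ0, ω, hω, h⟩
    · exact auxOp_pow_of_base p n hg (hpowF b)
    · exact auxOp_pow_of_root p n hk hnt hβ0 hω h
  have hW : (ρ • auxOp σ β) ^ p ^ n = ρ • auxOp σ β := by rw [smul_pow, hpowF, hZ]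
  have hkK : ((Module.finrank F K : ℕ) : K) ≠ 0 := by
    rw [Ne, CharP.cast_eq_zero_iff K p]
    intro h
    exact hpk ((Nat.prime_dvd_prime_iff_eq Fact.out hk).1 h)
  have hP2 : 2 ≤ p ^ n := by
    calc 2 ≤ p := (Fact.out : p.Prime).two_le
      _ ≤ p ^ n := Nat.le_self_pow (by omega) p
  obtain ⟨v, hv, hev⟩ := proj_eq_smul_trace hk hkK hσ hβ1 hρ hP2 hW
  refine ⟨v, hv, fun x hx hxV => ?_⟩
  rw [← hev]
  refine hV.proj x hx _ n hn ?_ hW hunit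
  have h1 := hV.scalar_mem hp hxV ρ
  rw [mu_mul]
  convert h1 using 1
  ext y
  simp [Algebra.smul_def]
  ring

theorem Adm.smul_one_mem (hV : Adm p (mu F) V) (x : K) : x • (1 : Module.End F K) ∈ V := by
  rw [smul_one_eq_mu]; exact hV.base x

theorem Adm.eq_top_of_forall (hV : Adm p (mu F) V)
    (h : ∀ g : K ≃ₐ[F] K, g ≠ 1 → ∀ x : K, x • tau g ∈ V) : V = ⊤ := by
  rw [eq_top_iff]
  intro X _
  rw [← sum_gcoef X]
  refine sum_mem fun g _ => ?_
  by_cases hg : g = 1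
  · rw [hg, tau_one]; exact hV.smul_one_mem _
  · exact h g hg _

theorem gcoef_smul_trace (v : K) (g : K ≃ₐ[F] K) :
    gcoef (v • ∑ g : K ≃ₐ[F] K, tau g) g = v := by
  rw [gcoef_smul, gcoef_trace, Pi.one_apply, mul_one]

theorem gal_eq_of_finrank_two (hk : Module.finrank F K = 2) {σ g : K ≃ₐ[F] K} (hσ : σ ≠ 1)
    (hg : g ≠ 1) : g = σ := by
  obtain ⟨n, hn⟩ := mem_powers_iff_mem_zpowers.2 (gal_zpowers (hk ▸ Nat.prime_two) hσ g)
  have h2 : σ ^ 2 = 1 := by rw [← hk, gal_pow_finrank]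
  have hn' : σ ^ n = g := hn
  rcases Nat.even_or_odd' n with ⟨c, rfl | rfl⟩
  · rw [pow_mul, h2, one_pow] at hn'
    exact absurd hn'.symm hg
  · rw [pow_succ, pow_mul, h2, one_pow, one_mul] at hn'
    exact hn'.symm

theorem Adm.eq_top_of_full (hp : Odd p) [Fact p.Prime] [CharP K p]
    (hk : (Module.finrank F K).Prime) (hpk : p ≠ Module.finrank F K)
    (hV : Adm p (mu F) V) {σ : K ≃ₐ[F] K} (hσ : σ ≠ 1) (hfull : ∀ x : K, x • tau σ ∈ V) :
    V = ⊤ := by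
  apply hV.eq_top_of_forall
  by_cases hk2 : Module.finrank F K = 2
  · intro g hg x
    rw [gal_eq_of_finrank_two hk2 hσ hg]
    exact hfull x
  have hz : Algebra.norm F (0 : K) ≠ 1 := by rw [Algebra.norm_zero]; exact zero_ne_one
  obtain ⟨v, hv, h⟩ := hV.exists_smul_trace hp hk hk2 hpk hσ (β := 0)
    (Or.inl ⟨0, (map_zero _).symm⟩) (Or.inr hz)
  have hTr : ∀ y : K, y • ∑ g : K ≃ₐ[F] K, tau g ∈ V := by
    intro y
    by_cases hy : y = 0
    · rw [hy, zero_smul]; exact zero_mem _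
    have hb : v * y⁻¹ ≠ 0 := mul_ne_zero hv (inv_ne_zero hy)
    have h1 := h (v * y⁻¹) hb (by
      rw [auxOp_eq, zero_smul, add_zero, map_zero, add_zero, smul_sub, ← smul_one_eq_mu, smul_smul]
      exact sub_mem (hfull _) (hV.smul_one_mem _))
    have h2 := hV.sandwich (v * y⁻¹)⁻¹ _ h1
    rw [mul_assoc, mul_assoc, ← map_mul, mul_inv_cancel₀ hb, map_one, mul_one, mu_mul, smul_smul,
      mul_inv, inv_inv, mul_right_comm, inv_mul_cancel₀ hv, one_mul] at h2
    exact h2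
  intro g hg z
  obtain ⟨x, hx⟩ : ∃ x, g x ≠ x := by
    by_contra! hcon
    exact hg (AlgEquiv.ext hcon)
  have hx0 : g x - x ≠ 0 := sub_ne_zero.2 hx
  have key : ∀ x b : K, (x * b) • tau g⁻¹ + (g x * b) • tau g ∈ V := by
    intro x b
    have h := hV.twist_single (hTr b) g⁻¹ x
    rw [gcoef_smul_trace, gcoef_smul_trace, inv_inv] at h
    exact h
  have h1 := sub_mem (key x (z / (g x - x))) (key 1 (x * (z / (g x - x))))
  rw [one_mul, map_one, one_mul, add_sub_add_left_eq_sub, sub_smul_end] at h1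
  convert h1 using 2
  field_simp

theorem gal_fixed_of_generator (hk : (Module.finrank F K).Prime) {σ : K ≃ₐ[F] K} (hσ : σ ≠ 1)
    {v : K} (hv : σ v = v) (g : K ≃ₐ[F] K) : g v = v := by
  obtain ⟨n, rfl⟩ := mem_powers_iff_mem_zpowers.2 (gal_zpowers hk hσ g)
  simp only
  induction n with
  | zero => simp
  | succ n ih => rw [pow_succ, AlgEquiv.mul_apply, hv, ih]

theorem Adm.eq_top_or_crit (hp : Odd p) [Fact p.Prime] [CharP K p]
    (hk : (Module.finrank F K).Prime) (hk2 : Module.finrank F K ≠ 2) (hpk : p ≠ Module.finrank F K)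
    (hV : Adm p (mu F) V) {σ : K ≃ₐ[F] K} (hσ : σ ≠ 1) {β : K} (hβ : GoodMult σ β)
    (hβ1 : β = 1 ∨ Algebra.norm F β ≠ 1)
    (hc : ∀ y : K, y • tau σ + (σ⁻¹ y * β) • tau σ⁻¹ ∈ V) :
    V = ⊤ ∨ ∀ g : K ≃ₐ[F] K, g ≠ 1 → ∀ x : K, x • tau g + g⁻¹ x • tau g⁻¹ ∈ V := by
  obtain ⟨v, hv, h⟩ := hV.exists_smul_trace hp hk hk2 hpk hσ hβ hβ1
  have hTr : v • ∑ g : K ≃ₐ[F] K, tau g ∈ V := by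
    have h1 := h 1 one_ne_zero (by
      rw [inv_one, one_smul, auxOp_eq]
      have := hc 1
      rw [one_smul, map_one, one_mul] at this
      exact sub_mem this (hV.base _))
    rwa [map_one, mul_one] at h1
  have key : ∀ (g : K ≃ₐ[F] K) (x : K), (x * v) • tau g + (g⁻¹ x * v) • tau g⁻¹ ∈ V := by
    intro g x
    have h := hV.twist_single hTr g x
    rwa [gcoef_smul_trace, gcoef_smul_trace] at h
  by_cases hvβ : v = σ⁻¹ v * β
  · right
    have hβ' : β = 1 := by
      rcases hβ1 with h | h
      · exact h
      · exfalso
        have h1 := congrArg (Algebra.norm F) hvβ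
        rw [map_mul, norm_gal] at h1
        have h2 : Algebra.norm F v ≠ 0 := Algebra.norm_ne_zero_iff.2 hv
        exact h (mul_left_cancel₀ h2 (by rw [mul_one]; exact h1.symm))
    rw [hβ', mul_one] at hvβ
    intro g hg x
    have hgv : g⁻¹ v = v := gal_fixed_of_generator hk (inv_ne_one.2 hσ) hvβ.symm _
    have h1 := key g (x / v)
    rw [map_div₀, hgv, div_mul_cancel₀ _ hv, div_mul_cancel₀ _ hv] at h1
    exact h1
  · left
    apply hV.eq_top_of_full hp hk hpk (inv_ne_one.2 hσ)
    intro x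
    have hne : v - σ⁻¹ v * β ≠ 0 := sub_ne_zero.2 hvβ
    obtain ⟨z, hz⟩ : ∃ z, z = σ (x / (v - σ⁻¹ v * β)) := ⟨_, rfl⟩
    have hz' : σ⁻¹ z = x / (v - σ⁻¹ v * β) := by
      rw [hz, ← AlgEquiv.mul_apply, inv_mul_cancel, AlgEquiv.one_apply]
    have h1 := sub_mem (key σ z) (hc (z * v))
    rw [add_sub_add_left_eq_sub, sub_smul_end, map_mul, hz'] at h1
    convert h1 using 2
    rw [mul_assoc, ← mul_sub, div_mul_cancel₀ _ hne]

end Classify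

section Multiplier

variable {F K : Type} [Field F] [Field K] [Algebra F K] [Finite F] [Finite K]
  [FiniteDimensional F K]

theorem mem_base_of_fixed (hk : (Module.finrank F K).Prime) {σ : K ≃ₐ[F] K} (hσ : σ ≠ 1)
    {v : K} (hv : σ v = v) : ∃ b : F, algebraMap F K b = v := by
  have := (IsGalois.mem_bot_iff_fixed (F := F) v).2 (gal_fixed_of_generator hk hσ hv)
  exact IntermediateField.mem_bot.1 this

theorem exists_pow_eq_algebraMap (hdvd : Module.finrank F K ∣ Nat.card F - 1) {γ : F}
    (hγ : γ ≠ 0) :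
    ∃ β : K, β ^ Module.finrank F K = algebraMap F K γ := by
  have := Fintype.ofFinite F
  have := Fintype.ofFinite K
  obtain ⟨k, hkk⟩ : ∃ k, Module.finrank F K = k := ⟨_, rfl⟩
  obtain ⟨q, hqq⟩ : ∃ q, Nat.card F = q := ⟨_, rfl⟩
  rw [hkk, hqq] at hdvd
  rw [hkk]
  have hq1 : 1 < q := by rw [← hqq]; exact Finite.one_lt_card
  obtain ⟨s, hs⟩ := IsCyclic.exists_generator (α := Kˣ)
  have hord : orderOf s = q ^ k - 1 := by
    rw [orderOf_eq_card_of_forall_mem_zpowers hs, Nat.card_units, Nat.card_eq_fintype_card,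
      Module.card_eq_pow_finrank (K := F), hkk, ← Nat.card_eq_fintype_card, hqq]
  have hγK : algebraMap F K γ ≠ 0 := (map_ne_zero _).2 hγ
  obtain ⟨j, hj⟩ := mem_powers_iff_mem_zpowers.2 (hs (Units.mk0 _ hγK))
  have hj' : s ^ j = Units.mk0 _ hγK := hj
  have h1 : s ^ (j * (q - 1)) = 1 := by
    rw [pow_mul, hj']
    ext
    rw [Units.val_pow_eq_pow_val, Units.val_mk0, ← map_pow, ← hqq, Nat.card_eq_fintype_card,
      FiniteField.pow_card_sub_one_eq_one γ hγ, map_one, Units.val_one]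
  have h2 := orderOf_dvd_of_pow_eq_one h1
  rw [hord, ← geom_sum_mul_of_one_le hq1.le] at h2
  have h3 := Nat.dvd_of_mul_dvd_mul_right (by omega) h2
  have h4 : k ∣ ∑ i ∈ Finset.range k, q ^ i := by
    have hm : q ≡ 1 [MOD k] := ((Nat.modEq_iff_dvd' hq1.le).2 hdvd).symm
    have : ∑ i ∈ Finset.range k, q ^ i ≡ ∑ i ∈ Finset.range k, 1 ^ i [MOD k] :=
      Nat.ModEq.sum fun i _ => hm.pow i
    rw [← Nat.modEq_zero_iff_dvd]
    refine this.trans ?_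
    simp
  obtain ⟨l, rfl⟩ := h4.trans h3
  refine ⟨(s ^ l : Kˣ), ?_⟩
  rw [← Units.val_pow_eq_pow_val, ← pow_mul, mul_comm l, hj', Units.val_mk0]

theorem norm_of_root (hk : (Module.finrank F K).Prime) (hk2 : Module.finrank F K ≠ 2)
    {σ : K ≃ₐ[F] K} (hσ : σ ≠ 1) {β : K} {ω : F} (hω : ω ^ Module.finrank F K = 1)
    (hσβ : σ β = algebraMap F K ω * β) :
    algebraMap F K (Algebra.norm F β) = β ^ Module.finrank F K := by
  classical
  have hord : orderOf σ = Module.finrank F K := by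
    rw [orderOf_eq_card_of_forall_mem_zpowers (gal_zpowers hk hσ), IsGalois.card_aut_eq_finrank]
  have hσpow : ∀ j : ℕ, (σ ^ j) β = algebraMap F K (ω ^ j) * β := by
    intro j
    induction j with
    | zero => simp
    | succ j ih =>
      rw [pow_succ, AlgEquiv.mul_apply, hσβ, map_mul, ih, AlgEquiv.commutes, pow_succ, map_mul]
      ring
  rw [Algebra.norm_eq_prod_automorphisms, ← IsCyclic.image_range_orderOf (gal_zpowers hk hσ),
    Finset.prod_image]
  · simp only [hσpow, Finset.prod_mul_distrib, Finset.prod_const, Finset.card_range, hord]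
    rw [← map_prod, Finset.prod_pow_eq_pow_sum, Finset.sum_range_id]
    obtain ⟨m, hm⟩ := hk.odd_of_ne_two hk2
    have : Module.finrank F K * (Module.finrank F K - 1) / 2 = Module.finrank F K * m := by
      rw [hm, Nat.add_sub_cancel, Nat.mul_left_comm, Nat.mul_div_cancel_left _ (by norm_num)]
    rw [this, pow_mul, hω, one_pow, map_one, one_mul]
  · intro i hi j hj h
    exact pow_injOn_Iio_orderOf (by simpa using hi) (by simpa using hj) h

theorem exists_goodMult (hk : (Module.finrank F K).Prime) (hk2 : Module.finrank F K ≠ 2)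
    {σ : K ≃ₐ[F] K} (hσ : σ ≠ 1) {γ : F} (hγ : γ ≠ 0) :
    ∃ β : K, β ≠ 0 ∧ Algebra.norm F β = γ ∧ GoodMult σ β ∧ (β = 1 ∨ Algebra.norm F β ≠ 1) := by
  have := Fintype.ofFinite F
  by_cases hγ1 : γ = 1
  · exact ⟨1, one_ne_zero, by rw [map_one, hγ1], Or.inl ⟨1, (map_one _).symm⟩, Or.inl rfl⟩
  suffices h : ∃ β : K, Algebra.norm F β = γ ∧ GoodMult σ β by
    obtain ⟨β, h1, h2⟩ := h
    refine ⟨β, ?_, h1, h2, Or.inr (by rwa [h1])⟩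
    rintro rfl
    exact hγ (by rw [← h1, Algebra.norm_zero])
  by_cases hdvd : Module.finrank F K ∣ Nat.card F - 1
  · obtain ⟨β, hβ⟩ := exists_pow_eq_algebraMap (K := K) hdvd hγ
    have hβ0 : β ≠ 0 := by
      rintro rfl
      rw [zero_pow hk.ne_zero] at hβ
      exact hγ ((map_eq_zero (algebraMap F K)).1 hβ.symm)
    have hq1 : 1 < Nat.card F := Finite.one_lt_card
    have hlt : Module.finrank F K < Nat.card F := by
      have := Nat.le_of_dvd (by omega) hdvd
      omega
    obtain ⟨ζ, hζ⟩ : ∃ ζ : Fˣ, orderOf ζ = Module.finrank F K := by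
      have := Fact.mk hk
      exact exists_prime_orderOf_dvd_card' _ (by rwa [Nat.card_units])
    have hprim : IsPrimitiveRoot (ζ : F) (Module.finrank F K) := by
      rw [← hζ]; exact IsPrimitiveRoot.coe_units_iff.2 (IsPrimitiveRoot.orderOf ζ)
    have hprimK := hprim.map_of_injective (algebraMap F K).injective
    have := NeZero.mk hk.ne_zero
    obtain ⟨i, -, hi⟩ := hprimK.eq_pow_of_pow_eq_one (ξ := σ β / β) (by
      rw [div_pow, ← map_pow, hβ, AlgEquiv.commutes, div_self ((map_ne_zero _).2 hγ)])
    rw [← map_pow] at hi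
    have hσβ : σ β = algebraMap F K ((ζ : F) ^ i) * β := by rw [hi, div_mul_cancel₀ _ hβ0]
    have hn := norm_of_root hk hk2 hσ (ω := (ζ : F) ^ i)
      (by rw [← pow_mul, mul_comm, pow_mul, hprim.pow_eq_one, one_pow]) hσβ
    refine ⟨β, (algebraMap F K).injective (by rw [hn, hβ]), ?_⟩
    by_cases hω : (ζ : F) ^ i = 1
    · rw [hω, map_one, one_mul] at hσβ
      obtain ⟨b, hb⟩ := mem_base_of_fixed hk hσ hσβ
      exact Or.inl ⟨b, hb.symm⟩
    · exact Or.inr ⟨hlt, hβ0, _, hω, hσβ⟩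
  · have hcop : (Nat.card Fˣ).Coprime (Module.finrank F K) := by
      rw [Nat.card_units]
      exact ((Nat.Prime.coprime_iff_not_dvd hk).2 hdvd).symm
    obtain ⟨b, hb⟩ := (powCoprime hcop).surjective (Units.mk0 γ hγ)
    refine ⟨algebraMap F K b, ?_, Or.inl ⟨_, rfl⟩⟩
    rw [Algebra.norm_algebraMap]
    have := congrArg Units.val hb
    simpa using this

end Multiplier

section Classification

variable {F K : Type} [Field F] [Field K] [Algebra F K] [Finite F] [Finite K]
  [FiniteDimensional F K] {p : ℕ} {V : AddSubgroup (Module.End F K)}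

theorem Adm.conclude (hp : Odd p) [Fact p.Prime] [CharP K p]
    (hk : (Module.finrank F K).Prime) (hpk : p ≠ Module.finrank F K) {c : K} (hc : c ≠ 0)
    (hV' : Adm p (mu F)
      (V.comap (LinearMap.toAddMonoidHom (LinearMap.lsmul K (Module.End F K) c⁻¹))))
    {N : Module.End F K} (hN : N ∈ V)
    (hcr : V.comap (LinearMap.toAddMonoidHom (LinearMap.lsmul K (Module.End F K) c⁻¹)) = ⊤ ∨
      ∀ g : K ≃ₐ[F] K, g ≠ 1 → ∀ x : K, x • tau g + g⁻¹ x • tau g⁻¹ ∈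
        V.comap (LinearMap.toAddMonoidHom (LinearMap.lsmul K (Module.End F K) c⁻¹))) :
    V = ⊤ ∨ ∃ c : K, c ≠ 0 ∧ (∀ X : Module.End F K, GalSymm (c • X) → X ∈ V) ∧
      GalSymm (c • N) := by
  have hback : ∀ X : Module.End F K,
      c • X ∈ V.comap (LinearMap.toAddMonoidHom (LinearMap.lsmul K (Module.End F K) c⁻¹)) ↔
        X ∈ V := by
    intro X
    change c⁻¹ • c • X ∈ V ↔ X ∈ V
    rw [smul_smul, inv_mul_cancel₀ hc, one_smul]
  have htop : V.comap (LinearMap.toAddMonoidHom (LinearMap.lsmul K (Module.End F K) c⁻¹)) = ⊤ →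
      V = ⊤ := by
    intro h
    rw [eq_top_iff]
    intro X _
    rw [← hback, h]
    exact AddSubgroup.mem_top _
  rcases hcr with h | h
  · exact Or.inl (htop h)
  by_cases hs : GalSymm (c • N)
  · exact Or.inr ⟨c, hc, fun X hX => (hback X).1 (hV'.galSymm_mem hp h hX), hs⟩
  · obtain ⟨g, hg, hfull⟩ := hV'.exists_full_of_not_galSymm h ((hback N).2 hN) hs
    exact Or.inl (htop (hV'.eq_top_of_full hp hk hpk hg hfull))

theorem Adm.classify (hp : Odd p) [Fact p.Prime] [CharP K p]
    (hk : (Module.finrank F K).Prime) (hpk : p ≠ Module.finrank F K) (hV : Adm p (mu F) V)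
    {N : Module.End F K} (hN : N ∈ V) (hNK : ∀ x : K, N ≠ mu F x) :
    V = ⊤ ∨ ∃ c : K, c ≠ 0 ∧ (∀ X : Module.End F K, GalSymm (c • X) → X ∈ V) ∧
      GalSymm (c • N) := by
  obtain ⟨σ, hσ, hn⟩ : ∃ σ : K ≃ₐ[F] K, σ ≠ 1 ∧ gcoef N σ ≠ 0 := by
    by_contra! hcon
    apply hNK (gcoef N 1)
    conv_lhs => rw [← sum_gcoef N]
    rw [Finset.sum_eq_single 1, tau_one, smul_one_eq_mu]
    · intro g _ hg
      rw [hcon g hg]; ext y; simp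
    · simp
  have hσ' : σ⁻¹ ≠ 1 := inv_ne_one.2 hσ
  by_cases hk2 : Module.finrank F K = 2
  · have hinv : σ⁻¹ = σ := gal_eq_of_finrank_two hk2 hσ hσ'
    have hc : (gcoef N σ)⁻¹ ≠ 0 := inv_ne_zero hn
    refine Adm.conclude hp hk hpk hc (hV.scale _ (inv_ne_zero hc)) hN (Or.inr ?_)
    intro g hg x
    rw [gal_eq_of_finrank_two hk2 hσ hg]
    change (gcoef N σ)⁻¹⁻¹ • (x • tau σ + σ⁻¹ x • tau σ⁻¹) ∈ V
    have h := hV.twist_single hN σ x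
    rw [hinv] at h ⊢
    rwa [inv_inv, smul_add, smul_smul, smul_smul, mul_comm _ x, mul_comm _ (σ x)]
  by_cases hn' : gcoef N σ⁻¹ = 0
  · left
    apply hV.eq_top_of_full hp hk hpk hσ
    intro x
    have h := hV.twist_single hN σ (x / gcoef N σ)
    rw [hn', mul_zero, div_mul_cancel₀ _ hn] at h
    convert h using 1
    ext y; simp
  have hN1 : Algebra.norm F (gcoef N σ) ≠ 0 := Algebra.norm_ne_zero_iff.2 hn
  have hN2 : Algebra.norm F (gcoef N σ⁻¹) ≠ 0 := Algebra.norm_ne_zero_iff.2 hn'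
  obtain ⟨β, hβ0, hβn, hβg, hβ1⟩ := exists_goodMult hk hk2 hσ (div_ne_zero hN2 hN1)
  have hδ : Algebra.norm F (β * σ⁻¹ (gcoef N σ) / gcoef N σ⁻¹) = 1 := by
    apply mul_right_cancel₀ hN2
    rw [← map_mul, div_mul_cancel₀ _ hn', map_mul, hβn, norm_gal, one_mul, div_mul_cancel₀ _ hN1]
  obtain ⟨b, hb⟩ := groupCohomology.exists_div_of_norm_eq_one (gal_zpowers hk hσ') hδ
  have hb0 : (b : K) ≠ 0 := b.ne_zero
  refine Adm.conclude hp hk hpk hb0 (hV.scale _ (inv_ne_zero hb0)) hN ?_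
  refine (hV.scale _ (inv_ne_zero hb0)).eq_top_or_crit hp hk hk2 hpk hσ hβg hβ1 fun y => ?_
  change (b : K)⁻¹ • (y • tau σ + (σ⁻¹ y * β) • tau σ⁻¹) ∈ V
  have h := hV.twist_single hN σ ((b : K)⁻¹ * y / gcoef N σ)
  have hs0 : σ⁻¹ (b : K) ≠ 0 := (map_ne_zero _).2 hb0
  have hs1 : σ⁻¹ (gcoef N σ) ≠ 0 := (map_ne_zero _).2 hn
  convert h using 1
  rw [smul_add, smul_smul, smul_smul, div_mul_cancel₀ _ hn]
  congr 2
  rw [map_div₀, map_mul, map_inv₀]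
  field_simp at hb ⊢
  linear_combination (-(σ⁻¹ y)) * hb

end Classification

section SelfAdjoint

variable {F K : Type} [Field F] [Field K] [Algebra F K] [Finite F] [Finite K]
  [FiniteDimensional F K]

/-- The adjoint with respect to the trace form. -/
noncomputable def trAdj (X : Module.End F K) : Module.End F K :=
  ∑ g : K ≃ₐ[F] K, g (gcoef X g⁻¹) • tau g

theorem trace_trAdj (X : Module.End F K) (a b : K) :
    Algebra.trace F K (X a * b) = Algebra.trace F K (a * trAdj X b) := by
  conv_lhs => rw [← sum_gcoef X]
  simp only [trAdj, LinearMap.sum_apply, LinearMap.smul_apply, tau_apply, smul_eq_mul,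
    Finset.sum_mul, Finset.mul_sum, map_sum]
  rw [← Equiv.sum_comp (Equiv.inv (K ≃ₐ[F] K))]
  refine Finset.sum_congr rfl fun g _ => ?_
  rw [Equiv.inv_apply, ← Algebra.trace_eq_of_algEquiv g]
  simp only [map_mul]
  rw [← AlgEquiv.mul_apply g g⁻¹ a, mul_inv_cancel, AlgEquiv.one_apply]
  congr 1
  ring

theorem galSymm_iff_trAdj (X : Module.End F K) : GalSymm X ↔ trAdj X = X := by
  constructor
  · intro h
    conv_rhs => rw [← sum_gcoef X]
    refine Finset.sum_congr rfl fun g _ => ?_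
    rw [h g, ← AlgEquiv.mul_apply, mul_inv_cancel, AlgEquiv.one_apply]
  · intro h g
    have h1 := gcoef_unique (X := X) (n := fun g => g (gcoef X g⁻¹)) h.symm
    have h2 := congrFun h1 g⁻¹
    rw [inv_inv] at h2
    exact h2

theorem galSymm_iff (X : Module.End F K) :
    GalSymm X ↔ ∀ a b, Algebra.trace F K (X a * b) = Algebra.trace F K (a * X b) := by
  rw [galSymm_iff_trAdj]
  constructor
  · intro h a b
    rw [trace_trAdj, h]
  · intro h
    ext b
    have hnd := traceForm_nondegenerate F K
    rw [← sub_eq_zero]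
    apply hnd.2
    intro a
    rw [Algebra.traceForm_apply, mul_sub, map_sub, ← trace_trAdj, h, sub_self]

end SelfAdjoint

section MapUnip

variable {A B : Type*} [Ring A] [Ring B]

/-- The map on invertible `2 × 2` matrices induced by a ring homomorphism. -/
def mapU (f : A →+* B) : (Matrix (Fin 2) (Fin 2) A)ˣ →* (Matrix (Fin 2) (Fin 2) B)ˣ :=
  Units.map (f.mapMatrix : Matrix (Fin 2) (Fin 2) A →+* Matrix (Fin 2) (Fin 2) B).toMonoidHom

theorem mapU_upU (f : A →+* B) (x : A) : mapU f (upU x) = upU (f x) := by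
  ext i j
  fin_cases i <;> fin_cases j <;> simp [mapU, upU_val]

theorem mapU_loU (f : A →+* B) (x : A) : mapU f (loU x) = loU (f x) := by
  ext i j
  fin_cases i <;> fin_cases j <;> simp [mapU, loU_val]

end MapUnip

section EndClassify

variable {F K : Type} [Field F] [Field K] [Algebra F K] [Finite F] [Finite K]
  [FiniteDimensional F K]

theorem end_classify (p : ℕ) (hp : Odd p) [Fact p.Prime] [CharP K p]
    (hk : (Module.finrank F K).Prime) (hpk : p ≠ Module.finrank F K) {s : K} {N : Module.End F K}
    (hs : ∀ x : K, x ≠ 0 → ∃ n : ℕ, s ^ n = x) (hc3 : Nat.card K ≠ 3) (hc9 : Nat.card K ≠ 9)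
    (G : Subgroup (Matrix (Fin 2) (Fin 2) (Module.End F K))ˣ) (h1 : upU 1 ∈ G)
    (h2 : loU (mu F s) ∈ G) (h3 : upU N ∈ G) (hNs : mu F s * N ≠ N * mu F s) :
    (∀ X, upU X ∈ G ∧ loU X ∈ G) ∨
      ∃ c : K, c ≠ 0 ∧ (∀ X : Module.End F K, GalSymm (c • X) → upU X ∈ G ∧ loU X ∈ G) ∧
        GalSymm (c • N) := by
  have hchar : CharP (Module.End F K) p := charP_of_injective_ringHom (mu F).injective p
  have h2K : (2 : K) ≠ 0 := by
    intro h
    exact one_ne_zero (two_ne_torsion (E := K) p hp (x := 1) (y := 0)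
      (by rw [h, zero_mul, zero_mul]))
  have hG : ∀ x : K, upU (mu F x) ∈ G ∧ loU (mu F x) ∈ G := by
    intro x
    have h := dickson h2K s hs hc3 hc9 (G.comap (mapU (mu F)))
      (by rw [Subgroup.mem_comap, mapU_upU, map_one]; exact h1)
      (by rw [Subgroup.mem_comap, mapU_loU]; exact h2) x
    rwa [Subgroup.mem_comap, Subgroup.mem_comap, mapU_upU, mapU_loU] at h
  have hV : Adm p (mu F) (unipSub G) :=
    @adm_unipSub K (Module.End F K) _ _ (mu F) p _ hp hchar G hG
  have hL1 : loU (1 : Module.End F K) ∈ G := by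
    have := (hG 1).2
    rwa [map_one] at this
  have hlo : ∀ X, X ∈ unipSub G → upU X ∈ G ∧ loU X ∈ G := fun X hX =>
    ⟨hX, (loU_mem_of_mem_unipSub h1 hL1).2 hX⟩
  have hNK : ∀ x : K, N ≠ mu F x := by
    rintro x rfl
    rw [← map_mul, ← map_mul, mul_comm] at hNs
    exact hNs rfl
  rcases hV.classify hp hk hpk (N := N) h3 hNK with h | ⟨c, hc, h, hN⟩
  · exact Or.inl fun X => hlo X (by rw [h]; exact AddSubgroup.mem_top _)
  · exact Or.inr ⟨c, hc, fun X hX => hlo X (h X hX), hN⟩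

theorem galSymm_mu (x : K) : GalSymm (mu F x) := by
  rw [galSymm_iff]
  intro a b
  rw [mu_apply, mu_apply]
  congr 1
  ring

end EndClassify

section SingerField

variable {F : Type} [Field F] [Fintype F] {k : ℕ}

theorem aeval_singer (S : Matrix (Fin k) (Fin k) F) (hk : 0 < k)
    (hord : orderOf S = Fintype.card F ^ k - 1) (f : Polynomial F) :
    Polynomial.aeval S f = 0 ∨ ∃ n : ℕ, Polynomial.aeval S f = S ^ n := by
  classical
  have hne : Nonempty (Fin k) := ⟨⟨0, hk⟩⟩
  have hq : 1 < Fintype.card F := Fintype.one_lt_card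
  have hqk : 1 < Fintype.card F ^ k := Nat.one_lt_pow hk.ne' hq
  let P : Finset (Matrix (Fin k) (Fin k) F) :=
    Finset.univ.image fun c : Fin k → F => ∑ i, c i • S ^ (i : ℕ)
  have hmem : ∀ g : Polynomial F, Polynomial.aeval S g ∈ P := by
    intro g
    rw [← Polynomial.aeval_modByMonic_eq_self_of_root (Matrix.aeval_self_charpoly S)]
    have hdeg : (g %ₘ S.charpoly).natDegree < k := by
      have h1 : S.charpoly.natDegree = k := by
        rw [Matrix.charpoly_natDegree_eq_dim, Fintype.card_fin]
      have := Polynomial.natDegree_modByMonic_lt g (Matrix.charpoly_monic S) (by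
        intro h
        rw [h, Polynomial.natDegree_one] at h1
        omega)
      rwa [h1] at this
    rw [Polynomial.aeval_eq_sum_range' hdeg]
    refine Finset.mem_image.2 ⟨fun i => (g %ₘ S.charpoly).coeff i, Finset.mem_univ _, ?_⟩
    exact Fin.sum_univ_eq_sum_range (fun i => (g %ₘ S.charpoly).coeff i • S ^ i) k
  have hS : ∀ n : ℕ, S ^ n ≠ 0 := by
    intro n h
    have h1 : S ^ orderOf S = 1 := pow_orderOf_eq_one S
    have h0 : 0 < orderOf S := by rw [hord]; omega
    have h2 : S ^ (n * orderOf S) = 0 := by rw [pow_mul, h, zero_pow h0.ne']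
    rw [mul_comm, pow_mul, h1, one_pow] at h2
    exact one_ne_zero h2
  let Q : Finset (Matrix (Fin k) (Fin k) F) :=
    insert 0 ((Finset.range (Fintype.card F ^ k - 1)).image (S ^ ·))
  have hQP : Q ⊆ P := by
    intro X hX
    rcases Finset.mem_insert.1 hX with rfl | hX
    · rw [← map_zero (Polynomial.aeval (R := F) S)]; exact hmem 0
    · obtain ⟨n, -, rfl⟩ := Finset.mem_image.1 hX
      have := hmem (Polynomial.X ^ n)
      rwa [map_pow, Polynomial.aeval_X] at this
  have hcardQ : Q.card = Fintype.card F ^ k := by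
    rw [Finset.card_insert_of_notMem, Finset.card_image_of_injOn, Finset.card_range]
    · omega
    · intro i hi j hj h
      exact pow_injOn_Iio_orderOf (by rw [hord]; simpa using hi) (by rw [hord]; simpa using hj) h
    · intro h
      obtain ⟨n, -, hn⟩ := Finset.mem_image.1 h
      exact hS n hn
  have hcardP : P.card ≤ Fintype.card F ^ k := by
    refine Finset.card_image_le.trans ?_
    rw [Finset.card_univ, Fintype.card_fun, Fintype.card_fin]
  have hPQ := Finset.eq_of_subset_of_card_le hQP (by rw [hcardQ]; exact hcardP)
  have h := hmem f
  rw [← hPQ] at h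
  rcases Finset.mem_insert.1 h with h | h
  · exact Or.inl h
  · obtain ⟨n, -, hn⟩ := Finset.mem_image.1 h
    exact Or.inr ⟨n, hn.symm⟩

theorem exists_singer_field (S : Matrix (Fin k) (Fin k) F) (hk : 0 < k)
    (hord : orderOf S = Fintype.card F ^ k - 1) :
    ∃ (K : Type) (_ : Field K) (_ : Algebra F K) (e : (Fin k → F) ≃ₗ[F] K) (s : K),
      (∀ v, e (S.mulVec v) = s * e v) ∧ ∀ x : K, x ≠ 0 → ∃ n : ℕ, s ^ n = x := by
  classical
  have hne : Nonempty (Fin k) := ⟨⟨0, hk⟩⟩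
  have hq : 1 < Fintype.card F := Fintype.one_lt_card
  have hqk : 1 < Fintype.card F ^ k := Nat.one_lt_pow hk.ne' hq
  have h0 : 0 < orderOf S := by rw [hord]; omega
  let A : Subalgebra F (Matrix (Fin k) (Fin k) F) := (Polynomial.aeval S).range
  have hSA : S ∈ A := ⟨Polynomial.X, Polynomial.aeval_X S⟩
  let s : A := ⟨S, hSA⟩
  have hs : ∀ x : A, x ≠ 0 → ∃ n : ℕ, s ^ n = x := by
    rintro ⟨_, f, rfl⟩ hx
    rcases aeval_singer S hk hord f with h | ⟨n, h⟩
    · exact absurd (Subtype.ext h) hx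
    · exact ⟨n, Subtype.ext h.symm⟩
  have hs1 : s ^ orderOf S = 1 := Subtype.ext (pow_orderOf_eq_one S)
  have hfield : IsField A :=
    { exists_pair_ne := ⟨0, 1, fun h => zero_ne_one (congrArg Subtype.val h)⟩
      mul_comm := by
        rintro ⟨_, f, rfl⟩ ⟨_, g, rfl⟩
        apply Subtype.ext
        change Polynomial.aeval S f * Polynomial.aeval S g =
          Polynomial.aeval S g * Polynomial.aeval S f
        rw [← map_mul, ← map_mul, mul_comm]
      mul_inv_cancel := by
        intro x hx
        obtain ⟨n, rfl⟩ := hs x hx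
        refine ⟨s ^ (n * (orderOf S - 1)), ?_⟩
        have e : n + n * (orderOf S - 1) = orderOf S * n := by
          obtain ⟨m, hm⟩ : ∃ m, orderOf S = m + 1 := ⟨orderOf S - 1, by omega⟩
          rw [hm, Nat.add_sub_cancel]; ring
        rw [← pow_add, e, pow_mul, hs1, one_pow] }
  let v₀ : Fin k → F := fun _ => 1
  have hv₀ : v₀ ≠ 0 := fun h => one_ne_zero (congrFun h ⟨0, hk⟩)
  let L : A →ₗ[F] (Fin k → F) :=
    { toFun := fun a => (a : Matrix (Fin k) (Fin k) F).mulVec v₀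
      map_add' := fun a b => Matrix.add_mulVec _ _ _
      map_smul' := fun c a => Matrix.smul_mulVec _ _ _ }
  have hinj : Function.Injective L := by
    rw [← LinearMap.ker_eq_bot, LinearMap.ker_eq_bot']
    intro a ha
    by_contra hne
    obtain ⟨b, hb⟩ := hfield.mul_inv_cancel hne
    rw [hfield.mul_comm] at hb
    have hb' : (b : Matrix (Fin k) (Fin k) F) * a = 1 := congrArg Subtype.val hb
    apply hv₀
    rw [← Matrix.one_mulVec v₀, ← hb', ← Matrix.mulVec_mulVec]
    change (b : Matrix (Fin k) (Fin k) F).mulVec (L a) = 0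
    rw [ha, Matrix.mulVec_zero]
  have hbij : Function.Bijective L := by
    refine hinj.bijective_of_nat_card_le ?_
    have h1 : Function.Injective (fun o : Option (Fin (orderOf S)) =>
        o.elim (0 : A) fun i => s ^ (i : ℕ)) := by
      have hpow0 : ∀ n : ℕ, s ^ n ≠ 0 := by
        intro n h
        have h2 : s ^ (n * orderOf S) = 0 := by rw [pow_mul, h, zero_pow h0.ne']
        rw [mul_comm, pow_mul, hs1, one_pow] at h2
        exact one_ne_zero (congrArg Subtype.val h2)
      rintro (_ | i) (_ | j) h
      · rfl
      · exact absurd h.symm (hpow0 _)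
      · exact absurd h (hpow0 _)
      · have h' : S ^ (i : ℕ) = S ^ (j : ℕ) := congrArg Subtype.val h
        rw [Fin.ext (pow_injOn_Iio_orderOf (Set.mem_Iio.2 i.2) (Set.mem_Iio.2 j.2) h')]
    have h2 := Nat.card_le_card_of_injective _ h1
    rw [Finite.card_option, Nat.card_fin, hord] at h2
    rw [Nat.card_fun, Nat.card_fin, Nat.card_eq_fintype_card]
    omega
  let E := LinearEquiv.ofBijective L hbij
  refine ⟨A, hfield.toField, A.algebra, E.symm, s, ?_, hs⟩
  intro v
  obtain ⟨a, rfl⟩ := E.surjective v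
  apply E.injective
  rw [E.apply_symm_apply, E.symm_apply_apply]
  change S.mulVec (Matrix.mulVec (a : Matrix (Fin k) (Fin k) F) v₀) =
    (S * (a : Matrix (Fin k) (Fin k) F)).mulVec v₀
  rw [Matrix.mulVec_mulVec]

end SingerField

section MatrixTransport

variable {F K : Type} [Field F] [Field K] [Algebra F K] {k : ℕ}

/-- The identification of matrices with endomorphisms of `K` along coordinates on `K`. -/
def matEnd (e : (Fin k → F) ≃ₗ[F] K) :
    Matrix (Fin k) (Fin k) F ≃ₐ[F] Module.End F K :=
  Matrix.toLinAlgEquiv'.trans (LinearEquiv.conjAlgEquiv F e)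

theorem matEnd_apply (e : (Fin k → F) ≃ₗ[F] K) (Z : Matrix (Fin k) (Fin k) F) (v : Fin k → F) :
    matEnd e Z (e v) = e (Z.mulVec v) := by
  simp [matEnd, LinearEquiv.conjAlgEquiv]

/-- The Gram matrix of the scaled trace form. -/
noncomputable def formGram (e : (Fin k → F) ≃ₗ[F] K) (c : K) : Matrix (Fin k) (Fin k) F :=
  Matrix.of fun i j => Algebra.trace F K (c * e (Pi.single i 1) * e (Pi.single j 1))

theorem gram_transpose (e : (Fin k → F) ≃ₗ[F] K) (c : K) :
    (formGram e c).transpose = formGram e c := by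
  ext i j
  simp only [formGram, Matrix.transpose_apply, Matrix.of_apply]
  congr 1
  ring

theorem dotProduct_gram (e : (Fin k → F) ≃ₗ[F] K) (c : K) (v w : Fin k → F) :
    v ⬝ᵥ (formGram e c).mulVec w = Algebra.trace F K (c * e v * e w) := by
  have hdec : ∀ v : Fin k → F, e v = ∑ i, v i • e (Pi.single i 1) := by
    intro v
    conv_lhs => rw [pi_eq_sum_univ' v]
    rw [map_sum]
    refine Finset.sum_congr rfl fun i _ => ?_
    rw [← map_smul]
  rw [hdec v, Finset.mul_sum, Finset.sum_mul, map_sum]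
  simp only [dotProduct, Matrix.mulVec]
  refine Finset.sum_congr rfl fun i _ => ?_
  rw [hdec w, Finset.mul_sum, Finset.mul_sum, map_sum]
  refine Finset.sum_congr rfl fun j _ => ?_
  rw [mul_smul_comm, mul_smul_comm, smul_mul_assoc, map_smul, map_smul, smul_eq_mul, smul_eq_mul]
  simp only [formGram, Matrix.of_apply]
  ring

theorem matrix_ext_dotProduct {A B : Matrix (Fin k) (Fin k) F}
    (h : ∀ v w, v ⬝ᵥ A.mulVec w = v ⬝ᵥ B.mulVec w) : A = B := by
  ext i j
  simpa using h (Pi.single i 1) (Pi.single j 1)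

variable [Finite F] [Finite K] [FiniteDimensional F K]

theorem galSymm_matEnd_iff (e : (Fin k → F) ≃ₗ[F] K) (c : K) (Z : Matrix (Fin k) (Fin k) F) :
    GalSymm (c • matEnd e Z) ↔ (formGram e c * Z).transpose = formGram e c * Z := by
  rw [galSymm_iff, Matrix.transpose_mul, gram_transpose]
  have key : (∀ a b, Algebra.trace F K ((c • matEnd e Z) a * b) =
      Algebra.trace F K (a * (c • matEnd e Z) b)) ↔
      ∀ v w, v ⬝ᵥ (Z.transpose * formGram e c).mulVec w = v ⬝ᵥ (formGram e c * Z).mulVec w := by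
    rw [e.surjective.forall]
    refine forall_congr' fun v => ?_
    rw [e.surjective.forall]
    refine forall_congr' fun w => ?_
    rw [LinearMap.smul_apply, LinearMap.smul_apply, matEnd_apply, matEnd_apply, smul_eq_mul,
      smul_eq_mul, ← Matrix.mulVec_mulVec, ← Matrix.mulVec_mulVec, dotProduct_gram,
      Matrix.dotProduct_mulVec, Matrix.vecMul_transpose, dotProduct_gram]
    rw [mul_left_comm, ← mul_assoc]
  rw [key]
  exact ⟨matrix_ext_dotProduct, fun h v w => by rw [h]⟩

theorem isUnit_gram (e : (Fin k → F) ≃ₗ[F] K) {c : K} (hc : c ≠ 0) : IsUnit (formGram e c) := by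
  rw [Matrix.isUnit_iff_isUnit_det, isUnit_iff_ne_zero]
  intro h
  obtain ⟨w, hw, h0⟩ := Matrix.exists_mulVec_eq_zero_iff.2 h
  have hew : e w ≠ 0 := fun h => hw (e.injective (by rw [h, map_zero]))
  apply Algebra.trace_ne_zero F K
  ext x
  have := dotProduct_gram e c (e.symm (x / (c * e w))) w
  rw [h0, dotProduct_zero, e.apply_symm_apply] at this
  rw [LinearMap.zero_apply, this]
  congr 1
  field_simp

end MatrixTransport

section MatClassify

variable {F : Type} [Field F] [Fintype F] {k : ℕ}

theorem mat_classify (p : ℕ) (hp : Odd p) [Fact p.Prime] [CharP F p] (hk : k.Prime) (hpk : p ≠ k)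
    (h9 : Fintype.card F ^ k ≠ 9) (u : (Matrix (Fin k) (Fin k) F)ˣ)
    (M₂ M₃ : Matrix (Fin k) (Fin k) F)
    (hord : orderOf ((u : Matrix (Fin k) (Fin k) F) * M₂) = Fintype.card F ^ k - 1)
    (hnc : (u : Matrix (Fin k) (Fin k) F) * M₂ * M₃ ≠ M₃ * M₂ * u)
    (G : Subgroup (Matrix (Fin 2) (Fin 2) (Matrix (Fin k) (Fin k) F))ˣ)
    (h1 : upU (u : Matrix (Fin k) (Fin k) F) ∈ G) (h2 : loU M₂ ∈ G) (h3 : upU M₃ ∈ G) :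
    (∀ X, upU X ∈ G ∧ loU X ∈ G) ∨
      ∃ D : (Matrix (Fin k) (Fin k) F)ˣ, D.val.transpose = D ∧
        (D.val * (u * M₂)).transpose = D.val * (u * M₂) ∧
        (D.val * (M₃ * (u⁻¹).val)).transpose = D.val * (M₃ * (u⁻¹).val) ∧
        ∀ Z : Matrix (Fin k) (Fin k) F,
          (D.val * Z).transpose = D.val * Z → upU (Z * u) ∈ G ∧ loU ((u⁻¹).val * Z) ∈ G := by
  obtain ⟨K, _, _, e, s, hes, hs⟩ := exists_singer_field ((u : Matrix (Fin k) (Fin k) F) * M₂)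
    hk.pos hord
  have : Finite K := Finite.of_equiv _ e.toEquiv
  have : FiniteDimensional F K := Module.Finite.equiv e
  have hfr : Module.finrank F K = k := by rw [← e.finrank_eq, Module.finrank_fin_fun]
  have : CharP K p := charP_of_injective_algebraMap (algebraMap F K).injective p
  have hcard : Nat.card K = Fintype.card F ^ k := by
    rw [← Nat.card_congr e.toEquiv, Nat.card_fun, Nat.card_fin, Nat.card_eq_fintype_card]
  have hc3 : Nat.card K ≠ 3 := by
    rw [hcard]
    intro h
    exact Nat.Prime.not_prime_pow hk.two_le (h ▸ Nat.prime_three)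
  have hS : matEnd e (u * M₂) = mu F s := by
    ext x
    obtain ⟨v, rfl⟩ := e.surjective x
    rw [matEnd_apply, hes, mu_apply]
  let Θ : Matrix (Fin k) (Fin k) F →+* Module.End F K := (matEnd e : _ →+* Module.End F K)
  let φ : (Matrix (Fin 2) (Fin 2) (Matrix (Fin k) (Fin k) F))ˣ →*
      (Matrix (Fin 2) (Fin 2) (Module.End F K))ˣ :=
    (mapU Θ).comp (MulAut.conj (diU 1 u)).toMonoidHom
  have hΘ : ∀ X, Θ X = matEnd e X := fun _ => rfl
  have hφinj : Function.Injective φ := by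
    have h : Function.Injective (mapU Θ) := by
      apply Units.map_injective
      exact Matrix.map_injective (matEnd e).injective
    exact h.comp (MulAut.conj (diU 1 u)).injective
  have hφU : ∀ X, φ (upU X) = upU (matEnd e (X * (u⁻¹).val)) := by
    intro X
    change mapU Θ (diU 1 u * upU X * (diU 1 u)⁻¹) = _
    rw [diU_conj_upU, mapU_upU, Units.val_one, one_mul, hΘ]
  have hφL : ∀ X, φ (loU X) = loU (matEnd e (u * X)) := by
    intro X
    change mapU Θ (diU 1 u * loU X * (diU 1 u)⁻¹) = _
    rw [diU_conj_loU, mapU_loU, inv_one, Units.val_one, mul_one, hΘ]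
  have hU : ∀ Z, upU (matEnd e Z) ∈ G.map φ ↔ upU (Z * u) ∈ G := by
    intro Z
    rw [← Subgroup.mem_map_iff_mem hφinj, hφU, mul_assoc, Units.mul_inv, mul_one]
  have hL : ∀ Z, loU (matEnd e Z) ∈ G.map φ ↔ loU ((u⁻¹).val * Z) ∈ G := by
    intro Z
    rw [← Subgroup.mem_map_iff_mem hφinj, hφL, ← mul_assoc, Units.mul_inv, one_mul]
  have hres := end_classify (F := F) p hp (by rw [hfr]; exact hk) (by rw [hfr]; exact hpk)
    (s := s) (N := matEnd e (M₃ * (u⁻¹).val)) hs hc3 (by rw [hcard]; exact h9) (G.map φ)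
    (by rw [← map_one (matEnd e), hU, one_mul]; exact h1)
    (by rw [← hS, hL, ← mul_assoc, Units.inv_mul, one_mul]; exact h2)
    (by rw [hU, mul_assoc, Units.inv_mul, mul_one]; exact h3)
    (by
      rw [← hS, ← map_mul, ← map_mul]
      intro h
      apply hnc
      have h' := congrArg (· * u.val) ((matEnd e).injective h)
      simpa [mul_assoc] using h')
  rcases hres with h | ⟨c, hc, h, hN⟩
  · left
    intro X
    constructor
    · have := (hU (X * (u⁻¹).val)).1 (h _).1
      rwa [mul_assoc, Units.inv_mul, mul_one] at this
    · have := (hL (u.val * X)).1 (h _).2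
      rwa [← mul_assoc, Units.inv_mul, one_mul] at this
  · right
    obtain ⟨D, hD⟩ := isUnit_gram e hc
    refine ⟨D, ?_, ?_, ?_, ?_⟩
    · rw [hD, gram_transpose]
    · rw [hD, ← galSymm_matEnd_iff, hS]
      have : c • mu F s = mu F (c * s) := by
        ext x
        simp
      rw [this]
      exact galSymm_mu _
    · rw [hD, ← galSymm_matEnd_iff]
      exact hN
    · intro Z hZ
      rw [hD, ← galSymm_matEnd_iff] at hZ
      exact ⟨(hU Z).1 (h _ hZ).1, (hL Z).1 (h _ hZ).2⟩

end MatClassify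

section SpecialLinear

variable {F : Type} [Field F] {ι : Type} [Fintype ι] [DecidableEq ι]

theorem coe_transvection_smul {i j : ι} (hij : i ≠ j) (c : F) :
    (Matrix.SpecialLinearGroup.transvection hij c : Matrix ι ι F) =
      1 + c • Matrix.single i j (1 : F) := by
  rw [Matrix.SpecialLinearGroup.transvection_coe, Matrix.smul_single, smul_eq_mul, mul_one]

theorem transvection_eq_commutator {i m j : ι} (him : i ≠ m) (hmj : m ≠ j) (hij : i ≠ j) (c : F) :
    Matrix.SpecialLinearGroup.transvection hij c =
      Matrix.SpecialLinearGroup.transvection him c * Matrix.SpecialLinearGroup.transvection hmj 1 *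
      Matrix.SpecialLinearGroup.transvection him (-c) *
      Matrix.SpecialLinearGroup.transvection hmj (-1) := by
  apply Subtype.ext
  simp only [Matrix.SpecialLinearGroup.coe_mul, coe_transvection_smul]
  simp only [add_mul, mul_add, one_mul, mul_one, Matrix.single_mul_single_same, smul_mul_assoc,
    mul_smul_comm, Matrix.single_mul_single_of_ne _ _ _ _ him.symm,
    Matrix.single_mul_single_of_ne _ _ _ _ hmj.symm,
    Matrix.single_mul_single_of_ne _ _ _ _ hij.symm, zero_mul, smul_zero]
  module

theorem diag2n_eq_transvections {i j : ι} (hij : i ≠ j) {a : F} (ha : a ≠ 0) :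
    Matrix.SpecialLinearGroup.diag2n hij a ha =
      Matrix.SpecialLinearGroup.transvection hij a *
      Matrix.SpecialLinearGroup.transvection hij.symm (-a⁻¹) *
      Matrix.SpecialLinearGroup.transvection hij a *
      (Matrix.SpecialLinearGroup.transvection hij (-1) *
      Matrix.SpecialLinearGroup.transvection hij.symm 1 *
      Matrix.SpecialLinearGroup.transvection hij (-1)) := by
  have hd : (Matrix.SpecialLinearGroup.diag2n hij a ha : Matrix ι ι F) =
      1 + (a - 1) • Matrix.single i i (1 : F) + (a⁻¹ - 1) • Matrix.single j j (1 : F) := by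
    rw [Matrix.SpecialLinearGroup.diag2n_coe]
    ext x y
    by_cases hxy : x = y
    · subst hxy
      by_cases hi : x = i
      · subst hi; simp [hij.symm]
      · by_cases hj : x = j
        · subst hj; simp [hij, hi]
        · simp [hi, hj, Ne.symm hi, Ne.symm hj]
    · have h1 : ∀ l, ¬ (l = x ∧ l = y) := fun l h => hxy (h.1.symm.trans h.2)
      simp [hxy, h1]
  have hw : ∀ b : F, b ≠ 0 → (Matrix.SpecialLinearGroup.transvection hij b *
      Matrix.SpecialLinearGroup.transvection hij.symm (-b⁻¹) *
      Matrix.SpecialLinearGroup.transvection hij b : Matrix ι ι F) =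
      1 - Matrix.single i i (1 : F) - Matrix.single j j (1 : F) + b • Matrix.single i j (1 : F) -
        b⁻¹ • Matrix.single j i (1 : F) := by
    intro b hb
    simp only [coe_transvection_smul]
    simp only [add_mul, mul_add, one_mul, mul_one, Matrix.single_mul_single_same, smul_mul_assoc,
      mul_smul_comm, Matrix.single_mul_single_of_ne _ _ _ _ hij.symm, smul_zero]
    match_scalars <;> field_simp
    ring
  have hw' := hw (-1) (neg_ne_zero.2 one_ne_zero)
  rw [inv_neg, neg_neg, inv_one] at hw'
  apply Subtype.ext
  simp only [Matrix.SpecialLinearGroup.coe_mul]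
  rw [hd, hw a ha, hw']
  simp only [add_mul, mul_add, sub_mul, mul_sub, one_mul, mul_one, Matrix.single_mul_single_same,
    smul_mul_assoc, mul_smul_comm, Matrix.single_mul_single_of_ne _ _ _ _ hij.symm,
    Matrix.single_mul_single_of_ne _ _ _ _ hij, smul_zero]
  module

theorem eq_top_of_transvection_mem {k : ℕ}
    {Γ : Subgroup (Matrix.SpecialLinearGroup (Fin 2 × Fin k) F)} (hk : 0 < k)
    (h : ∀ (i j : Fin 2 × Fin k) (hij : i ≠ j) (c : F), i.1 ≠ j.1 →
      Matrix.SpecialLinearGroup.transvection hij c ∈ Γ) : Γ = ⊤ := by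
  have hT : ∀ (i j : Fin 2 × Fin k) (hij : i ≠ j) (c : F),
      Matrix.SpecialLinearGroup.transvection hij c ∈ Γ := by
    intro i j hij c
    by_cases h1 : i.1 = j.1
    · let m : Fin 2 × Fin k := (i.1 + 1, i.2)
      have hb : ∀ b : Fin 2, b ≠ b + 1 := by decide
      have him : i ≠ m := fun e => hb _ (congrArg Prod.fst e)
      have hmj : m ≠ j := fun e => hb _ (h1.trans (congrArg Prod.fst e).symm)
      rw [transvection_eq_commutator him hmj hij]
      have e1 : i.1 ≠ m.1 := hb _
      have e2 : m.1 ≠ j.1 := by rw [← h1]; exact (hb _).symm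
      exact mul_mem (mul_mem (mul_mem (h _ _ _ _ e1) (h _ _ _ _ e2)) (h _ _ _ _ e1)) (h _ _ _ _ e2)
    · exact h i j hij c h1
  have hn : Nontrivial (Fin 2 × Fin k) :=
    ⟨(0, ⟨0, hk⟩), (1, ⟨0, hk⟩), fun e => zero_ne_one (congrArg Prod.fst e)⟩
  rw [Subgroup.eq_top_iff']
  intro M
  refine Matrix.SpecialLinearGroup.diagonal_transvection_induction' (· ∈ Γ) M ?_ hT
    (fun A B => mul_mem)
  intro i j hij c hc
  rw [diag2n_eq_transvections]
  exact mul_mem (mul_mem (mul_mem (hT _ _ _ _) (hT _ _ _ _)) (hT _ _ _ _))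
    (mul_mem (mul_mem (hT _ _ _ _) (hT _ _ _ _)) (hT _ _ _ _))

end SpecialLinear

section Symplectic

variable {F : Type} [Field F] {k : ℕ}

/-- Block assembly, as an isomorphism between groups of invertible matrices. -/
def blockEquiv (k : ℕ) (F : Type) [Field F] :
    (Matrix (Fin 2) (Fin 2) (Matrix (Fin k) (Fin k) F))ˣ ≃* GL (Fin 2 × Fin k) F :=
  Units.mapEquiv (Matrix.compRingEquiv (Fin 2) (Fin k) F).toMulEquiv

theorem blockEquiv_val (w : (Matrix (Fin 2) (Fin 2) (Matrix (Fin k) (Fin k) F))ˣ) :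
    (blockEquiv k F w : Matrix (Fin 2 × Fin k) (Fin 2 × Fin k) F) = blocks2 w.val := rfl

theorem blocks2_mul (A B : Matrix (Fin 2) (Fin 2) (Matrix (Fin k) (Fin k) F)) :
    blocks2 (A * B) = blocks2 A * blocks2 B :=
  map_mul (Matrix.compRingEquiv (Fin 2) (Fin k) F) A B

theorem blocks2_injective :
    Function.Injective (blocks2 : Matrix (Fin 2) (Fin 2) (Matrix (Fin k) (Fin k) F) → _) :=
  (Matrix.compRingEquiv (Fin 2) (Fin k) F).injective

theorem blocks2_transpose (A : Matrix (Fin 2) (Fin 2) (Matrix (Fin k) (Fin k) F)) :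
    (blocks2 A)ᵀ = blocks2 (Aᵀ.map Matrix.transpose) := rfl

theorem blockEquiv_mem_SpGL_iff (w : (Matrix (Fin 2) (Fin 2) (Matrix (Fin k) (Fin k) F))ˣ) :
    blockEquiv k F w ∈ SpGL (blocks2 (k := k) (F := F) !![0, -1; 1, 0]) ↔
      (w.val 1 0)ᵀ * w.val 0 0 = (w.val 0 0)ᵀ * w.val 1 0 ∧
      (w.val 1 1)ᵀ * w.val 0 1 = (w.val 0 1)ᵀ * w.val 1 1 ∧
      (w.val 0 0)ᵀ * w.val 1 1 - (w.val 1 0)ᵀ * w.val 0 1 = 1 := by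
  obtain ⟨a, ha⟩ : ∃ a, w.val 0 0 = a := ⟨_, rfl⟩
  obtain ⟨b, hb⟩ : ∃ a, w.val 0 1 = a := ⟨_, rfl⟩
  obtain ⟨c, hc⟩ : ∃ a, w.val 1 0 = a := ⟨_, rfl⟩
  obtain ⟨d, hd⟩ : ∃ a, w.val 1 1 = a := ⟨_, rfl⟩
  have hw : w.val = !![a, b; c, d] := by
    ext i j : 2
    fin_cases i <;> fin_cases j <;> simp [ha, hb, hc, hd]
  rw [ha, hb, hc, hd]
  change (blocks2 w.val)ᵀ * _ * blocks2 w.val = _ ↔ _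
  rw [blocks2_transpose, ← blocks2_mul, ← blocks2_mul, blocks2_injective.eq_iff, hw]
  have e1 : (!![a, b; c, d]ᵀ.map Matrix.transpose) * !![0, -1; 1, 0] * !![a, b; c, d] =
      !![cᵀ * a - aᵀ * c, cᵀ * b - aᵀ * d; dᵀ * a - bᵀ * c, dᵀ * b - bᵀ * d] := by
    ext i j : 2
    fin_cases i <;> fin_cases j <;>
      simp [Matrix.mul_apply, Fin.sum_univ_two, sub_eq_add_neg]
  rw [e1]
  constructor
  · intro h
    have h00 := congrFun (congrFun h 0) 0
    have h01 := congrFun (congrFun h 0) 1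
    have h11 := congrFun (congrFun h 1) 1
    simp only [Matrix.of_apply, Matrix.cons_val_zero, Matrix.cons_val_one,
      Matrix.cons_val'] at h00 h01 h11
    refine ⟨sub_eq_zero.1 h00, sub_eq_zero.1 h11, ?_⟩
    rw [← neg_sub, h01, neg_neg]
  · rintro ⟨h1, h2, h3⟩
    have h4 : dᵀ * a - bᵀ * c = 1 := by
      have := congrArg Matrix.transpose h3
      simpa using this
    rw [h1, h2, h4, sub_self, sub_self, ← neg_sub, h3]

/-- The subgroup generated by the symmetric unipotent elements. -/
def symU (k : ℕ) (F : Type) [Field F] :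
    Subgroup (Matrix (Fin 2) (Fin 2) (Matrix (Fin k) (Fin k) F))ˣ :=
  Subgroup.closure {g | ∃ Y : Matrix (Fin k) (Fin k) F, Yᵀ = Y ∧ (g = upU Y ∨ g = loU Y)}

theorem upU_mem_symU {Y : Matrix (Fin k) (Fin k) F} (hY : Yᵀ = Y) : upU Y ∈ symU k F :=
  Subgroup.subset_closure ⟨Y, hY, Or.inl rfl⟩

theorem loU_mem_symU {Y : Matrix (Fin k) (Fin k) F} (hY : Yᵀ = Y) : loU Y ∈ symU k F :=
  Subgroup.subset_closure ⟨Y, hY, Or.inr rfl⟩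

/-- The preimage of the symplectic group under block assembly. -/
def spU (k : ℕ) (F : Type) [Field F] :
    Subgroup (Matrix (Fin 2) (Fin 2) (Matrix (Fin k) (Fin k) F))ˣ :=
  (SpGL (blocks2 (k := k) (F := F) !![0, -1; 1, 0])).comap (blockEquiv k F).toMonoidHom

theorem mem_spU_iff (w : (Matrix (Fin 2) (Fin 2) (Matrix (Fin k) (Fin k) F))ˣ) :
    w ∈ spU k F ↔
      (w.val 1 0)ᵀ * w.val 0 0 = (w.val 0 0)ᵀ * w.val 1 0 ∧
      (w.val 1 1)ᵀ * w.val 0 1 = (w.val 0 1)ᵀ * w.val 1 1 ∧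
      (w.val 0 0)ᵀ * w.val 1 1 - (w.val 1 0)ᵀ * w.val 0 1 = 1 :=
  blockEquiv_mem_SpGL_iff w

theorem symU_le_spU : symU k F ≤ spU k F := by
  rw [symU, Subgroup.closure_le]
  rintro _ ⟨Y, hY, rfl | rfl⟩
  · exact (mem_spU_iff _).2 (by simp [upU_val, hY])
  · exact (mem_spU_iff _).2 (by simp [loU_val, hY])

/-- The inverse transpose of an invertible matrix. -/
def contra (P : (Matrix (Fin k) (Fin k) F)ˣ) : (Matrix (Fin k) (Fin k) F)ˣ where
  val := (P⁻¹).valᵀ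
  inv := P.valᵀ
  val_inv := by rw [← Matrix.transpose_mul, Units.mul_inv, Matrix.transpose_one]
  inv_val := by rw [← Matrix.transpose_mul, Units.inv_mul, Matrix.transpose_one]

theorem contra_val (P : (Matrix (Fin k) (Fin k) F)ˣ) : (contra P).val = (P⁻¹).valᵀ := rfl

theorem contra_mul (P Q : (Matrix (Fin k) (Fin k) F)ˣ) : contra (P * Q) = contra P * contra Q := by
  ext1
  rw [Units.val_mul, contra_val, contra_val, contra_val, _root_.mul_inv_rev, Units.val_mul,
    Matrix.transpose_mul]

theorem diU_mul {E : Type*} [Ring E] (a b c d : Eˣ) : diU (a * c) (b * d) = diU a b * diU c d := by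
  ext1
  simp [diU_val]

theorem levi_mem_of_eq_one_add {P : (Matrix (Fin k) (Fin k) F)ˣ} {X Y : Matrix (Fin k) (Fin k) F}
    (hX : Xᵀ = X) (hY : Yᵀ = Y) (hP : P.val = 1 + X * Y) : diU P (contra P) ∈ symU k F := by
  have hPT : P.valᵀ = 1 + Y * X := by rw [hP]; simp [hX, hY]
  have h1 : (contra P).val * (1 + Y * X) = 1 := by
    rw [← hPT]; exact (contra P).mul_inv
  have h1' : (1 + Y * X) * (contra P).val = 1 := by
    rw [← hPT]; exact (contra P).inv_mul
  have hYP : Y * (P⁻¹).val = (contra P).val * Y := by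
    calc Y * (P⁻¹).val = (contra P).val * (1 + Y * X) * Y * (P⁻¹).val := by rw [h1, one_mul]
      _ = (contra P).val * Y * ((1 + X * Y) * (P⁻¹).val) := by noncomm_ring
      _ = (contra P).val * Y := by rw [← hP, Units.mul_inv, mul_one]
  have hXP : (P⁻¹).val * X = X * (contra P).val := by
    calc (P⁻¹).val * X = (P⁻¹).val * X * ((1 + Y * X) * (contra P).val) := by rw [h1', mul_one]
      _ = ((P⁻¹).val * (1 + X * Y)) * X * (contra P).val := by noncomm_ring
      _ = X * (contra P).val := by rw [← hP, Units.inv_mul, one_mul]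
  have hs1 : (Y * (P⁻¹).val)ᵀ = Y * (P⁻¹).val := by
    rw [Matrix.transpose_mul, hY, ← contra_val, hYP]
  have hs2 : ((P⁻¹).val * X)ᵀ = (P⁻¹).val * X := by
    rw [Matrix.transpose_mul, hX, ← contra_val, hXP]
  have key : loU (Y * (P⁻¹).val) * diU P (contra P) * upU ((P⁻¹).val * X) = upU X * loU Y := by
    ext1
    simp only [Units.val_mul, upU_val, loU_val, diU_val]
    have e : Y * (P⁻¹).val * X + (contra P).val = 1 := by
      rw [hYP, mul_assoc, ← mul_add_one, add_comm, h1]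
    have e1 : Y * (P⁻¹).val * P.val = Y := by rw [mul_assoc, Units.inv_mul, mul_one]
    have e2 : P.val * ((P⁻¹).val * X) = X := by rw [← mul_assoc, Units.mul_inv, one_mul]
    rw [Matrix.mul_fin_two, Matrix.mul_fin_two, Matrix.mul_fin_two]
    simp only [one_mul, mul_zero, zero_mul, add_zero, zero_add, mul_one, e1, e2]
    rw [← mul_assoc, e, hP]
  have : diU P (contra P) =
      (loU (Y * (P⁻¹).val))⁻¹ * (upU X * loU Y) * (upU ((P⁻¹).val * X))⁻¹ := by
    rw [← key]; group
  rw [this]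
  exact mul_mem (mul_mem (inv_mem (loU_mem_symU hs1)) (mul_mem (upU_mem_symU hX) (loU_mem_symU hY)))
    (inv_mem (upU_mem_symU hs2))

theorem levi_mem_symU (P : (Matrix (Fin k) (Fin k) F)ˣ) : diU P (contra P) ∈ symU k F := by
  have h : ∀ M : Matrix (Fin k) (Fin k) F, M.det ≠ 0 →
      ∀ P : (Matrix (Fin k) (Fin k) F)ˣ, P.val = M → diU P (contra P) ∈ symU k F := by
    intro M hM
    refine Matrix.diagonal_transvection_induction_of_det_ne_zero (fun M =>
      ∀ P : (Matrix (Fin k) (Fin k) F)ˣ, P.val = M → diU P (contra P) ∈ symU k F) M hM ?_ ?_ ?_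
    · intro d _ P hP
      refine levi_mem_of_eq_one_add (X := Matrix.diagonal fun i => d i - 1) (Y := 1)
        (Matrix.diagonal_transpose _) Matrix.transpose_one ?_
      rw [hP, mul_one, ← Matrix.diagonal_one, Matrix.diagonal_add]
      simp
    · rintro ⟨i, j, hij, c⟩ P hP
      refine levi_mem_of_eq_one_add (X := Matrix.single i i c)
        (Y := Matrix.single i j 1 + Matrix.single j i 1) (by simp)
        (by simp [add_comm]) ?_
      rw [hP]
      simp [Matrix.transvection, mul_add, hij]
    · intro A B hA hB ihA ihB P hP
      obtain ⟨a, ha⟩ := (Matrix.isUnit_iff_isUnit_det A).2 hA.isUnit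
      obtain ⟨b, hb⟩ := (Matrix.isUnit_iff_isUnit_det B).2 hB.isUnit
      obtain rfl : P = a * b := by ext1; rw [hP, Units.val_mul, ha, hb]
      rw [contra_mul, diU_mul]
      exact mul_mem (ihA a ha) (ihB b hb)
  refine h P.val ?_ P rfl
  exact ((Matrix.isUnit_iff_isUnit_det _).1 P.isUnit).ne_zero

theorem mem_symU_of_isUnit {w : (Matrix (Fin 2) (Fin 2) (Matrix (Fin k) (Fin k) F))ˣ}
    (hw : w ∈ spU k F) (hA : IsUnit (w.val 0 0)) : w ∈ symU k F := by
  obtain ⟨P, hP⟩ := hA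
  obtain ⟨h1, -, -⟩ := (mem_spU_iff w).1 hw
  have hs : (w.val 1 0 * (P⁻¹).val)ᵀ = w.val 1 0 * (P⁻¹).val := by
    rw [← hP] at h1
    calc (w.val 1 0 * (P⁻¹).val)ᵀ
        = (contra P).val * ((w.val 1 0)ᵀ * P.val) * (P⁻¹).val := by
          rw [Matrix.transpose_mul, ← contra_val, mul_assoc, mul_assoc, Units.mul_inv, mul_one]
      _ = ((contra P).val * P.valᵀ) * (w.val 1 0 * (P⁻¹).val) := by rw [h1]; noncomm_ring
      _ = _ := by
          have : (contra P).val * P.valᵀ = 1 := (contra P).mul_inv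
          rw [this, one_mul]
  have hg1 : loU (w.val 1 0 * (P⁻¹).val) ∈ symU k F := loU_mem_symU hs
  have hg2 : diU P (contra P) ∈ symU k F := levi_mem_symU P
  set g := (diU P (contra P))⁻¹ * (loU (w.val 1 0 * (P⁻¹).val))⁻¹ * w with hg
  have hgs : g ∈ spU k F :=
    mul_mem (mul_mem (inv_mem (symU_le_spU hg2)) (inv_mem (symU_le_spU hg1))) hw
  have hw' : loU (w.val 1 0 * (P⁻¹).val) * diU P (contra P) * g = w := by rw [hg]; group
  have hwv := congrArg Units.val hw'
  simp only [Units.val_mul, loU_val, diU_val] at hwv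
  have h00 := congrFun (congrFun hwv 0) 0
  have h10 := congrFun (congrFun hwv 1) 0
  simp only [Matrix.mul_apply, Fin.sum_univ_two] at h00 h10
  simp [← hP] at h00 h10
  replace h00 : g.val 0 0 = 1 := P.isUnit.mul_left_cancel (h00.trans (mul_one _).symm)
  have hg0 : g.val 1 0 = 0 := by
    rw [h00, mul_one] at h10
    exact (contra P).isUnit.mul_left_cancel ((add_eq_left.1 h10).trans (mul_zero _).symm)
  obtain ⟨e1, e2, e3⟩ := (mem_spU_iff g).1 hgs
  rw [h00, hg0] at e3
  have h11 : g.val 1 1 = 1 := by simpa using e3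
  rw [h11] at e2
  have hs2 : (g.val 0 1)ᵀ = g.val 0 1 := by simpa using e2.symm
  have : g = upU (g.val 0 1) := by
    ext i j : 3
    fin_cases i <;> fin_cases j <;> simp [upU_val, h00, hg0, h11]
  rw [← hw', this]
  exact mul_mem (mul_mem hg1 hg2) (upU_mem_symU hs2)

theorem spU_le_symU : spU k F ≤ symU k F := by
  classical
  intro w hw
  obtain ⟨L, L', d, hd⟩ :=
    Matrix.Pivot.exists_list_transvec_mul_mul_list_transvec_eq_diagonal (w.val 0 0)
  have hunit : ∀ l : List (Matrix.TransvectionStruct (Fin k) F),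
      IsUnit (l.map Matrix.TransvectionStruct.toMatrix).prod := fun l => by
    rw [Matrix.isUnit_iff_isUnit_det, Matrix.TransvectionStruct.det_toMatrix_prod]
    exact isUnit_one
  obtain ⟨P, hP⟩ := hunit L
  obtain ⟨Q, hQ⟩ := hunit L'
  rw [← hP, ← hQ] at hd
  set g := diU P (contra P) * w * diU Q (contra Q) with hg
  have hgs : g ∈ spU k F :=
    mul_mem (mul_mem (symU_le_spU (levi_mem_symU P)) hw) (symU_le_spU (levi_mem_symU Q))
  suffices hmem : g ∈ symU k F by
    have : w = (diU P (contra P))⁻¹ * g * (diU Q (contra Q))⁻¹ := by rw [hg]; group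
    rw [this]
    exact mul_mem (mul_mem (inv_mem (levi_mem_symU P)) hmem) (inv_mem (levi_mem_symU Q))
  have h00 : g.val 0 0 = Matrix.diagonal d := by
    rw [← hd, hg, Units.val_mul, Units.val_mul]
    simp only [Matrix.mul_apply (l := Fin 2), Fin.sum_univ_two]
    simp [diU_val]
  obtain ⟨e1, -, e3⟩ := (mem_spU_iff g).1 hgs
  rw [h00, Matrix.diagonal_transpose] at e1 e3
  have hC : ∀ i j, g.val 1 0 j i * d j = d i * g.val 1 0 i j := fun i j => by
    simpa using congrFun (congrFun e1 i) j
  set C := g.val 1 0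
  set X : Matrix (Fin k) (Fin k) F := Matrix.diagonal fun i => if d i = 0 then 1 else 0 with hX
  have hXs : Xᵀ = X := Matrix.diagonal_transpose _
  have hinv : IsUnit (Matrix.diagonal d + X * C) := by
    rw [Matrix.isUnit_iff_isUnit_det, isUnit_iff_ne_zero]
    intro hdet
    obtain ⟨v, hv, hv0⟩ := Matrix.exists_mulVec_eq_zero_iff.2 hdet
    rw [Matrix.add_mulVec, ← Matrix.mulVec_mulVec] at hv0
    have hvi : ∀ i, d i * v i + (if d i = 0 then 1 else 0) * (C *ᵥ v) i = 0 := fun i => by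
      have := congrFun hv0 i
      rwa [Pi.add_apply, Matrix.mulVec_diagonal, hX, Matrix.mulVec_diagonal] at this
    have hA : ∀ i, d i ≠ 0 → v i = 0 := fun i hi => by simpa [hi] using hvi i
    have hCv : C *ᵥ v = 0 := by
      ext i
      by_cases hi : d i = 0
      · simpa [hi] using hvi i
      · change ∑ j, C i j * v j = 0
        refine Finset.sum_eq_zero fun j _ => ?_
        by_cases hj : d j = 0
        · have := hC i j
          rw [hj, mul_zero, eq_comm, mul_eq_zero, or_iff_right hi] at this
          rw [this, zero_mul]
        · rw [hA j hj, mul_zero]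
    have hdv : Matrix.diagonal d *ᵥ v = 0 := by
      ext i
      rw [Matrix.mulVec_diagonal]
      by_cases hi : d i = 0
      · simp [hi]
      · simp [hA i hi]
    have e4 := congrArg Matrix.transpose e3
    simp only [Matrix.transpose_sub, Matrix.transpose_mul, Matrix.diagonal_transpose,
      Matrix.transpose_transpose, Matrix.transpose_one] at e4
    apply hv
    calc v = (1 : Matrix (Fin k) (Fin k) F) *ᵥ v := (Matrix.one_mulVec v).symm
      _ = 0 := by
        rw [← e4, Matrix.sub_mulVec, ← Matrix.mulVec_mulVec, ← Matrix.mulVec_mulVec, hdv, hCv]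
        simp
  have hm : upU X * g ∈ symU k F := by
    refine mem_symU_of_isUnit (mul_mem (symU_le_spU (upU_mem_symU hXs)) hgs) ?_
    convert hinv using 1
    rw [← h00]
    simp [upU_val, Matrix.mul_apply, Fin.sum_univ_two, C]
  have : g = (upU X)⁻¹ * (upU X * g) := by group
  rw [this]
  exact mul_mem (inv_mem (upU_mem_symU hXs)) hm

theorem symU_eq_spU : symU k F = spU k F := le_antisymm symU_le_spU spU_le_symU

/-- The symmetric unipotent elements generate a copy of the symplectic group. -/
theorem nonempty_symU_mulEquiv :
    Nonempty (symU k F ≃* SpGL (blocks2 (k := k) (F := F) !![0, -1; 1, 0])) := by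
  rw [symU_eq_spU]
  have h : (spU k F).map (blockEquiv k F).toMonoidHom =
      SpGL (blocks2 (k := k) (F := F) !![0, -1; 1, 0]) :=
    Subgroup.map_comap_eq_self_of_surjective (blockEquiv k F).surjective _
  exact ⟨((blockEquiv k F).subgroupMap (spU k F)).trans (MulEquiv.subgroupCongr h)⟩

end Symplectic

section Final

variable {F : Type} [Field F] {k : ℕ}

theorem det_blocks2 (A B C D : Matrix (Fin k) (Fin k) F) :
    (blocks2 !![A, B; C, D]).det = (Matrix.fromBlocks A B C D).det := by
  let f : Fin k ⊕ Fin k → Fin 2 × Fin k := Sum.elim (fun i => (0, i)) (fun i => (1, i))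
  have hf : Function.Bijective f := by
    refine ⟨?_, ?_⟩
    · rintro (i | i) (j | j) h <;> simp [f] at h <;> simp [h]
    · rintro ⟨b, i⟩
      fin_cases b
      · exact ⟨Sum.inl i, rfl⟩
      · exact ⟨Sum.inr i, rfl⟩
  rw [← Matrix.det_submatrix_equiv_self (Equiv.ofBijective f hf)]
  congr 1
  ext i j
  rcases i with i | i <;> rcases j with j | j <;> rfl

/-- Block disassembly of the special linear group. -/
def slBlock (k : ℕ) (F : Type) [Field F] :
    Matrix.SpecialLinearGroup (Fin 2 × Fin k) F →*
      (Matrix (Fin 2) (Fin 2) (Matrix (Fin k) (Fin k) F))ˣ :=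
  (blockEquiv k F).symm.toMonoidHom.comp Matrix.SpecialLinearGroup.toGL

theorem blocks2_slBlock (g : Matrix.SpecialLinearGroup (Fin 2 × Fin k) F) :
    blocks2 (slBlock k F g).val = g.val := by
  rw [← blockEquiv_val]
  change ((blockEquiv k F) ((blockEquiv k F).symm (Matrix.SpecialLinearGroup.toGL g))).val = _
  rw [MulEquiv.apply_symm_apply]
  rfl

theorem slBlock_eq_iff {g : Matrix.SpecialLinearGroup (Fin 2 × Fin k) F}
    {w : (Matrix (Fin 2) (Fin 2) (Matrix (Fin k) (Fin k) F))ˣ} :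
    slBlock k F g = w ↔ g.val = blocks2 w.val := by
  rw [← blocks2_slBlock, blocks2_injective.eq_iff, Units.ext_iff]

theorem slBlock_injective : Function.Injective (slBlock k F) := by
  intro g h e
  apply Subtype.ext
  rw [← blocks2_slBlock, e, blocks2_slBlock]

theorem exists_slBlock_eq_upU (X : Matrix (Fin k) (Fin k) F) : ∃ g, slBlock k F g = upU X :=
  ⟨⟨blocks2 !![1, X; 0, 1], by rw [det_blocks2, Matrix.det_fromBlocks_zero₂₁]; simp⟩,
    slBlock_eq_iff.2 rfl⟩

theorem exists_slBlock_eq_loU (X : Matrix (Fin k) (Fin k) F) : ∃ g, slBlock k F g = loU X :=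
  ⟨⟨blocks2 !![1, 0; X, 1], by rw [det_blocks2, Matrix.det_fromBlocks_zero₁₂]; simp⟩,
    slBlock_eq_iff.2 rfl⟩

/-- The generators of the group of the main theorem. -/
def slGens (M₁ M₂ M₃ : Matrix (Fin k) (Fin k) F) :
    Set (Matrix.SpecialLinearGroup (Fin 2 × Fin k) F) :=
  {g | (g : Matrix (Fin 2 × Fin k) (Fin 2 × Fin k) F) = blocks2 !![1, M₁; 0, 1] ∨
    (g : Matrix (Fin 2 × Fin k) (Fin 2 × Fin k) F) = blocks2 !![1, 0; M₂, 1] ∨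
    (g : Matrix (Fin 2 × Fin k) (Fin 2 × Fin k) F) = blocks2 !![1, M₃; 0, 1]}

theorem slBlock_image_slGens (M₁ M₂ M₃ : Matrix (Fin k) (Fin k) F) :
    slBlock k F '' slGens M₁ M₂ M₃ = {upU M₁, loU M₂, upU M₃} := by
  ext w
  constructor
  · rintro ⟨g, h | h | h, rfl⟩
    · exact Or.inl (slBlock_eq_iff.2 h)
    · exact Or.inr (Or.inl (slBlock_eq_iff.2 h))
    · exact Or.inr (Or.inr (slBlock_eq_iff.2 h))
  · rintro (rfl | rfl | rfl)
    · obtain ⟨g, hg⟩ := exists_slBlock_eq_upU M₁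
      exact ⟨g, Or.inl (slBlock_eq_iff.1 hg), hg⟩
    · obtain ⟨g, hg⟩ := exists_slBlock_eq_loU M₂
      exact ⟨g, Or.inr (Or.inl (slBlock_eq_iff.1 hg)), hg⟩
    · obtain ⟨g, hg⟩ := exists_slBlock_eq_upU M₃
      exact ⟨g, Or.inr (Or.inr (slBlock_eq_iff.1 hg)), hg⟩

theorem eq_top_of_unipotents_mem {Γ : Subgroup (Matrix.SpecialLinearGroup (Fin 2 × Fin k) F)}
    (hk : 0 < k) (h : ∀ X, upU X ∈ Γ.map (slBlock k F) ∧ loU X ∈ Γ.map (slBlock k F)) : Γ = ⊤ := by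
  refine eq_top_of_transvection_mem hk fun i j hij c h1 => ?_
  have hmem : slBlock k F (Matrix.SpecialLinearGroup.transvection hij c) ∈ Γ.map (slBlock k F) := by
    obtain ⟨a, i⟩ := i
    obtain ⟨b, j⟩ := j
    have hb : (a = 0 ∧ b = 1) ∨ (a = 1 ∧ b = 0) := by
      fin_cases a <;> fin_cases b <;> simp_all
    rcases hb with ⟨rfl, rfl⟩ | ⟨rfl, rfl⟩
    · convert (h (Matrix.single i j c)).1
      rw [slBlock_eq_iff, Matrix.SpecialLinearGroup.transvection_coe]
      ext ⟨x, s⟩ ⟨y, t⟩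
      fin_cases x <;> fin_cases y <;>
        simp [blocks2, upU_val, Matrix.one_apply, Matrix.single_apply]
    · convert (h (Matrix.single i j c)).2
      rw [slBlock_eq_iff, Matrix.SpecialLinearGroup.transvection_coe]
      ext ⟨x, s⟩ ⟨y, t⟩
      fin_cases x <;> fin_cases y <;>
        simp [blocks2, loU_val, Matrix.one_apply, Matrix.single_apply]
  obtain ⟨g, hg, e⟩ := hmem
  rwa [← slBlock_injective e]

theorem map_conj_closure_eq_symU {D u : (Matrix (Fin k) (Fin k) F)ˣ}
    {M₂ M₃ : Matrix (Fin k) (Fin k) F} (hD : D.valᵀ = D)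
    (h2 : (D.val * (u.val * M₂))ᵀ = D.val * (u.val * M₂))
    (h3 : (D.val * (M₃ * u⁻¹.val))ᵀ = D.val * (M₃ * u⁻¹.val))
    (hZ : ∀ Z : Matrix (Fin k) (Fin k) F, (D.val * Z)ᵀ = D.val * Z →
      upU (Z * u.val) ∈ Subgroup.closure {upU u.val, loU M₂, upU M₃} ∧
      loU (u⁻¹.val * Z) ∈ Subgroup.closure {upU u.val, loU M₂, upU M₃}) :
    (Subgroup.closure {upU u.val, loU M₂, upU M₃}).map (MulAut.conj (diU D u)).toMonoidHom =
      symU k F := by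
  have hDi : (D⁻¹.val)ᵀ = D⁻¹.val := by
    have : D⁻¹.val * (D.val * (D⁻¹.val)ᵀ) = D⁻¹.val := by
      conv_lhs => rw [← hD, ← Matrix.transpose_mul]
      simp
    rwa [← mul_assoc, Units.inv_mul, one_mul] at this
  apply le_antisymm
  · rw [MonoidHom.map_closure, Subgroup.closure_le]
    rintro _ ⟨w, rfl | rfl | rfl, rfl⟩
    · change diU D u * _ * (diU D u)⁻¹ ∈ symU k F
      rw [diU_conj_upU]
      refine upU_mem_symU ?_
      rw [mul_assoc, Units.mul_inv, mul_one, hD]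
    · change diU D u * _ * (diU D u)⁻¹ ∈ symU k F
      rw [diU_conj_loU]
      refine loU_mem_symU ?_
      have : u.val * M₂ * D⁻¹.val = D⁻¹.val * (D.val * (u.val * M₂)) * D⁻¹.val := by
        rw [← mul_assoc D⁻¹.val, Units.inv_mul, one_mul]
      rw [this, Matrix.transpose_mul, Matrix.transpose_mul, h2, hDi]
      simp only [mul_assoc]
    · change diU D u * _ * (diU D u)⁻¹ ∈ symU k F
      rw [diU_conj_upU]
      refine upU_mem_symU ?_
      rw [mul_assoc, h3]
  · rw [symU, Subgroup.closure_le]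
    rintro _ ⟨Y, hY, rfl | rfl⟩
    · refine ⟨_, (hZ (D⁻¹.val * Y) ?_).1, ?_⟩
      · rw [← mul_assoc, Units.mul_inv, one_mul, hY]
      · change diU D u * _ * (diU D u)⁻¹ = _
        rw [diU_conj_upU]
        congr 1
        simp [mul_assoc]
    · refine ⟨_, (hZ (Y * D.val) ?_).2, ?_⟩
      · rw [Matrix.transpose_mul, Matrix.transpose_mul, hY, hD, mul_assoc]
      · change diU D u * _ * (diU D u)⁻¹ = _
        rw [diU_conj_loU]
        congr 1
        simp [mul_assoc]

end Final

theorem stmt8 (p r q k : ℕ) (hp : p.Prime) (hk : k.Prime) (hp2 : 2 < p) (hpk : p ≠ k)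
    (hr : 1 ≤ r) (hq : q = p ^ r) (h9 : q ^ k ≠ 9)
    (F : Type) [Field F] [Fintype F] (hF : Fintype.card F = q)
    (M₁ M₂ M₃ : Matrix (Fin k) (Fin k) F)
    (hunit : IsUnit (M₁ * M₂)) (hord : orderOf (M₁ * M₂) = q ^ k - 1)
    (hnc : M₁ * M₂ * M₃ ≠ M₃ * M₂ * M₁) :
    Nonempty
      ((Subgroup.closure {g : Matrix.SpecialLinearGroup (Fin 2 × Fin k) F |
          (g : Matrix (Fin 2 × Fin k) (Fin 2 × Fin k) F) = blocks2 !![1, M₁; 0, 1] ∨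
          (g : Matrix (Fin 2 × Fin k) (Fin 2 × Fin k) F) = blocks2 !![1, 0; M₂, 1] ∨
          (g : Matrix (Fin 2 × Fin k) (Fin 2 × Fin k) F) = blocks2 !![1, M₃; 0, 1]})
        ≃* SpGL (blocks2 (k := k) (F := F) !![0, -1; 1, 0])) ∨
    Subgroup.closure {g : Matrix.SpecialLinearGroup (Fin 2 × Fin k) F |
          (g : Matrix (Fin 2 × Fin k) (Fin 2 × Fin k) F) = blocks2 !![1, M₁; 0, 1] ∨
          (g : Matrix (Fin 2 × Fin k) (Fin 2 × Fin k) F) = blocks2 !![1, 0; M₂, 1] ∨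
          (g : Matrix (Fin 2 × Fin k) (Fin 2 × Fin k) F) = blocks2 !![1, M₃; 0, 1]} = ⊤ := by
  change Nonempty (Subgroup.closure (slGens M₁ M₂ M₃) ≃* _) ∨
    Subgroup.closure (slGens M₁ M₂ M₃) = ⊤
  have : Fact p.Prime := ⟨hp⟩
  have : CharP F p := charP_of_card_eq_prime_pow (hF.trans hq)
  obtain ⟨u, rfl⟩ : IsUnit M₁ := by
    rw [Matrix.isUnit_iff_isUnit_det, Matrix.det_mul] at hunit
    exact (Matrix.isUnit_iff_isUnit_det _).2 (isUnit_of_mul_isUnit_left hunit)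
  have hmap : (Subgroup.closure (slGens u.val M₂ M₃)).map (slBlock k F) =
      Subgroup.closure {upU u.val, loU M₂, upU M₃} := by
    rw [MonoidHom.map_closure, slBlock_image_slGens]
  have hg : ∀ w ∈ ({upU u.val, loU M₂, upU M₃} : Set _),
      w ∈ Subgroup.closure {upU u.val, loU M₂, upU M₃} := fun w hw => Subgroup.subset_closure hw
  rcases mat_classify p (hp.odd_of_ne_two hp2.ne') hk hpk (by rwa [hF]) u M₂ M₃ (by rwa [hF]) hnc
    (Subgroup.closure {upU u.val, loU M₂, upU M₃}) (hg _ (by simp)) (hg _ (by simp))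
    (hg _ (by simp)) with h | ⟨D, hD, h2, h3, hZ⟩
  · right
    refine eq_top_of_unipotents_mem hk.pos ?_
    rwa [hmap]
  · left
    obtain ⟨e⟩ := nonempty_symU_mulEquiv (k := k) (F := F)
    exact ⟨(((Subgroup.closure (slGens u.val M₂ M₃)).equivMapOfInjective _ slBlock_injective).trans
      (MulEquiv.subgroupCongr hmap)).trans
      ((((MulAut.conj (diU D u)).subgroupMap _).trans
        (MulEquiv.subgroupCongr (map_conj_closure_eq_symU hD h2 h3 hZ))).trans e)⟩
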